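/- Let n ≥ 2 and take the endpoint exponents p = (n+1)/(n−1) and q = (n+1)/n (the point A). Then for every α < (n+1)/n (equivalently α < 2p/(p+1)) there is a constant C such that ‖ Σ_j λ_j |e^{itΔ}f_j|² ‖_{L^q(ℝ, L^p(ℝⁿ))} ≤ C ‖{λ_j}‖_{ℓ^α} for all families {f_j} orthonormal in L²(ℝⁿ) and all {λ_j} ∈ ℓ^α; moreover, for α = (n+1)/n no such finite constant exists. -/

import Mathlib

noncomputable section

open MeasureTheory ENNReal Real Set

namespace OS

/-- `ℝⁿ` as a Euclidean space. -/
abbrev Rn (n : ℕ) := EuclideanSpace ℝ (Fin n)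

/-- The real dot product `x·ξ`, viewed as a complex number. -/
def dotC {n : ℕ} (x ξ : Rn n) : ℂ := ((∑ i, x i * ξ i : ℝ) : ℂ)

/-- The Fourier transform `f̂(ξ) = ∫ f(x) e^{-i x·ξ} dx`. -/
def FT {n : ℕ} (f : Rn n → ℂ) (ξ : Rn n) : ℂ :=
  ∫ x : Rn n, Complex.exp (-(Complex.I * dotC x ξ)) * f x

/-- The propagator `e^{itΔ}` composed with a Fourier multiplier `m`:
`x ↦ (2π)^{-n} ∫ e^{i(x·ξ - t|ξ|²)} m(ξ) f̂(ξ) dξ`. -/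
def prop {n : ℕ} (m : Rn n → ℂ) (f : Rn n → ℂ) (t : ℝ) (x : Rn n) : ℂ :=
  ((2 * π : ℝ) ^ (-(n : ℝ)) : ℝ) •
    ∫ ξ : Rn n, Complex.exp (Complex.I * (dotC x ξ - (t : ℂ) * ((‖ξ‖ : ℝ) : ℂ) ^ 2)) *
      (m ξ * FT f ξ)

/-- The free Schrödinger propagator `e^{itΔ} f`, as a function of `(t, x)`. -/
def schrodinger {n : ℕ} (f : Rn n → ℂ) : ℝ → Rn n → ℂ := prop (fun _ => 1) f

/-- The Fourier multiplier `|ξ|^{-s} ψ(2^{-k}|ξ|)` of `(-Δ)^{-s/2} P_k`. -/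
def LPmult {n : ℕ} (s : ℝ) (ψ : ℝ → ℝ) (k : ℤ) (ξ : Rn n) : ℂ :=
  ((‖ξ‖ ^ (-s) * ψ ((2 : ℝ) ^ (-k) * ‖ξ‖) : ℝ) : ℂ)

/-- The Littlewood–Paley projection `P_k h`. -/
def LP {n : ℕ} (ψ : ℝ → ℝ) (k : ℤ) (h : Rn n → ℂ) (x : Rn n) : ℂ :=
  ((2 * π : ℝ) ^ (-(n : ℝ)) : ℝ) •
    ∫ ξ : Rn n, Complex.exp (Complex.I * dotC x ξ) *
      (((ψ ((2 : ℝ) ^ (-k) * ‖ξ‖) : ℝ) : ℂ) * FT h ξ)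

/-- The standing hypotheses on the Littlewood–Paley bump function `ψ`:
smooth, `[0,1]`-valued, supported in `[1/2,2]`, with `∑_{k∈ℤ} ψ(2^{-k} r) = 1` for `r ≠ 0`. -/
structure IsLPF (ψ : ℝ → ℝ) : Prop where
  smooth : ContDiff ℝ (⊤ : ℕ∞) ψ
  mem_Icc : ∀ r, ψ r ∈ Icc (0 : ℝ) 1
  supp : Function.support ψ ⊆ Icc (1 / 2 : ℝ) 2
  sum_one : ∀ r : ℝ, r ≠ 0 → ∑' k : ℤ, ψ ((2 : ℝ) ^ (-k) * r) = 1

/-- Orthonormality in `L²(ℝⁿ)`. -/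
def OrthonormalL2 {n : ℕ} (f : ℕ → Rn n → ℂ) : Prop :=
  ∀ j k, (∫ x : Rn n, f j x * (starRingEnd ℂ) (f k x)) = if j = k then 1 else 0

/-- Orthonormality in the homogeneous Sobolev space `Ḣ^s(ℝⁿ)`:
`(2π)^{-n} ∫ |ξ|^{2s} f̂_j(ξ) conj(f̂_k(ξ)) dξ = δ_{jk}`. -/
def OrthonormalHs {n : ℕ} (s : ℝ) (f : ℕ → Rn n → ℂ) : Prop :=
  ∀ j k, ((2 * π : ℝ) ^ (-(n : ℝ)) : ℝ) •
    (∫ ξ : Rn n, ((‖ξ‖ ^ (2 * s) : ℝ) : ℂ) * (FT (f j) ξ * (starRingEnd ℂ) (FT (f k) ξ)))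
      = if j = k then 1 else 0

/-- The density `Σ_j λ_j |u_j(t,x)|²` of a system of space-time functions. -/
def density2 {n : ℕ} (lam : ℕ → ℝ) (u : ℕ → ℝ → Rn n → ℂ) (t : ℝ) (x : Rn n) : ℝ :=
  ∑' j, lam j * ‖u j t x‖ ^ 2

/-- The density `Σ_j λ_j |e^{itΔ}f_j(x)|²`. -/
def density {n : ℕ} (lam : ℕ → ℝ) (f : ℕ → Rn n → ℂ) : ℝ → Rn n → ℝ :=
  density2 lam fun j => schrodinger (f j)

/-- The `L^q` norm (w.r.t. `μ`) of an `ℝ≥0∞`-valued function. -/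
def eLp {α : Type*} [MeasurableSpace α] (μ : Measure α) (q : ℝ≥0∞) (F : α → ℝ≥0∞) : ℝ≥0∞ :=
  if q = ∞ then essSup F μ
  else (∫⁻ t, F t ^ q.toReal ∂μ) ^ (1 / q.toReal)

/-- The Lorentz `L^{p,r}` (quasi)norm of an `ℝ≥0∞`-valued function, via the
distribution function.  For `r = ∞` this is the weak-`L^p` quasinorm
`sup_{s>0} s μ(G > s)^{1/p} = sup_{t>0} t^{1/p} G^*(t)`. -/
def lor {α : Type*} [MeasurableSpace α] (μ : Measure α) (p r : ℝ≥0∞) (G : α → ℝ≥0∞) : ℝ≥0∞ :=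
  if p = ∞ then essSup G μ
  else if r = ∞ then
    ⨆ (s : ℝ) (_ : 0 < s), ENNReal.ofReal s * μ {x | ENNReal.ofReal s < G x} ^ (1 / p.toReal)
  else
    (∫⁻ s in Ioi (0 : ℝ),
      (ENNReal.ofReal s * μ {x | ENNReal.ofReal s < G x} ^ (1 / p.toReal)) ^ r.toReal *
        (ENNReal.ofReal s)⁻¹) ^ (1 / r.toReal)

/-- The mixed norm `‖u‖_{L^q(ℝ, L^p(ℝⁿ))}`. -/
def mixedLp {n : ℕ} {E : Type*} [NormedAddCommGroup E] (q p : ℝ≥0∞)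
    (u : ℝ → Rn n → E) : ℝ≥0∞ :=
  eLp volume q fun t => eLpNorm (u t) p volume

/-- The mixed norm `‖u‖_{L^{q,∞}(ℝ, L^p(ℝⁿ))}` (weak in time). -/
def mixedWeakLp {n : ℕ} {E : Type*} [NormedAddCommGroup E] (q p : ℝ≥0∞)
    (u : ℝ → Rn n → E) : ℝ≥0∞ :=
  lor volume q ∞ fun t => eLpNorm (u t) p volume

/-- The weak `L^{p,∞}(ℝⁿ)` quasinorm. -/
def wLp {n : ℕ} {E : Type*} [NormedAddCommGroup E] (p : ℝ≥0∞) (g : Rn n → E) : ℝ≥0∞ :=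
  lor volume p ∞ fun x => (‖g x‖₊ : ℝ≥0∞)

/-- The mixed Lorentz norm `‖u‖_{L^{q,r}(ℝ, L^{p,r̃}(ℝⁿ))}`. -/
def mixedLorentz {n : ℕ} {E : Type*} [NormedAddCommGroup E] (q r p rt : ℝ≥0∞)
    (u : ℝ → Rn n → E) : ℝ≥0∞ :=
  lor volume q r fun t => lor volume p rt fun x => (‖u t x‖₊ : ℝ≥0∞)

/-- The `ℓ^a` norm of a sequence (with `ℓ^∞` the supremum norm). -/
def seqNormE (a : ℝ≥0∞) (lam : ℕ → ℝ) : ℝ≥0∞ :=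
  if a = ∞ then ⨆ j, ENNReal.ofReal |lam j|
  else (∑' j, ENNReal.ofReal |lam j| ^ a.toReal) ^ (1 / a.toReal)

/-- The decreasing rearrangement of a sequence: `seqRearr lam j` is the
`(j+1)`-th largest value of `|lam i|`. -/
def seqRearr (lam : ℕ → ℝ) (j : ℕ) : ℝ≥0∞ :=
  sInf {s : ℝ≥0∞ | Measure.count {i : ℕ | s < ENNReal.ofReal |lam i|} ≤ (j : ℝ≥0∞)}

/-- The Lorentz sequence norm `‖lam‖_{ℓ^{q,r}} = (Σ_j (j^{1/q} λ*_j)^r / j)^{1/r}`,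
parametrized by `qinv = 1/q` and a finite second exponent `r`. -/
def seqLor (qinv r : ℝ) (lam : ℕ → ℝ) : ℝ≥0∞ :=
  (∑' j : ℕ, (((j : ℝ≥0∞) + 1) ^ qinv * seqRearr lam j) ^ r * ((j : ℝ≥0∞) + 1)⁻¹) ^ (1 / r)

/-- The interior of the triangle `OAB`, in the coordinates `(a, b) = (1/p, 1/q)`. -/
def IntOAB (n : ℕ) (a b : ℝ) : Prop :=
  a ∈ Ioo (0 : ℝ) 1 ∧ b ∈ Ioo (0 : ℝ) 1 ∧ b < (n : ℝ) / (n - 1) * a ∧ 2 * b + n * a < n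

/-- The interior of the quadrilateral `OCDA`, in the coordinates `(a, b) = (1/p, 1/q)`. -/
def IntOCDA (n : ℕ) (a b : ℝ) : Prop :=
  a ∈ Ioo (0 : ℝ) 1 ∧ b ∈ Ioo (0 : ℝ) 1 ∧ (n : ℝ) / (n - 1) * a < b ∧ 2 * b + n * a < n

def ptO : ℝ × ℝ := (0, 0)
def ptA (n : ℕ) : ℝ × ℝ := (((n : ℝ) - 1) / (n + 1), (n : ℝ) / (n + 1))
def ptB : ℝ × ℝ := (1, 0)
def ptC : ℝ × ℝ := (0, 1)
def ptD (n : ℕ) : ℝ × ℝ := (((n : ℝ) - 2) / n, 1)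

/-- The closed triangle `OAB`. -/
def OAB (n : ℕ) : Set (ℝ × ℝ) := convexHull ℝ {ptO, ptA n, ptB}

/-- The closed quadrilateral `OCDA`. -/
def OCDA (n : ℕ) : Set (ℝ × ℝ) := convexHull ℝ {ptO, ptC, ptD n, ptA n}

/-- The half-open segment `[A, D)`. -/
def segAD (n : ℕ) : Set (ℝ × ℝ) := {x | ∃ t ∈ Ico (0 : ℝ) 1, x = (1 - t) • ptA n + t • ptD n}

/-- The Lebesgue exponent with reciprocal `a` (so `expOf 0 = ∞`). -/
def expOf (a : ℝ) : ℝ≥0∞ := (ENNReal.ofReal a)⁻¹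

/-- The weighted velocity average `∫ f(x - tv, v) |v|^{-2s} dv` of the solution of
the kinetic transport equation with datum `f`. -/
def velAvg {n : ℕ} (s : ℝ) (f : Rn n × Rn n → ℂ) (t : ℝ) (x : Rn n) : ℂ :=
  ∫ v : Rn n, ((‖v‖ ^ (-(2 * s)) : ℝ) : ℂ) * f (x - t • v, v)

end OS

open OS

lemma lintegral_mul_sq_le {α : Type*} [MeasurableSpace α] {μ : Measure α} {f g : α → ℝ≥0∞}
    (hf : AEMeasurable f μ) (hg : AEMeasurable g μ) :
    (∫⁻ a, f a * g a ∂μ) ^ 2 ≤ (∫⁻ a, f a ^ 2 ∂μ) * ∫⁻ a, g a ^ 2 ∂μ := by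
  have h := ENNReal.lintegral_mul_le_Lp_mul_Lq μ (Real.HolderConjugate.two_two) hf hg
  simp only [ENNReal.rpow_two, Pi.mul_apply] at h
  calc _ ≤ ((∫⁻ a, f a ^ 2 ∂μ) ^ (1 / 2 : ℝ) * (∫⁻ a, g a ^ 2 ∂μ) ^ (1 / 2 : ℝ)) ^ 2 := by gcongr
    _ = _ := by
      rw [mul_pow, ← ENNReal.rpow_two, ← ENNReal.rpow_two, ← ENNReal.rpow_mul, ← ENNReal.rpow_mul]
      norm_num

/-- A measurable bounded function whose support has finite measure. -/
structure FinSupp {Z : Type*} [MeasurableSpace Z] (ζ : Measure Z) (p : Z → ℂ) : Prop where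
  meas : Measurable p
  bdd : ∃ M, ∀ z, ‖p z‖ ≤ M
  fin : ζ (Function.support p) < ∞

namespace FinSupp
variable {Z : Type*} [MeasurableSpace Z] {ζ : Measure Z} {p : Z → ℂ}

lemma integrable (hp : FinSupp ζ p) : Integrable p ζ := by
  obtain ⟨M, hM⟩ := hp.bdd
  have hS : MeasurableSet (Function.support p) := measurableSet_support hp.meas
  have : IntegrableOn p (Function.support p) ζ :=
    Measure.integrableOn_of_bounded hp.fin.ne hp.meas.aestronglyMeasurable (M := M) (by simp [hM])
  rwa [integrableOn_iff_integrable_of_support_subset subset_rfl] at this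

lemma lintegral_lt_top (hp : FinSupp ζ p) : ∫⁻ z, ‖p z‖ₑ ^ 2 ∂ζ < ∞ := by
  obtain ⟨M, hM⟩ := hp.bdd
  calc ∫⁻ z, ‖p z‖ₑ ^ 2 ∂ζ ≤ ∫⁻ z, ENNReal.ofReal M * ‖p z‖ₑ ∂ζ := by
        refine lintegral_mono fun z => ?_
        rw [sq]
        gcongr
        rw [← ofReal_norm]
        exact ENNReal.ofReal_le_ofReal (hM z)
    _ = ENNReal.ofReal M * ∫⁻ z, ‖p z‖ₑ ∂ζ := lintegral_const_mul _ hp.meas.enorm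
    _ < ∞ := ENNReal.mul_lt_top ENNReal.ofReal_lt_top hp.integrable.2

lemma indicator (hp : FinSupp ζ p) {s : Set Z} (hs : MeasurableSet s) :
    FinSupp ζ (s.indicator p) := by
  obtain ⟨M, hM⟩ := hp.bdd
  refine ⟨hp.meas.indicator hs, ⟨M, fun z => (norm_indicator_le_norm_self _ _).trans (hM z)⟩, ?_⟩
  refine (measure_mono ?_).trans_lt hp.fin
  simp

end FinSupp

section Abstract

variable {H : Type*} [NormedAddCommGroup H] [InnerProductSpace ℂ H] [CompleteSpace H]
  {X : Type*} [MeasurableSpace X]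

/-- A bounded measurable field of vectors over space-time with the slice-wise `L²` bound and the
dispersive decay. -/
structure Dispersive (n : ℕ) (μ : Measure X) (v : ℝ × X → H) : Prop where
  meas : StronglyMeasurable v
  bdd : ∃ M, ∀ z, ‖v z‖ ≤ M
  slice : ∀ t w, ∫⁻ x, ‖inner ℂ (v (t, x)) w‖ₑ ^ 2 ∂μ ≤ ‖w‖ₑ ^ 2
  decay : ∀ t s x y, t ≠ s →
    ‖inner ℂ (v (t, x)) (v (s, y))‖ₑ ^ 2 ≤ ENNReal.ofReal ((|t - s| ^ n)⁻¹)

/-- The synthesis operator `p ↦ ∫ p v`. -/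
def synth {Z : Type*} [MeasurableSpace Z] (ζ : Measure Z) (v : Z → H) (p : Z → ℂ) : H :=
  ∫ z, p z • v z ∂ζ

variable {Z : Type*} [MeasurableSpace Z] {ζ : Measure Z} {w : Z → H}

lemma integrable_smul_field {p : Z → ℂ} (hp : Integrable p ζ) (hw : StronglyMeasurable w)
    (hb : ∃ M, ∀ z, ‖w z‖ ≤ M) : Integrable (fun z => p z • w z) ζ := by
  obtain ⟨M, hM⟩ := hb
  exact hp.smul_bdd M hw.aestronglyMeasurable (Filter.Eventually.of_forall hM)

lemma inner_synth {p : Z → ℂ} (hp : Integrable p ζ) (hw : StronglyMeasurable w)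
    (hb : ∃ M, ∀ z, ‖w z‖ ≤ M) (e : H) :
    inner ℂ e (synth ζ w p) = ∫ z, p z * inner ℂ e (w z) ∂ζ := by
  rw [synth, ← integral_inner (integrable_smul_field hp hw hb) e]
  simp [inner_smul_right]

/-- The integrand of `⟪synth p, synth p'⟫` as a double integral. -/
def pairKer {Z : Type*} (w : Z → H) (p p' : Z → ℂ) (y : Z × Z) : ℂ :=
  (starRingEnd ℂ) (p y.1) * p' y.2 * inner ℂ (w y.1) (w y.2)

lemma synth_inner_synth [SFinite ζ] {p p' : Z → ℂ} (hp : Integrable p ζ) (hp' : Integrable p' ζ)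
    (hw : StronglyMeasurable w) (hb : ∃ M, ∀ z, ‖w z‖ ≤ M) :
    Integrable (pairKer w p p') (ζ.prod ζ) ∧
    inner ℂ (synth ζ w p) (synth ζ w p') = ∫ y, pairKer w p p' y ∂(ζ.prod ζ) := by
  obtain ⟨M, hM⟩ := id hb
  have h1 : Integrable (pairKer w p p') (ζ.prod ζ) := by
    have h2 : Integrable (fun y : Z × Z => (starRingEnd ℂ) (p y.1) * p' y.2) (ζ.prod ζ) :=
      Integrable.mul_prod (f := fun z => (starRingEnd ℂ) (p z))
        ((LinearIsometryEquiv.integrable_comp_iff Complex.conjLIE).2 hp) hp'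
    refine h2.mul_bdd (c := M * M) ?_ (Filter.Eventually.of_forall fun y => ?_)
    · exact ((hw.comp_measurable measurable_fst).inner
        (hw.comp_measurable measurable_snd)).aestronglyMeasurable
    · refine (norm_inner_le_norm _ _).trans ?_
      gcongr
      · exact (norm_nonneg _).trans (hM y.1)
      · exact hM _
      · exact hM _
  refine ⟨h1, ?_⟩
  rw [integral_prod _ h1, inner_synth hp' hw hb, ← integral_prod _ h1, integral_prod_symm _ h1]
  congr 1; ext z
  rw [← inner_conj_symm, inner_synth hp hw hb, ← integral_conj, ← integral_const_mul]
  congr 1; ext y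
  rw [pairKer, map_mul, inner_conj_symm]; ring

end Abstract

section NearFar

variable {H : Type*} [NormedAddCommGroup H] [InnerProductSpace ℂ H] [CompleteSpace H]
  {X : Type*} [MeasurableSpace X] {μ : Measure X} [SigmaFinite μ] {n : ℕ} {v : ℝ × X → H}

/-- Space-time points at time distance at most `τ` from `t`. -/
def timeWindow (X : Type*) (τ t : ℝ) : Set (ℝ × X) := {z | |z.1 - t| ≤ τ}

lemma measurableSet_timeWindow (τ t : ℝ) : MeasurableSet (timeWindow X τ t) :=
  measurableSet_le (by fun_prop) measurable_const

lemma volume_abs_sub_le (τ t : ℝ) : volume {s : ℝ | |s - t| ≤ τ} = ENNReal.ofReal (2 * τ) := by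
  have : {s : ℝ | |s - t| ≤ τ} = Icc (t - τ) (t + τ) := by
    ext s; simp only [mem_ofPred_eq, abs_le, mem_Icc]; constructor <;> rintro ⟨h, h'⟩ <;>
      constructor <;> linarith
  rw [this, Real.volume_Icc]; congr 1; ring

lemma Dispersive.synth_window_le (hv : Dispersive n μ v) {q : ℝ × X → ℂ}
    (hq : FinSupp (volume.prod μ) q) {τ t : ℝ} (hs : ∀ z, q z ≠ 0 → z ∈ timeWindow X τ t) :
    ‖synth (volume.prod μ) v q‖ₑ ^ 2 ≤
      ENNReal.ofReal (2 * τ) * ∫⁻ z, ‖q z‖ₑ ^ 2 ∂(volume.prod μ) := by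
  set e := synth (volume.prod μ) v q with he
  by_cases h0 : e = 0
  · simp [h0]
  have hm : Measurable fun z => ‖inner ℂ (v z) e‖ₑ :=
    (hv.meas.inner stronglyMeasurable_const).enorm
  have h1 : ‖e‖ₑ ^ 2 ≤ ∫⁻ z, ‖q z‖ₑ *
      (timeWindow X τ t).indicator (fun z => ‖inner ℂ (v z) e‖ₑ) z ∂(volume.prod μ) := by
    have : ‖e‖ₑ ^ 2 = ‖inner ℂ e e‖ₑ := by
      rw [inner_self_eq_norm_sq_to_K, ← ofReal_norm, ← ofReal_norm, ← ENNReal.ofReal_pow (by simp)]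
      simp
    rw [this]
    nth_rewrite 2 [he]
    rw [inner_synth hq.integrable hv.meas hv.bdd]
    refine (enorm_integral_le_lintegral_enorm _).trans (lintegral_mono fun z => ?_)
    rw [enorm_mul]
    by_cases hz : q z = 0
    · simp [hz]
    · rw [indicator_of_mem (hs z hz), ← ofReal_norm (inner ℂ (v z) e), norm_inner_symm, ofReal_norm]
  have h2 : ∫⁻ z, (timeWindow X τ t).indicator (fun z => ‖inner ℂ (v z) e‖ₑ) z ^ 2
      ∂(volume.prod μ) ≤ ENNReal.ofReal (2 * τ) * ‖e‖ₑ ^ 2 := by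
    rw [lintegral_prod _ ((hm.indicator (measurableSet_timeWindow _ _)).pow_const 2).aemeasurable]
    calc _ ≤ ∫⁻ s, {s : ℝ | |s - t| ≤ τ}.indicator (fun _ => ‖e‖ₑ ^ 2) s := by
          refine lintegral_mono fun s => ?_
          by_cases h : |s - t| ≤ τ
          · rw [indicator_of_mem (by exact h)]
            refine le_trans (lintegral_mono fun x => ?_) (hv.slice s e)
            gcongr
            exact indicator_le_self _ _ _
          · simp [timeWindow, indicator, h]
      _ = _ := by
          rw [lintegral_indicator_const (measurableSet_le (by fun_prop) measurable_const),
            volume_abs_sub_le, mul_comm]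
  have h3 : (‖e‖ₑ ^ 2) ^ 2 ≤ (∫⁻ z, ‖q z‖ₑ ^ 2 ∂(volume.prod μ)) *
      (ENNReal.ofReal (2 * τ) * ‖e‖ₑ ^ 2) := by
    refine le_trans (by gcongr) ((lintegral_mul_sq_le hq.meas.enorm.aemeasurable
      (hm.indicator (measurableSet_timeWindow _ _)).aemeasurable).trans ?_)
    gcongr
  have h4 : ‖e‖ₑ ^ 2 ≠ 0 := by simpa using h0
  have h5 : ‖e‖ₑ ^ 2 ≠ ∞ := by simp
  rw [sq (‖e‖ₑ ^ 2), ← mul_assoc] at h3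
  rw [mul_comm (ENNReal.ofReal _)]
  exact (ENNReal.mul_le_mul_iff_left h4 h5).1 h3

/-- The pairs of space-time points at time distance at most `τ`. -/
def nearPairs (X : Type*) (τ : ℝ) : Set ((ℝ × X) × (ℝ × X)) := {y | |y.2.1 - y.1.1| ≤ τ}

lemma measurableSet_nearPairs (τ : ℝ) : MeasurableSet (nearPairs X τ) :=
  measurableSet_le (by fun_prop) measurable_const

lemma Dispersive.near_le (hv : Dispersive n μ v) {p p' : ℝ × X → ℂ}
    (hp : FinSupp (volume.prod μ) p) (hp' : FinSupp (volume.prod μ) p') {τ R : ℝ}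
    (hR : ∀ t, ‖synth (volume.prod μ) v ((timeWindow X τ t).indicator p')‖ₑ ^ 2 ≤
      ENNReal.ofReal (R ^ 2) *
        ∫⁻ z, ‖(timeWindow X τ t).indicator p' z‖ₑ ^ 2 ∂(volume.prod μ)) :
    ‖∫ y in nearPairs X τ, pairKer v p p' y ∂((volume.prod μ).prod (volume.prod μ))‖ₑ ^ 2 ≤
      ENNReal.ofReal (R ^ 2) * ENNReal.ofReal (2 * τ) * (∫⁻ z, ‖p z‖ₑ ^ 2 ∂(volume.prod μ)) *
        ∫⁻ z, ‖p' z‖ₑ ^ 2 ∂(volume.prod μ) := by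
  set ζ := (volume : Measure ℝ).prod μ
  have hW : MeasurableSet {y : ℝ × (ℝ × X) | |y.2.1 - y.1| ≤ τ} :=
    measurableSet_le (by fun_prop) measurable_const
  have hind : StronglyMeasurable fun y : ℝ × (ℝ × X) => (timeWindow X τ y.1).indicator p' y.2 := by
    have : Measurable ({y : ℝ × (ℝ × X) | |y.2.1 - y.1| ≤ τ}.indicator fun y => p' y.2) :=
      (hp'.meas.comp measurable_snd).indicator hW
    exact this.stronglyMeasurable
  set h : ℝ → H := fun t => synth ζ v ((timeWindow X τ t).indicator p')
  have hh : StronglyMeasurable h :=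
    StronglyMeasurable.integral_prod_right (f := fun t z => (timeWindow X τ t).indicator p' z • v z)
      (hind.smul (hv.meas.comp_measurable measurable_snd))
  have hin : StronglyMeasurable fun z : ℝ × X => inner ℂ (v z) (h z.1) :=
    hv.meas.inner (hh.comp_measurable measurable_fst)
  have hG := (synth_inner_synth hp.integrable hp'.integrable hv.meas hv.bdd).1
  have e1 : ∫ y in nearPairs X τ, pairKer v p p' y ∂(ζ.prod ζ) =
      ∫ z, (starRingEnd ℂ) (p z) * inner ℂ (v z) (h z.1) ∂ζ := by
    rw [← integral_indicator (measurableSet_nearPairs τ),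
      integral_prod _ (hG.indicator (measurableSet_nearPairs τ))]
    congr 1; ext z
    rw [inner_synth (hp'.integrable.indicator (measurableSet_timeWindow _ _)) hv.meas hv.bdd,
      ← integral_const_mul]
    congr 1; ext z'
    by_cases hz : |z'.1 - z.1| ≤ τ
    · rw [indicator_of_mem (by exact hz), indicator_of_mem (by exact hz), pairKer, mul_assoc]
    · rw [indicator_of_notMem (by exact hz), indicator_of_notMem (by exact hz)]; simp
  rw [e1]
  have h1 : ‖∫ z, (starRingEnd ℂ) (p z) * inner ℂ (v z) (h z.1) ∂ζ‖ₑ ≤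
      ∫⁻ z, ‖p z‖ₑ * ‖inner ℂ (v z) (h z.1)‖ₑ ∂ζ := by
    refine (enorm_integral_le_lintegral_enorm _).trans_eq ?_
    congr 1; ext z
    rw [enorm_mul, ← ofReal_norm ((starRingEnd ℂ) (p z)), RCLike.norm_conj, ofReal_norm]
  have h2 : ∫⁻ z, ‖inner ℂ (v z) (h z.1)‖ₑ ^ 2 ∂ζ ≤
      ENNReal.ofReal (R ^ 2) * (ENNReal.ofReal (2 * τ) * ∫⁻ z, ‖p' z‖ₑ ^ 2 ∂ζ) := by
    have hmm : Measurable fun y : ℝ × (ℝ × X) => ‖(timeWindow X τ y.1).indicator p' y.2‖ₑ ^ 2 :=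
      hind.enorm.pow_const 2
    calc _ = ∫⁻ t, ∫⁻ x, ‖inner ℂ (v (t, x)) (h t)‖ₑ ^ 2 ∂μ :=
          lintegral_prod _ (hin.enorm.pow_const 2).aemeasurable
      _ ≤ ∫⁻ t, ‖h t‖ₑ ^ 2 := lintegral_mono fun t => hv.slice t _
      _ ≤ ∫⁻ t, ENNReal.ofReal (R ^ 2) * ∫⁻ z, ‖(timeWindow X τ t).indicator p' z‖ₑ ^ 2 ∂ζ :=
          lintegral_mono hR
      _ = ENNReal.ofReal (R ^ 2) * ∫⁻ t, ∫⁻ z, ‖(timeWindow X τ t).indicator p' z‖ₑ ^ 2 ∂ζ :=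
          lintegral_const_mul _ hmm.lintegral_prod_right'
      _ = ENNReal.ofReal (R ^ 2) * ∫⁻ z, (∫⁻ t, ‖(timeWindow X τ t).indicator p' z‖ₑ ^ 2) ∂ζ := by
          rw [lintegral_lintegral_swap hmm.aemeasurable]
      _ = _ := by
          congr 1
          rw [← lintegral_const_mul _ (hp'.meas.enorm.pow_const 2)]
          refine lintegral_congr fun z => ?_
          rw [← volume_abs_sub_le τ z.1, mul_comm, ← lintegral_indicator_const
            (measurableSet_le (by fun_prop) measurable_const)]
          congr 1; ext t
          by_cases hz : |z.1 - t| ≤ τ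
          · rw [indicator_of_mem (by exact hz), indicator_of_mem]
            rwa [mem_ofPred_eq, abs_sub_comm]
          · rw [indicator_of_notMem (by exact hz), indicator_of_notMem]
            · simp
            · rwa [mem_ofPred_eq, abs_sub_comm]
  calc _ ≤ (∫⁻ z, ‖p z‖ₑ * ‖inner ℂ (v z) (h z.1)‖ₑ ∂ζ) ^ 2 := by gcongr
    _ ≤ _ := lintegral_mul_sq_le hp.meas.enorm.aemeasurable hin.enorm.aemeasurable
    _ ≤ (∫⁻ z, ‖p z‖ₑ ^ 2 ∂ζ) *
        (ENNReal.ofReal (R ^ 2) * (ENNReal.ofReal (2 * τ) * ∫⁻ z, ‖p' z‖ₑ ^ 2 ∂ζ)) := by gcongr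
    _ = _ := by ring

lemma Dispersive.far_le (hv : Dispersive n μ v) {ι : Type*} (J : Finset ι) {p p' : ι → ℝ × X → ℂ}
    (hp : ∀ j, FinSupp (volume.prod μ) (p j)) (hp' : ∀ j, FinSupp (volume.prod μ) (p' j))
    {E E' : Set (ℝ × X)} (hE : MeasurableSet E) (hE' : MeasurableSet E')
    (hpE : ∀ j z, z ∉ E → p j z = 0) (hpE' : ∀ j z, z ∉ E' → p' j z = 0) {τ : ℝ} (hτ : 0 ≤ τ) :
    ‖∑ j ∈ J, ∫ y in (nearPairs X τ)ᶜ, pairKer v (p j) (p' j) y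
        ∂((volume.prod μ).prod (volume.prod μ))‖ₑ ^ 2 ≤
      (∫⁻ y, ‖∑ j ∈ J, (starRingEnd ℂ) (p j y.1) * p' j y.2‖ₑ ^ 2
        ∂((volume.prod μ).prod (volume.prod μ))) *
      ∫⁻ y in (nearPairs X τ)ᶜ ∩ E ×ˢ E', ENNReal.ofReal ((|y.1.1 - y.2.1| ^ n)⁻¹)
        ∂((volume.prod μ).prod (volume.prod μ)) := by
  set ζ := (volume : Measure ℝ).prod μ
  have hG := fun j => (synth_inner_synth (hp j).integrable (hp' j).integrable hv.meas hv.bdd).1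
  have hF : MeasurableSet ((nearPairs X τ)ᶜ ∩ E ×ˢ E') :=
    (measurableSet_nearPairs τ).compl.inter (hE.prod hE')
  have hK : Measurable fun y : (ℝ × X) × (ℝ × X) => ‖inner ℂ (v y.1) (v y.2)‖ₑ :=
    ((hv.meas.comp_measurable measurable_fst).inner (hv.meas.comp_measurable measurable_snd)).enorm
  have hΓ : Measurable fun y : (ℝ × X) × (ℝ × X) =>
      ‖∑ j ∈ J, (starRingEnd ℂ) (p j y.1) * p' j y.2‖ₑ := by
    refine (Finset.measurable_sum _ fun j _ => ?_).enorm
    exact (Complex.continuous_conj.measurable.comp ((hp j).meas.comp measurable_fst)).mul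
      ((hp' j).meas.comp measurable_snd)
  have h1 : ‖∑ j ∈ J, ∫ y in (nearPairs X τ)ᶜ, pairKer v (p j) (p' j) y ∂(ζ.prod ζ)‖ₑ ≤
      ∫⁻ y, ‖∑ j ∈ J, (starRingEnd ℂ) (p j y.1) * p' j y.2‖ₑ *
        ((nearPairs X τ)ᶜ ∩ E ×ˢ E').indicator (fun y => ‖inner ℂ (v y.1) (v y.2)‖ₑ) y
          ∂(ζ.prod ζ) := by
    rw [← integral_finsetSum _ fun j _ => (hG j).integrableOn,
      ← integral_indicator (measurableSet_nearPairs τ).compl]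
    refine (enorm_integral_le_lintegral_enorm _).trans (lintegral_mono fun y => ?_)
    by_cases hy : y ∈ (nearPairs X τ)ᶜ
    · rw [indicator_of_mem hy]
      by_cases hz : y ∈ E ×ˢ E'
      · rw [indicator_of_mem (show y ∈ (nearPairs X τ)ᶜ ∩ E ×ˢ E' from ⟨hy, hz⟩), ← enorm_mul, Finset.sum_mul]; rfl
      · have : ∀ j ∈ J, pairKer v (p j) (p' j) y = 0 := by
          intro j _
          rw [mem_prod, not_and_or] at hz
          rcases hz with hz | hz
          · simp [pairKer, hpE j _ hz]
          · simp [pairKer, hpE' j _ hz]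
        rw [Finset.sum_eq_zero this]; simp
    · rw [indicator_of_notMem hy]; simp
  calc _ ≤ _ := by gcongr
    _ ≤ _ := lintegral_mul_sq_le hΓ.aemeasurable (hK.indicator hF).aemeasurable
    _ ≤ _ := by
      refine mul_le_mul_right ?_ _
      rw [← lintegral_indicator hF]
      refine lintegral_mono fun y => ?_
      by_cases hy : y ∈ (nearPairs X τ)ᶜ ∩ E ×ˢ E'
      · rw [indicator_of_mem hy, indicator_of_mem hy]
        refine hv.decay _ _ _ _ fun h => hy.1 ?_
        simp [nearPairs, h, hτ]
      · rw [indicator_of_notMem hy]; simp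

end NearFar

section FarTime

/-- The truncated dispersive kernel. -/
def farKer (n : ℕ) (τ r : ℝ) : ℝ≥0∞ := {r : ℝ | τ < |r|}.indicator
  (fun r => ENNReal.ofReal ((|r| ^ n)⁻¹)) r

lemma measurable_farKer (n : ℕ) (τ : ℝ) : Measurable (farKer n τ) := by
  refine Measurable.indicator ?_ (measurableSet_lt measurable_const (by fun_prop))
  exact ((measurable_id.abs.pow_const n).inv).ennreal_ofReal

lemma lintegral_Ioi_pow_inv_le {n : ℕ} (hn : 2 ≤ n) {τ : ℝ} (hτ : 0 < τ) :
    ∫⁻ r in Ioi τ, ENNReal.ofReal ((|r| ^ n)⁻¹) ≤ ENNReal.ofReal ((τ ^ (n - 1))⁻¹) := by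
  have hn' : (2 : ℝ) ≤ n := by exact_mod_cast hn
  have h1 : ∫⁻ r in Ioi τ, ENNReal.ofReal ((|r| ^ n)⁻¹) =
      ∫⁻ r in Ioi τ, ENNReal.ofReal (r ^ (-(n : ℝ))) := by
    refine setLIntegral_congr_fun measurableSet_Ioi fun r hr => ?_
    have : 0 < r := hτ.trans hr
    rw [abs_of_pos this, Real.rpow_neg this.le, Real.rpow_natCast]
  rw [h1, ← ofReal_integral_eq_lintegral_ofReal (integrableOn_Ioi_rpow_of_lt (by linarith) hτ)
    ((ae_restrict_mem measurableSet_Ioi).mono fun r hr => Real.rpow_nonneg (hτ.trans hr).le _),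
    integral_Ioi_rpow_of_lt (by linarith) hτ]
  refine ENNReal.ofReal_le_ofReal ?_
  have h2 : τ ^ (-(n : ℝ) + 1) = (τ ^ (n - 1))⁻¹ := by
    rw [← Real.rpow_natCast, ← Real.rpow_neg hτ.le, Nat.cast_sub (by omega)]
    congr 1; push_cast; ring
  rw [h2, neg_div, ← div_neg]
  exact div_le_self (by positivity) (by linarith)

lemma lintegral_farKer_le {n : ℕ} (hn : 2 ≤ n) {τ : ℝ} (hτ : 0 < τ) :
    ∫⁻ r, farKer n τ r ≤ ENNReal.ofReal (2 * (τ ^ (n - 1))⁻¹) := by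
  have hset : {r : ℝ | τ < |r|} = Iio (-τ) ∪ Ioi τ := by
    ext r; simp only [mem_ofPred_eq, mem_union, mem_Iio, mem_Ioi, lt_abs]; constructor <;>
      rintro (h | h) <;> first | (left; linarith) | (right; linarith)
  have h2 : ∫⁻ r in Iio (-τ), ENNReal.ofReal ((|r| ^ n)⁻¹) =
      ∫⁻ r in Ioi τ, ENNReal.ofReal ((|r| ^ n)⁻¹) := by
    rw [← lintegral_indicator measurableSet_Iio, ← lintegral_indicator measurableSet_Ioi,
      ← (Measure.measurePreserving_neg (volume : Measure ℝ)).lintegral_comp_emb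
        (MeasurableEquiv.neg ℝ).measurableEmbedding]
    refine lintegral_congr fun r => ?_
    by_cases h : τ < r
    · rw [indicator_of_mem (by simpa using h), indicator_of_mem (by exact h), abs_neg]
    · rw [indicator_of_notMem (by simpa using h), indicator_of_notMem (by exact h)]
  have h3 := lintegral_Ioi_pow_inv_le hn hτ
  unfold farKer
  rw [lintegral_indicator (measurableSet_lt measurable_const (by fun_prop)), hset]
  refine (lintegral_union_le _ _ _).trans ?_
  rw [h2, two_mul, ENNReal.ofReal_add (by positivity) (by positivity)]
  gcongr

lemma young_sq_le {k a a' : ℝ → ℝ≥0∞} (hk : Measurable k) (ha : Measurable a)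
    (ha' : Measurable a') :
    (∫⁻ t, ∫⁻ s, k (t - s) * a t * a' s) ^ 2 ≤
      (∫⁻ r, k r) ^ 2 * (∫⁻ t, a t ^ 2) * ∫⁻ t, a' t ^ 2 := by
  have hk2 : Measurable fun y : ℝ × ℝ => k (y.1 - y.2) := hk.comp (by fun_prop)
  have e : ∀ x : ℝ≥0∞, (x ^ (1 / 2 : ℝ)) ^ 2 = x := fun x => by
    rw [← ENNReal.rpow_two, ← ENNReal.rpow_mul]; norm_num
  have hf : Measurable fun y : ℝ × ℝ => k (y.1 - y.2) ^ (1 / 2 : ℝ) * a y.1 :=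
    (hk2.pow_const _).mul (ha.comp measurable_fst)
  have hg : Measurable fun y : ℝ × ℝ => k (y.1 - y.2) ^ (1 / 2 : ℝ) * a' y.2 :=
    (hk2.pow_const _).mul (ha'.comp measurable_snd)
  have h := lintegral_mul_sq_le (μ := (volume : Measure ℝ).prod volume) hf.aemeasurable
    hg.aemeasurable
  have h1 : ∫⁻ y : ℝ × ℝ, k (y.1 - y.2) ^ (1 / 2 : ℝ) * a y.1 *
      (k (y.1 - y.2) ^ (1 / 2 : ℝ) * a' y.2) ∂((volume : Measure ℝ).prod volume) =
      ∫⁻ t, ∫⁻ s, k (t - s) * a t * a' s := by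
    refine (lintegral_prod _ (hf.mul hg).aemeasurable).trans ?_
    refine lintegral_congr fun t => lintegral_congr fun s => ?_
    change k (t - s) ^ (1 / 2 : ℝ) * a t * (k (t - s) ^ (1 / 2 : ℝ) * a' s) = _
    nth_rewrite 3 [← e (k (t - s))]
    ring
  have h2 : ∫⁻ y : ℝ × ℝ, (k (y.1 - y.2) ^ (1 / 2 : ℝ) * a y.1) ^ 2
      ∂((volume : Measure ℝ).prod volume) = (∫⁻ r, k r) * ∫⁻ t, a t ^ 2 := by
    rw [lintegral_prod _ (hf.pow_const 2).aemeasurable, ← lintegral_const_mul _ (ha.pow_const 2)]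
    refine lintegral_congr fun t => ?_
    simp only [mul_pow, e]
    have hks : Measurable fun s => k (t - s) := hk.comp (by fun_prop)
    rw [lintegral_mul_const _ hks]
    congr 1
    exact lintegral_sub_left_eq_self k t
  have h3 : ∫⁻ y : ℝ × ℝ, (k (y.1 - y.2) ^ (1 / 2 : ℝ) * a' y.2) ^ 2
      ∂((volume : Measure ℝ).prod volume) = (∫⁻ r, k r) * ∫⁻ t, a' t ^ 2 := by
    rw [lintegral_prod_symm _ (hg.pow_const 2).aemeasurable,
      ← lintegral_const_mul _ (ha'.pow_const 2)]
    refine lintegral_congr fun t => ?_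
    simp only [mul_pow, e]
    have hks : Measurable fun s => k (s - t) := hk.comp (by fun_prop)
    rw [lintegral_mul_const _ hks]
    congr 1
    exact lintegral_sub_right_eq_self k t
  rw [h1, h2, h3] at h
  exact h.trans_eq (by ring)

variable {X : Type*} [MeasurableSpace X] {μ : Measure X} [SigmaFinite μ]

/-- The measure of the time slices of a space-time set. -/
def sliceMeas (μ : Measure X) (E : Set (ℝ × X)) (t : ℝ) : ℝ≥0∞ := μ (Prod.mk t ⁻¹' E)

lemma measurable_sliceMeas {E : Set (ℝ × X)} (hE : MeasurableSet E) :
    Measurable (sliceMeas μ E) := measurable_measure_prodMk_left hE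

lemma setLIntegral_comp_fst {E : Set (ℝ × X)} (hE : MeasurableSet E) {g : ℝ → ℝ≥0∞}
    (hg : Measurable g) :
    ∫⁻ z in E, g z.1 ∂((volume : Measure ℝ).prod μ) = ∫⁻ t, g t * sliceMeas μ E t := by
  rw [← lintegral_indicator hE]
  refine (lintegral_prod _ ((hg.comp measurable_fst).indicator hE).aemeasurable).trans ?_
  refine lintegral_congr fun t => ?_
  rw [sliceMeas, ← lintegral_indicator_const (measurable_prodMk_left hE)]
  rfl

lemma lintegral_far_sq_le {n : ℕ} (hn : 2 ≤ n) {τ : ℝ} (hτ : 0 < τ) {E E' : Set (ℝ × X)}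
    (hE : MeasurableSet E) (hE' : MeasurableSet E') :
    (∫⁻ y in (nearPairs X τ)ᶜ ∩ E ×ˢ E', ENNReal.ofReal ((|y.1.1 - y.2.1| ^ n)⁻¹)
        ∂(((volume : Measure ℝ).prod μ).prod ((volume : Measure ℝ).prod μ))) ^ 2 ≤
      ENNReal.ofReal (2 * (τ ^ (n - 1))⁻¹) ^ 2 * (∫⁻ t, sliceMeas μ E t ^ 2) *
        ∫⁻ t, sliceMeas μ E' t ^ 2 := by
  set ζ := (volume : Measure ℝ).prod μ
  have hk := measurable_farKer n τ
  have hkk : Measurable fun y : (ℝ × X) × (ℝ × X) => farKer n τ (y.1.1 - y.2.1) :=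
    hk.comp (by fun_prop)
  have hk' : Measurable fun y : ℝ × (ℝ × X) => farKer n τ (y.1 - y.2.1) := hk.comp (by fun_prop)
  have h1 : ∫⁻ y in (nearPairs X τ)ᶜ ∩ E ×ˢ E', ENNReal.ofReal ((|y.1.1 - y.2.1| ^ n)⁻¹)
      ∂(ζ.prod ζ) = ∫⁻ y in E ×ˢ E', farKer n τ (y.1.1 - y.2.1) ∂(ζ.prod ζ) := by
    rw [← lintegral_indicator (((measurableSet_nearPairs τ).compl.inter (hE.prod hE'))),
      ← lintegral_indicator (hE.prod hE')]
    refine lintegral_congr fun y => ?_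
    rw [inter_comm, ← indicator_indicator]
    congr 1; ext y
    by_cases hy : y ∈ (nearPairs X τ)ᶜ
    · rw [indicator_of_mem hy, farKer, indicator_of_mem]
      rw [mem_ofPred_eq, abs_sub_comm]; simpa [nearPairs] using hy
    · rw [indicator_of_notMem hy, farKer, indicator_of_notMem]
      rw [mem_ofPred_eq, abs_sub_comm]; simpa [nearPairs] using hy
  have h2 : ∫⁻ y in E ×ˢ E', farKer n τ (y.1.1 - y.2.1) ∂(ζ.prod ζ) =
      ∫⁻ t, ∫⁻ s, farKer n τ (t - s) * sliceMeas μ E t * sliceMeas μ E' s := by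
    rw [← Measure.prod_restrict, lintegral_prod _ hkk.aemeasurable]
    have : ∀ z : ℝ × X, ∫⁻ z' in E', farKer n τ (z.1 - z'.1) ∂ζ =
        (fun t => ∫⁻ s, farKer n τ (t - s) * sliceMeas μ E' s) z.1 := fun z =>
      setLIntegral_comp_fst hE' (g := fun s => farKer n τ (z.1 - s)) (hk.comp (by fun_prop))
    simp_rw [this]
    have hm : Measurable fun y : ℝ × ℝ => farKer n τ (y.1 - y.2) * sliceMeas μ E' y.2 :=
      (hk.comp (by fun_prop)).mul ((measurable_sliceMeas hE').comp measurable_snd)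
    rw [setLIntegral_comp_fst hE (g := fun t => ∫⁻ s, farKer n τ (t - s) * sliceMeas μ E' s)
      hm.lintegral_prod_right']
    refine lintegral_congr fun t => ?_
    have hmt : Measurable fun s => farKer n τ (t - s) * sliceMeas μ E' s :=
      hm.comp measurable_prodMk_left
    rw [← lintegral_mul_const _ hmt]
    refine lintegral_congr fun s => ?_
    ring
  rw [h1, h2]
  refine (young_sq_le hk (measurable_sliceMeas hE) (measurable_sliceMeas hE')).trans ?_
  gcongr
  exact lintegral_farKer_le hn hτ

end FarTime

section Bilinear

variable {H : Type*} [NormedAddCommGroup H] [InnerProductSpace ℂ H] [CompleteSpace H]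
  {X : Type*} [MeasurableSpace X] {μ : Measure X} [SigmaFinite μ] {n : ℕ} {v : ℝ × X → H}

lemma ennreal_le_of_sq_le {x y : ℝ≥0∞} (h : x ^ 2 ≤ y ^ 2) : x ≤ y :=
  (ENNReal.pow_le_pow_left_iff (by norm_num)).1 h

lemma Dispersive.inner_split (hv : Dispersive n μ v) {p p' : ℝ × X → ℂ}
    (hp : FinSupp (volume.prod μ) p) (hp' : FinSupp (volume.prod μ) p') (τ : ℝ) :
    inner ℂ (synth (volume.prod μ) v p) (synth (volume.prod μ) v p') =
      (∫ y in nearPairs X τ, pairKer v p p' y ∂((volume.prod μ).prod (volume.prod μ))) +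
      ∫ y in (nearPairs X τ)ᶜ, pairKer v p p' y ∂((volume.prod μ).prod (volume.prod μ)) := by
  obtain ⟨h1, h2⟩ := synth_inner_synth hp.integrable hp'.integrable hv.meas hv.bdd
  rw [h2, integral_add_compl (measurableSet_nearPairs τ) h1]

lemma Dispersive.synth_level_le (hv : Dispersive n μ v) (hn : 2 ≤ n) {E : Set (ℝ × X)}
    (hE : MeasurableSet E) {δ : ℝ} (hδ : 0 < δ)
    (hEδ : ∫⁻ t, sliceMeas μ E t ^ 2 ≤ ENNReal.ofReal (δ ^ (n + 1))) {p : ℝ × X → ℂ}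
    (hp : FinSupp (volume.prod μ) p) (hpE : ∀ z, z ∉ E → p z = 0) :
    ‖synth (volume.prod μ) v p‖ₑ ^ 2 ≤
      ENNReal.ofReal (4 * δ) * ∫⁻ z, ‖p z‖ₑ ^ 2 ∂(volume.prod μ) := by
  set ζ := (volume : Measure ℝ).prod μ
  set A := ∫⁻ z, ‖p z‖ₑ ^ 2 ∂ζ with hA
  have e0 : ‖synth ζ v p‖ₑ ^ 2 = ‖inner ℂ (synth ζ v p) (synth ζ v p)‖ₑ := by
    rw [inner_self_eq_norm_sq_to_K, ← ofReal_norm, ← ofReal_norm, ← ENNReal.ofReal_pow (by simp)]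
    simp
  rw [e0, hv.inner_split hp hp δ]
  have hnear := hv.near_le hp hp (τ := δ) (R := √(2 * δ)) fun t => by
    rw [Real.sq_sqrt (by positivity)]
    exact hv.synth_window_le (hp.indicator (measurableSet_timeWindow δ t)) fun z hz =>
      (mem_of_indicator_ne_zero hz)
  have hfar := hv.far_le (ι := Unit) {()} (fun _ => hp) (fun _ => hp) hE hE (fun _ => hpE)
    (fun _ => hpE) hδ.le
  simp only [Finset.sum_singleton] at hfar
  have hJ := lintegral_far_sq_le (μ := μ) hn hδ hE hE
  set J := ∫⁻ y in (nearPairs X δ)ᶜ ∩ E ×ˢ E, ENNReal.ofReal ((|y.1.1 - y.2.1| ^ n)⁻¹)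
    ∂(ζ.prod ζ)
  have hJ' : J ≤ ENNReal.ofReal (2 * δ) ^ 2 := by
    apply ennreal_le_of_sq_le
    refine hJ.trans ?_
    calc _ ≤ ENNReal.ofReal (2 * (δ ^ (n - 1))⁻¹) ^ 2 * ENNReal.ofReal (δ ^ (n + 1)) *
          ENNReal.ofReal (δ ^ (n + 1)) := by gcongr
      _ = ENNReal.ofReal (2 * δ ^ 2) ^ 2 := by
        rw [mul_assoc, ← sq, ← mul_pow, ← ENNReal.ofReal_mul (by positivity)]
        congr 2
        obtain ⟨m, rfl⟩ : ∃ m, n = m + 1 := ⟨n - 1, by omega⟩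
        simp only [Nat.add_sub_cancel]
        field_simp
        ring
      _ ≤ _ := by
        gcongr
        rw [← ENNReal.ofReal_pow (by positivity)]
        apply ENNReal.ofReal_le_ofReal
        nlinarith [sq_nonneg δ]
  have hΓ : ∫⁻ y, ‖(starRingEnd ℂ) (p y.1) * p y.2‖ₑ ^ 2 ∂(ζ.prod ζ) = A ^ 2 := by
    rw [sq A, hA, ← lintegral_prod_mul (hp.meas.enorm.pow_const 2).aemeasurable
      (hp.meas.enorm.pow_const 2).aemeasurable]
    refine lintegral_congr fun y => ?_
    rw [enorm_mul, ← ofReal_norm ((starRingEnd ℂ) (p y.1)), RCLike.norm_conj, ofReal_norm, mul_pow]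
  rw [hΓ] at hfar
  have h1 : ‖∫ y in nearPairs X δ, pairKer v p p y ∂(ζ.prod ζ)‖ₑ ≤ ENNReal.ofReal (2 * δ) * A := by
    apply ennreal_le_of_sq_le
    refine hnear.trans_eq ?_
    rw [Real.sq_sqrt (by positivity)]
    ring
  have h2 : ‖∫ y in (nearPairs X δ)ᶜ, pairKer v p p y ∂(ζ.prod ζ)‖ₑ ≤
      ENNReal.ofReal (2 * δ) * A := by
    apply ennreal_le_of_sq_le
    refine hfar.trans ?_
    rw [mul_comm, mul_pow]
    gcongr
  refine (enorm_add_le _ _).trans ((add_le_add h1 h2).trans_eq ?_)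
  rw [← add_mul, ← ENNReal.ofReal_add (by positivity) (by positivity)]
  congr 2; ring

lemma Dispersive.bilinear_le (hv : Dispersive n μ v) (hn : 2 ≤ n) {ι : Type*} (S : Finset ι)
    {p p' : ι → ℝ × X → ℂ}
    (hp : ∀ j, FinSupp (volume.prod μ) (p j)) (hp' : ∀ j, FinSupp (volume.prod μ) (p' j))
    {E E' : Set (ℝ × X)} (hE : MeasurableSet E) (hE' : MeasurableSet E')
    (hpE : ∀ j z, z ∉ E → p j z = 0) (hpE' : ∀ j z, z ∉ E' → p' j z = 0)
    {τ δ P P' G a a' : ℝ} (hτ : 0 < τ) (hδ : 0 < δ) (hP0 : 0 ≤ P) (hP0' : 0 ≤ P') (hG0 : 0 ≤ G)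
    (ha0 : 0 ≤ a) (ha0' : 0 ≤ a')
    (hEδ : ∫⁻ t, sliceMeas μ E' t ^ 2 ≤ ENNReal.ofReal (δ ^ (n + 1)))
    (hP : ∑ j ∈ S, ∫⁻ z, ‖p j z‖ₑ ^ 2 ∂(volume.prod μ) ≤ ENNReal.ofReal P)
    (hP' : ∑ j ∈ S, ∫⁻ z, ‖p' j z‖ₑ ^ 2 ∂(volume.prod μ) ≤ ENNReal.ofReal P')
    (hG : ∫⁻ y, ‖∑ j ∈ S, (starRingEnd ℂ) (p j y.1) * p' j y.2‖ₑ ^ 2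
        ∂((volume.prod μ).prod (volume.prod μ)) ≤ ENNReal.ofReal G)
    (ha : ∫⁻ t, sliceMeas μ E t ^ 2 ≤ ENNReal.ofReal (a ^ 2))
    (ha' : ∫⁻ t, sliceMeas μ E' t ^ 2 ≤ ENNReal.ofReal (a' ^ 2)) :
    ‖∑ j ∈ S, inner ℂ (synth (volume.prod μ) v (p j)) (synth (volume.prod μ) v (p' j))‖ ≤
      √(min (2 * τ) (4 * δ) * (2 * τ)) * √(P * P') +
        √(G * (2 * (τ ^ (n - 1))⁻¹ * (a * a'))) := by
  set ζ := (volume : Measure ℝ).prod μ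
  set r := min (2 * τ) (4 * δ) with hr
  have hr0 : 0 < r := by positivity
  have hnear : ∀ j, ‖∫ y in nearPairs X τ, pairKer v (p j) (p' j) y ∂(ζ.prod ζ)‖ ≤
      √(r * (2 * τ)) * (√(∫⁻ z, ‖p j z‖ₑ ^ 2 ∂ζ).toReal * √(∫⁻ z, ‖p' j z‖ₑ ^ 2 ∂ζ).toReal) := by
    intro j
    have h := hv.near_le (hp j) (hp' j) (τ := τ) (R := √r) fun t => by
      rw [Real.sq_sqrt hr0.le]
      rcases min_cases (2 * τ) (4 * δ) with ⟨h, -⟩ | ⟨h, -⟩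
      · rw [hr, h]
        exact hv.synth_window_le ((hp' j).indicator (measurableSet_timeWindow τ t)) fun z hz =>
          (mem_of_indicator_ne_zero hz)
      · rw [hr, h]
        exact hv.synth_level_le hn hE' hδ hEδ ((hp' j).indicator (measurableSet_timeWindow τ t))
          fun z hz => by simp [indicator, hpE' j z hz]
    rw [Real.sq_sqrt hr0.le, ← ofReal_norm, ← ENNReal.ofReal_pow (norm_nonneg _),
      ← ENNReal.ofReal_toReal (hp j).lintegral_lt_top.ne,
      ← ENNReal.ofReal_toReal (hp' j).lintegral_lt_top.ne, ← ENNReal.ofReal_mul hr0.le,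
      ← ENNReal.ofReal_mul (by positivity), ← ENNReal.ofReal_mul (by positivity),
      ENNReal.ofReal_le_ofReal_iff (by positivity)] at h
    rw [← Real.sqrt_mul toReal_nonneg, ← Real.sqrt_mul (by positivity)]
    refine Real.le_sqrt_of_sq_le (h.trans_eq (by ring))
  have hsum : ∀ (p : ι → ℝ × X → ℂ) (P : ℝ), 0 ≤ P → (∀ j, FinSupp ζ (p j)) →
      ∑ j ∈ S, ∫⁻ z, ‖p j z‖ₑ ^ 2 ∂ζ ≤ ENNReal.ofReal P →
      ∑ j ∈ S, (∫⁻ z, ‖p j z‖ₑ ^ 2 ∂ζ).toReal ≤ P := by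
    intro p P hP0 hp hP
    rw [← ENNReal.toReal_sum fun j _ => (hp j).lintegral_lt_top.ne]
    exact ENNReal.toReal_le_of_le_ofReal hP0 hP
  have hfar : ‖∑ j ∈ S, ∫ y in (nearPairs X τ)ᶜ, pairKer v (p j) (p' j) y ∂(ζ.prod ζ)‖ ≤
      √(G * (2 * (τ ^ (n - 1))⁻¹ * (a * a'))) := by
    have h := hv.far_le S hp hp' hE hE' hpE hpE' hτ.le
    have hJ := lintegral_far_sq_le (μ := μ) hn hτ hE hE'
    set J := ∫⁻ y in (nearPairs X τ)ᶜ ∩ E ×ˢ E', ENNReal.ofReal ((|y.1.1 - y.2.1| ^ n)⁻¹)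
      ∂(ζ.prod ζ)
    have hJ' : J ≤ ENNReal.ofReal (2 * (τ ^ (n - 1))⁻¹ * (a * a')) := by
      apply ennreal_le_of_sq_le
      calc _ ≤ _ := hJ
        _ ≤ ENNReal.ofReal (2 * (τ ^ (n - 1))⁻¹) ^ 2 * ENNReal.ofReal (a ^ 2) *
          ENNReal.ofReal (a' ^ 2) := by gcongr
        _ = _ := by
          rw [ENNReal.ofReal_pow ha0, ENNReal.ofReal_pow ha0', ← mul_pow, ← mul_pow,
            ← ENNReal.ofReal_mul (by positivity), ← ENNReal.ofReal_mul (by positivity), mul_assoc]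
    have h2 := h.trans (mul_le_mul' hG hJ')
    rw [← ENNReal.ofReal_mul hG0, ← ofReal_norm, ← ENNReal.ofReal_pow (norm_nonneg _),
      ENNReal.ofReal_le_ofReal_iff (by positivity)] at h2
    exact Real.le_sqrt_of_sq_le h2
  rw [Finset.sum_congr rfl fun j _ => hv.inner_split (hp j) (hp' j) τ]
  rw [Finset.sum_add_distrib]
  refine (norm_add_le _ _).trans (add_le_add ?_ hfar)
  refine (norm_sum_le _ _).trans ((Finset.sum_le_sum fun j _ => hnear j).trans ?_)
  rw [← Finset.mul_sum, Real.sqrt_mul hP0]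
  gcongr
  refine (Real.sum_sqrt_mul_sqrt_le S (fun _ => toReal_nonneg) (fun _ => toReal_nonneg)).trans ?_
  gcongr
  · exact hsum p P hP0 hp hP
  · exact hsum p' P' hP0' hp' hP'

end Bilinear

section RealLemmas

lemma le_two_mul_of_forall_rpow {Q x y A B : ℝ} (hA : 0 < A) (hB : 0 < B) (hx : 0 ≤ x) (hy : 0 ≤ y)
    (h : ∀ θ : ℝ, 0 < θ → Q ≤ x * θ ^ A + y * θ ^ (-B)) :
    Q ≤ 2 * (x ^ (B / (A + B)) * y ^ (A / (A + B))) := by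
  have hAB : 0 < A + B := by positivity
  rcases hx.eq_or_lt with rfl | hx
  · rw [Real.zero_rpow (by positivity), zero_mul, mul_zero]
    have ht : Filter.Tendsto (fun θ : ℝ => y * θ ^ (-B)) Filter.atTop (nhds (y * 0)) :=
      (tendsto_rpow_neg_atTop hB).const_mul y
    rw [mul_zero] at ht
    refine ge_of_tendsto ht ((Filter.eventually_gt_atTop 0).mono fun θ hθ => ?_)
    simpa using h θ hθ
  rcases hy.eq_or_lt with rfl | hy
  · rw [Real.zero_rpow (by positivity), mul_zero, mul_zero]
    have ht : Filter.Tendsto (fun θ : ℝ => x * (θ⁻¹) ^ A) Filter.atTop (nhds (x * 0)) := by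
      refine Filter.Tendsto.const_mul x ?_
      refine (tendsto_rpow_neg_atTop hA).congr' ((Filter.eventually_gt_atTop 0).mono fun θ hθ => ?_)
      simp only [Real.inv_rpow hθ.le, Real.rpow_neg hθ.le]
    rw [mul_zero] at ht
    refine ge_of_tendsto ht ((Filter.eventually_gt_atTop 0).mono fun θ hθ => ?_)
    simpa using h θ⁻¹ (inv_pos.2 hθ)
  have hxy : 0 < y / x := div_pos hy hx
  refine (h ((y / x) ^ (1 / (A + B))) (Real.rpow_pos_of_pos hxy _)).trans_eq ?_
  rw [← Real.rpow_mul hxy.le, ← Real.rpow_mul hxy.le, two_mul]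
  congr 1
  · rw [Real.div_rpow hy.le hx.le]
    have : x ^ (B / (A + B)) = x / x ^ (1 / (A + B) * A) := by
      nth_rewrite 2 [← Real.rpow_one x]
      rw [← Real.rpow_sub hx]
      congr 1; field_simp; ring
    rw [this]; ring_nf
  · have h1 : (y / x) ^ (1 / (A + B) * -B) = x ^ (B / (A + B)) / y ^ (B / (A + B)) := by
      rw [← Real.div_rpow hx.le hy.le, ← inv_div y x, Real.inv_rpow hxy.le, ← Real.rpow_neg hxy.le]
      congr 1; ring
    have h2 : y ^ (A / (A + B)) = y / y ^ (B / (A + B)) := by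
      nth_rewrite 2 [← Real.rpow_one y]
      rw [← Real.rpow_sub hy]
      congr 1; field_simp; ring
    rw [h1, h2]; ring

lemma min_le_rpow_mul_rpow {x y s : ℝ} (hx : 0 < x) (hy : 0 < y) (hs : 0 ≤ s) (hs1 : s ≤ 1) :
    min x y ≤ x ^ (1 - s) * y ^ s := by
  have hm : 0 < min x y := lt_min hx hy
  calc min x y = min x y ^ (1 - s) * min x y ^ s := by
        rw [← Real.rpow_add hm, sub_add_cancel, Real.rpow_one]
    _ ≤ _ := by
        gcongr
        · exact min_le_left _ _
        · exact min_le_right _ _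

lemma sum_rpow_mul_rpow_le {ι : Type*} (L : Finset ι) {x y : ι → ℝ} (hx : ∀ l, 0 ≤ x l)
    (hy : ∀ l, 0 ≤ y l) {κ : ℝ} (h0 : 0 < κ) (h1 : κ < 1) :
    ∑ l ∈ L, x l ^ κ * y l ^ (1 - κ) ≤ (∑ l ∈ L, x l) ^ κ * (∑ l ∈ L, y l) ^ (1 - κ) := by
  have hc : (κ⁻¹).HolderConjugate (1 - κ)⁻¹ := by
    rw [Real.holderConjugate_iff]
    exact ⟨(one_lt_inv₀ h0).2 h1, by simp⟩
  have h := Real.inner_le_Lp_mul_Lq_of_nonneg L hc (f := fun l => x l ^ κ)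
    (g := fun l => y l ^ (1 - κ)) (fun l _ => Real.rpow_nonneg (hx l) _)
    (fun l _ => Real.rpow_nonneg (hy l) _)
  have e1 : ∀ l, (x l ^ κ) ^ κ⁻¹ = x l := fun l => Real.rpow_rpow_inv (hx l) h0.ne'
  have e2 : ∀ l, (y l ^ (1 - κ)) ^ (1 - κ)⁻¹ = y l := fun l =>
    Real.rpow_rpow_inv (hy l) (by linarith)
  simpa [e1, e2] using h

lemma summable_pow_natAbs {g : ℝ} (h0 : 0 ≤ g) (h1 : g < 1) :
    Summable fun d : ℤ => g ^ d.natAbs := by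
  refine Summable.of_nat_of_neg ?_ ?_ <;> simpa using summable_geometric_of_lt_one h0 h1

lemma schur_le (L : Finset ℤ) {g : ℝ} (h0 : 0 ≤ g) (h1 : g < 1) (w : ℤ → ℝ) :
    ∑ l ∈ L, ∑ l' ∈ L, g ^ (l - l').natAbs * (w l * w l') ≤
      (∑' d : ℤ, g ^ d.natAbs) * ∑ l ∈ L, w l ^ 2 := by
  have hs := summable_pow_natAbs h0 h1
  have hb : ∀ l, ∑ l' ∈ L, g ^ (l - l').natAbs ≤ ∑' d : ℤ, g ^ d.natAbs := by
    intro l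
    have : ∑ l' ∈ L, g ^ (l - l').natAbs =
        ∑ d ∈ L.map (Equiv.subLeft l).toEmbedding, g ^ d.natAbs := by simp
    rw [this]
    exact hs.sum_le_tsum _ fun _ _ => by positivity
  have hsym : ∑ l ∈ L, ∑ l' ∈ L, g ^ (l - l').natAbs * w l' ^ 2 =
      ∑ l ∈ L, ∑ l' ∈ L, g ^ (l - l').natAbs * w l ^ 2 := by
    rw [Finset.sum_comm]
    refine Finset.sum_congr rfl fun l _ => Finset.sum_congr rfl fun l' _ => ?_
    rw [← Int.natAbs_neg, neg_sub]
  calc _ ≤ ∑ l ∈ L, ∑ l' ∈ L, (g ^ (l - l').natAbs * w l ^ 2 / 2 +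
        g ^ (l - l').natAbs * w l' ^ 2 / 2) := by
        refine Finset.sum_le_sum fun l _ => Finset.sum_le_sum fun l' _ => ?_
        have : 0 ≤ g ^ (l - l').natAbs := by positivity
        nlinarith [mul_nonneg this (sq_nonneg (w l - w l'))]
    _ = ∑ l ∈ L, ∑ l' ∈ L, g ^ (l - l').natAbs * w l ^ 2 := by
        simp only [Finset.sum_add_distrib, ← Finset.sum_div]
        rw [hsym]; ring
    _ = ∑ l ∈ L, (∑ l' ∈ L, g ^ (l - l').natAbs) * w l ^ 2 := by simp only [Finset.sum_mul]
    _ ≤ ∑ l ∈ L, (∑' d : ℤ, g ^ d.natAbs) * w l ^ 2 := by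
        gcongr with l _; exact hb l
    _ = _ := by rw [Finset.mul_sum]

end RealLemmas

section MultiLevel

/-- The sharp interpolation exponent: `1 - κ` is half of `(1 - e) / ((1 - e) + (n - 1) / 2)`. -/
def gainExp (n : ℕ) (e : ℝ) : ℝ := (1 - e) / ((1 - e) + ((n : ℝ) - 1) / 2)

/-- The off-diagonal decay rate between levels. -/
def levelDecay (n : ℕ) (e : ℝ) : ℝ := (2 : ℝ) ^ (-(e / 2 * (1 - gainExp n e)))

lemma gainExp_pos {n : ℕ} (hn : 2 ≤ n) {e : ℝ} (he : e < 1) : 0 < gainExp n e := by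
  have hn' : (2 : ℝ) ≤ n := by exact_mod_cast hn
  exact div_pos (by linarith) (by linarith)

lemma gainExp_lt_one {n : ℕ} (hn : 2 ≤ n) {e : ℝ} (he : e < 1) : gainExp n e < 1 := by
  have hn' : (2 : ℝ) ≤ n := by exact_mod_cast hn
  rw [gainExp, div_lt_one (by linarith)]; linarith

/-- Optimization over the time scale of the bilinear estimate. -/
lemma pair_optimize {n : ℕ} (hn : 2 ≤ n) {e : ℝ} (he : 0 < e) (he' : e ≤ 1 / 2) {Q m β : ℝ}
    (hm : 0 ≤ m) (hβ : 0 ≤ β) (d : ℕ)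
    (h : ∀ θ : ℝ, 0 < θ → Q ≤ √(min (2 * θ) (4 * (2 : ℝ) ^ (-(d : ℝ) / 2)) * (2 * θ)) * m +
      √(2 * (θ ^ (n - 1))⁻¹ * (m * β))) :
    Q ≤ 6 * (levelDecay n e ^ d * (m ^ (1 - gainExp n e / 2) * β ^ (gainExp n e / 2))) := by
  have hn' : (2 : ℝ) ≤ n := by exact_mod_cast hn
  have hA : 0 < 1 - e := by linarith
  have hB : 0 < ((n : ℝ) - 1) / 2 := by linarith
  set y : ℝ := (2 : ℝ) ^ (-(d : ℝ) / 2) with hy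
  have hy0 : 0 < y := by positivity
  have h1 : ∀ θ : ℝ, 0 < θ → Q ≤ (3 * y ^ e * m) * θ ^ (1 - e) +
      (2 * √(m * β)) * θ ^ (-(((n : ℝ) - 1) / 2)) := by
    intro θ hθ
    refine (h θ hθ).trans (add_le_add ?_ ?_)
    · have : √(min (2 * θ) (4 * y) * (2 * θ)) ≤ 3 * (y ^ e * θ ^ (1 - e)) := by
        apply Real.sqrt_le_iff.2 ⟨by positivity, ?_⟩
        have h2 := min_le_rpow_mul_rpow hθ hy0 (s := 2 * e) (by linarith) (by linarith)
        have h3 : min (2 * θ) (4 * y) ≤ 4 * min θ y := by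
          rw [mul_min_of_nonneg _ _ (by norm_num : (0 : ℝ) ≤ 4)]
          exact min_le_min (by linarith) le_rfl
        have h4 : θ ^ (1 - 2 * e) * y ^ (2 * e) * θ = (y ^ e * θ ^ (1 - e)) ^ 2 := by
          rw [mul_pow, ← Real.rpow_natCast, ← Real.rpow_natCast, ← Real.rpow_mul hy0.le,
            ← Real.rpow_mul hθ.le]
          nth_rewrite 2 [← Real.rpow_one θ]
          rw [mul_right_comm, ← Real.rpow_add hθ, mul_comm]
          congr 2 <;> push_cast <;> ring
        calc _ ≤ (4 * (θ ^ (1 - 2 * e) * y ^ (2 * e))) * (2 * θ) := by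
              gcongr; exact h3.trans (by gcongr)
          _ = 8 * (y ^ e * θ ^ (1 - e)) ^ 2 := by rw [← h4]; ring
          _ ≤ _ := by nlinarith [sq_nonneg (y ^ e * θ ^ (1 - e))]
      calc _ ≤ 3 * (y ^ e * θ ^ (1 - e)) * m := by gcongr
        _ = _ := by ring
    · have e1 : (θ ^ (n - 1))⁻¹ = (θ ^ (-(((n : ℝ) - 1) / 2))) ^ 2 := by
        rw [← Real.rpow_natCast, ← Real.rpow_natCast, ← Real.rpow_neg hθ.le, ← Real.rpow_mul hθ.le,
          Nat.cast_sub (by omega)]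
        congr 1; push_cast; ring
      have hmb : 0 ≤ m * β := by positivity
      rw [e1]
      apply Real.sqrt_le_iff.2 ⟨by positivity, ?_⟩
      rw [mul_pow, mul_pow, Real.sq_sqrt hmb]
      have : 0 ≤ m * β * (θ ^ (-(((n : ℝ) - 1) / 2))) ^ 2 := by positivity
      nlinarith
  have h2 := le_two_mul_of_forall_rpow hA hB (by positivity) (by positivity) h1
  set c := gainExp n e with hc
  have hc0 : 0 < c := gainExp_pos hn (by linarith)
  have hc1 : c < 1 := gainExp_lt_one hn (by linarith)
  have e1 : (1 - e) / (1 - e + ((n : ℝ) - 1) / 2) = c := rfl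
  have e2 : ((n : ℝ) - 1) / 2 / (1 - e + ((n : ℝ) - 1) / 2) = 1 - c := by
    have hne : 1 - e + ((n : ℝ) - 1) / 2 ≠ 0 := by linarith
    rw [← e1, eq_sub_iff_add_eq, ← add_div, add_comm, div_self hne]
  rw [e1, e2] at h2
  refine h2.trans ?_
  have hyd : (y ^ e) ^ (1 - c) = levelDecay n e ^ d := by
    rw [levelDecay, ← hc, ← Real.rpow_mul hy0.le, hy, ← Real.rpow_mul (by norm_num),
      ← Real.rpow_natCast, ← Real.rpow_mul (by norm_num)]
    congr 1; ring
  have h3 : (3 : ℝ) ^ (1 - c) * 2 ^ c ≤ 3 := by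
    calc (3 : ℝ) ^ (1 - c) * 2 ^ c ≤ 3 ^ (1 - c) * 3 ^ c := by
          gcongr; norm_num
      _ = 3 := by rw [← Real.rpow_add (by norm_num)]; norm_num
  have h4 : m ^ (1 - c) * √(m * β) ^ c = m ^ (1 - c / 2) * β ^ (c / 2) := by
    rw [Real.sqrt_eq_rpow, ← Real.rpow_mul (by positivity), Real.mul_rpow hm hβ, ← mul_assoc,
      ← Real.rpow_add_of_nonneg hm (by linarith) (by linarith)]
    congr 2 <;> ring
  rw [Real.mul_rpow (by positivity) hm, Real.mul_rpow (by norm_num) (by positivity),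
    Real.mul_rpow (by norm_num) (by positivity), hyd]
  have h5 : 0 ≤ levelDecay n e ^ d * (m ^ (1 - c / 2) * β ^ (c / 2)) := by
    unfold levelDecay; positivity
  calc 2 * (3 ^ (1 - c) * levelDecay n e ^ d * m ^ (1 - c) * (2 ^ c * √(m * β) ^ c))
      = 2 * (3 ^ (1 - c) * 2 ^ c) * (levelDecay n e ^ d * (m ^ (1 - c) * √(m * β) ^ c)) := by ring
    _ = 2 * (3 ^ (1 - c) * 2 ^ c) * (levelDecay n e ^ d * (m ^ (1 - c / 2) * β ^ (c / 2))) := by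
        rw [h4]
    _ ≤ 2 * 3 * (levelDecay n e ^ d * (m ^ (1 - c / 2) * β ^ (c / 2))) := by gcongr
    _ = _ := by ring

end MultiLevel

section MultiLevel

variable {H : Type*} [NormedAddCommGroup H] [InnerProductSpace ℂ H] [CompleteSpace H]
  {X : Type*} [MeasurableSpace X] {μ : Measure X} [SigmaFinite μ] {n : ℕ} {v : ℝ × X → H}

lemma lintegral_gram_le {ι Z : Type*} [MeasurableSpace Z] {ζ : Measure Z} [SFinite ζ] (S : Finset ι)
    {p q : ι → Z → ℂ} (hp : ∀ j, FinSupp ζ (p j)) (hq : ∀ j, FinSupp ζ (q j)) {B : ℝ≥0∞}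
    (hB : ∀ c : ι → ℂ, ∫⁻ z, ‖∑ j ∈ S, c j * q j z‖ₑ ^ 2 ∂ζ ≤ B * ∑ j ∈ S, ‖c j‖ₑ ^ 2) :
    ∫⁻ y, ‖∑ j ∈ S, (starRingEnd ℂ) (p j y.1) * q j y.2‖ₑ ^ 2 ∂(ζ.prod ζ) ≤
      B * ∑ j ∈ S, ∫⁻ z, ‖p j z‖ₑ ^ 2 ∂ζ := by
  have hm : Measurable fun y : Z × Z => ‖∑ j ∈ S, (starRingEnd ℂ) (p j y.1) * q j y.2‖ₑ ^ 2 := by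
    refine Measurable.pow_const (Measurable.enorm (Finset.measurable_sum S fun j _ => ?_)) 2
    exact (Complex.continuous_conj.measurable.comp ((hp j).meas.comp measurable_fst)).mul
      ((hq j).meas.comp measurable_snd)
  rw [lintegral_prod _ hm.aemeasurable, ← lintegral_finsetSum S fun j _ =>
    ((hp j).meas.enorm.pow_const 2), ← lintegral_const_mul _ (Finset.measurable_sum S fun j _ =>
    ((hp j).meas.enorm.pow_const 2))]
  refine lintegral_mono fun z => (hB fun j => (starRingEnd ℂ) (p j z)).trans_eq ?_
  congr 1
  refine Finset.sum_congr rfl fun j _ => ?_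
  rw [← ofReal_norm ((starRingEnd ℂ) (p j z)), RCLike.norm_conj, ofReal_norm]

lemma Dispersive.pair_le (hv : Dispersive n μ v) (hn : 2 ≤ n) {ι : Type*} (S : Finset ι)
    {p p' : ι → ℝ × X → ℂ}
    (hp : ∀ j, FinSupp (volume.prod μ) (p j)) (hp' : ∀ j, FinSupp (volume.prod μ) (p' j))
    {E E' : Set (ℝ × X)} (hE : MeasurableSet E) (hE' : MeasurableSet E')
    (hpE : ∀ j z, z ∉ E → p j z = 0) (hpE' : ∀ j z, z ∉ E' → p' j z = 0)
    {l l' : ℤ} (hl : l ≤ l') {N N' b b' : ℝ} (hN : 0 ≤ N) (hN' : 0 ≤ N') (hb : 0 ≤ b) (hb' : 0 ≤ b')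
    (hb1 : b' ≤ 1)
    (hs : ∫⁻ t, sliceMeas μ E t ^ 2 ≤ ENNReal.ofReal (((2 : ℝ) ^ (-l)) ^ (n + 1) * b))
    (hs' : ∫⁻ t, sliceMeas μ E' t ^ 2 ≤ ENNReal.ofReal (((2 : ℝ) ^ (-l')) ^ (n + 1) * b'))
    (hP : ∑ j ∈ S, ∫⁻ z, ‖p j z‖ₑ ^ 2 ∂(volume.prod μ) ≤ ENNReal.ofReal (2 ^ l * N))
    (hP' : ∑ j ∈ S, ∫⁻ z, ‖p' j z‖ₑ ^ 2 ∂(volume.prod μ) ≤ ENNReal.ofReal (2 ^ l' * N'))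
    (hB : ∀ c : ι → ℂ, ∫⁻ z, ‖∑ j ∈ S, c j * p j z‖ₑ ^ 2 ∂(volume.prod μ) ≤
      ENNReal.ofReal (2 ^ l) * ∑ j ∈ S, ‖c j‖ₑ ^ 2)
    (hB' : ∀ c : ι → ℂ, ∫⁻ z, ‖∑ j ∈ S, c j * p' j z‖ₑ ^ 2 ∂(volume.prod μ) ≤
      ENNReal.ofReal (2 ^ l') * ∑ j ∈ S, ‖c j‖ₑ ^ 2)
    {e : ℝ} (he : 0 < e) (he' : e ≤ 1 / 2) :
    ‖∑ j ∈ S, inner ℂ (synth (volume.prod μ) v (p j)) (synth (volume.prod μ) v (p' j))‖ ≤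
      6 * (levelDecay n e ^ (l - l').natAbs *
        (√(N * N') ^ (1 - gainExp n e / 2) * √(b * b') ^ (gainExp n e / 2))) := by
  refine pair_optimize hn he he' (by positivity) (by positivity) _ fun θ hθ => ?_
  set ζ := (volume : Measure ℝ).prod μ
  set s : ℝ := (2 : ℝ) ^ (((l : ℝ) + l') / 2) with hs_def
  have hs0 : 0 < s := by positivity
  have hs2 : (2 : ℝ) ^ l * 2 ^ l' = s ^ 2 := by
    rw [hs_def, ← Real.rpow_natCast, ← Real.rpow_mul (by norm_num), ← Real.rpow_intCast,
      ← Real.rpow_intCast, ← Real.rpow_add (by norm_num)]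
    congr 1; push_cast; ring
  set y : ℝ := (2 : ℝ) ^ (-(((l - l').natAbs : ℕ) : ℝ) / 2) with hy_def
  have hy0 : 0 < y := by positivity
  have hδ : (2 : ℝ) ^ (-l') = y / s := by
    have : (((l - l').natAbs : ℕ) : ℝ) = (l' : ℝ) - l := by
      rw [Nat.cast_natAbs, abs_of_nonpos (by omega)]; push_cast; ring
    rw [hy_def, hs_def, ← Real.rpow_sub (by norm_num), ← Real.rpow_intCast, this]
    congr 1; push_cast; ring
  have hG : ∫⁻ z, ‖∑ j ∈ S, (starRingEnd ℂ) (p j z.1) * p' j z.2‖ₑ ^ 2 ∂(ζ.prod ζ) ≤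
      ENNReal.ofReal (s ^ 2 * √(N * N')) := by
    have h1 := lintegral_gram_le S hp hp' hB'
    have h2 := lintegral_gram_le S hp' hp hB
    have h3 : ∫⁻ z, ‖∑ j ∈ S, (starRingEnd ℂ) (p j z.1) * p' j z.2‖ₑ ^ 2 ∂(ζ.prod ζ) =
        ∫⁻ z, ‖∑ j ∈ S, (starRingEnd ℂ) (p' j z.1) * p j z.2‖ₑ ^ 2 ∂(ζ.prod ζ) := by
      rw [← lintegral_prod_swap]
      refine lintegral_congr fun z => ?_
      simp only [Prod.fst_swap, Prod.snd_swap]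
      rw [← ofReal_norm, ← RCLike.norm_conj, ofReal_norm, map_sum]
      simp only [map_mul, Complex.conj_conj, mul_comm]
    have h4 := h1.trans (mul_le_mul_right hP _)
    have h5 := (h3.le.trans h2).trans (mul_le_mul_right hP' _)
    rw [← ENNReal.ofReal_mul (by positivity)] at h4 h5
    have h6 := mul_le_mul' h4 h5
    rw [← sq, ← ENNReal.ofReal_mul (by positivity)] at h6
    apply ennreal_le_of_sq_le
    rw [← ENNReal.ofReal_pow (by positivity), mul_pow, Real.sq_sqrt (by positivity)]
    refine h6.trans_eq (congrArg _ ?_)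
    rw [← hs2]; ring
  have hmain := hv.bilinear_le hn S hp hp' hE hE' hpE hpE' (τ := θ / s) (δ := y / s)
    (P := 2 ^ l * N) (P' := 2 ^ l' * N') (G := s ^ 2 * √(N * N'))
    (a := √(((2 : ℝ) ^ (-l)) ^ (n + 1) * b)) (a' := √(((2 : ℝ) ^ (-l')) ^ (n + 1) * b'))
    (by positivity) (by positivity) (by positivity) (by positivity) (by positivity) (by positivity)
    (by positivity) ?_ hP hP' hG ?_ ?_
  · refine hmain.trans_eq ?_
    congr 1
    · have h1 : min (2 * (θ / s)) (4 * (y / s)) * (2 * (θ / s)) =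
          min (2 * θ) (4 * y) * (2 * θ) / s ^ 2 := by
        rw [← mul_div_assoc, ← mul_div_assoc, ← mul_div_assoc, min_div_div_right hs0.le]
        field_simp
      have h2 : 2 ^ l * N * (2 ^ l' * N') = s ^ 2 * (N * N') := by rw [← hs2]; ring
      rw [h1, h2, Real.sqrt_div (by positivity), Real.sqrt_mul (sq_nonneg s), Real.sqrt_sq hs0.le]
      field_simp
    · have h1 : √(((2 : ℝ) ^ (-l)) ^ (n + 1) * b) * √(((2 : ℝ) ^ (-l')) ^ (n + 1) * b') =
          √(b * b') / s ^ (n + 1) := by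
        rw [← Real.sqrt_mul (by positivity)]
        have : ((2 : ℝ) ^ (-l)) ^ (n + 1) * b * (((2 : ℝ) ^ (-l')) ^ (n + 1) * b') =
            b * b' / (s ^ (n + 1)) ^ 2 := by
          rw [← pow_mul, mul_comm (n + 1) 2, pow_mul, ← hs2, zpow_neg, zpow_neg]
          have hA : (0 : ℝ) < 2 ^ l := by positivity
          have hA' : (0 : ℝ) < 2 ^ l' := by positivity
          generalize (2 : ℝ) ^ l = A at hA
          generalize (2 : ℝ) ^ l' = A' at hA'
          rw [inv_pow, inv_pow, mul_pow]
          field_simp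
        rw [this, Real.sqrt_div (by positivity), Real.sqrt_sq (by positivity)]
      rw [h1]
      congr 1
      obtain ⟨k, rfl⟩ : ∃ k, n = k + 1 := ⟨n - 1, by omega⟩
      simp only [Nat.add_sub_cancel, div_pow]
      field_simp
      ring
  · rw [← hδ]
    exact hs'.trans (ENNReal.ofReal_le_ofReal (mul_le_of_le_one_right (by positivity) hb1))
  · rwa [Real.sq_sqrt (by positivity)]
  · rwa [Real.sq_sqrt (by positivity)]

/-- Finitely many level sets with the size bounds inherited from a mixed-norm bounded weight. -/
structure LevelSets (n : ℕ) (μ : Measure X) (L : Finset ℤ) (E : ℤ → Set (ℝ × X)) (b : ℤ → ℝ) :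
    Prop where
  meas : ∀ l, MeasurableSet (E l)
  fin : ∀ l, (volume.prod μ) (E l) < ∞
  nonneg : ∀ l, 0 ≤ b l
  sum_le : ∑ l ∈ L, b l ≤ 1
  slice : ∀ l ∈ L, ∫⁻ t, sliceMeas μ (E l) t ^ 2 ≤ ENNReal.ofReal (((2 : ℝ) ^ (-l)) ^ (n + 1) * b l)

/-- The constant in the multi-level estimate. -/
def levelConst (n : ℕ) (e : ℝ) : ℝ := 6 * ∑' d : ℤ, levelDecay n e ^ d.natAbs

lemma Dispersive.sum_synth_levels_le (hv : Dispersive n μ v) (hn : 2 ≤ n) {L : Finset ℤ}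
    {E : ℤ → Set (ℝ × X)} {b : ℤ → ℝ} (hE : LevelSets n μ L E b) {ι : Type*} [DecidableEq ι]
    (S : Finset ι) {p : ι → ℤ → ℝ × X → ℂ} (hp : ∀ j l, FinSupp (volume.prod μ) (p j l))
    (hpE : ∀ j l z, z ∉ E l → p j l z = 0)
    (hB : ∀ c : ι → ℂ, ∑ l ∈ L, ENNReal.ofReal (2 ^ (-l)) *
      ∫⁻ z, ‖∑ j ∈ S, c j * p j l z‖ₑ ^ 2 ∂(volume.prod μ) ≤ ∑ j ∈ S, ‖c j‖ₑ ^ 2)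
    {e : ℝ} (he : 0 < e) (he' : e ≤ 1 / 2) :
    ∑ j ∈ S, ‖∑ l ∈ L, synth (volume.prod μ) v (p j l)‖ ^ 2 ≤
      levelConst n e * (S.card : ℝ) ^ (1 - gainExp n e / 2) := by
  set ζ := (volume : Measure ℝ).prod μ
  set c := gainExp n e with hc
  have hc0 : 0 < c := gainExp_pos hn (by linarith)
  have hc1 : c < 1 := gainExp_lt_one hn (by linarith)
  have h2 : ∀ l : ℤ, ENNReal.ofReal (2 ^ l) * ENNReal.ofReal (2 ^ (-l)) = 1 := fun l => by
    rw [← ENNReal.ofReal_mul (by positivity), zpow_neg, mul_inv_cancel₀ (by positivity)]; simp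
  have hBl : ∀ l ∈ L, ∀ c : ι → ℂ, ∫⁻ z, ‖∑ j ∈ S, c j * p j l z‖ₑ ^ 2 ∂ζ ≤
      ENNReal.ofReal (2 ^ l) * ∑ j ∈ S, ‖c j‖ₑ ^ 2 := by
    intro l hl c
    have := (Finset.single_le_sum (f := fun l => ENNReal.ofReal (2 ^ (-l)) *
      ∫⁻ z, ‖∑ j ∈ S, c j * p j l z‖ₑ ^ 2 ∂ζ) (fun _ _ => zero_le) hl).trans (hB c)
    calc _ = ENNReal.ofReal (2 ^ l) * (ENNReal.ofReal (2 ^ (-l)) *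
          ∫⁻ z, ‖∑ j ∈ S, c j * p j l z‖ₑ ^ 2 ∂ζ) := by rw [← mul_assoc, h2, one_mul]
      _ ≤ _ := by gcongr
  set A : ℤ → ℝ≥0∞ := fun l => ∑ j ∈ S, ∫⁻ z, ‖p j l z‖ₑ ^ 2 ∂ζ with hA
  have hAfin : ∀ l, A l ≠ ∞ := fun l => (ENNReal.sum_lt_top.2 fun j _ => (hp j l).lintegral_lt_top).ne
  set N : ℤ → ℝ := fun l => 2 ^ (-l) * (A l).toReal with hN
  have hN0 : ∀ l, 0 ≤ N l := fun l => by positivity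
  have hNsum : ∑ l ∈ L, N l ≤ S.card := by
    have h1 : ∀ j ∈ S, ∑ l ∈ L, ENNReal.ofReal (2 ^ (-l)) * ∫⁻ z, ‖p j l z‖ₑ ^ 2 ∂ζ ≤ 1 := by
      intro j hj
      have := hB (Pi.single j 1)
      simpa [Pi.single_apply, apply_ite, Finset.sum_ite_eq, hj] using this
    have h3 : ∑ l ∈ L, ENNReal.ofReal (2 ^ (-l)) * A l ≤ S.card := by
      simp only [hA, Finset.mul_sum]
      rw [Finset.sum_comm]
      exact (Finset.sum_le_sum h1).trans (by simp)
    have h4 : ∑ l ∈ L, N l = (∑ l ∈ L, ENNReal.ofReal (2 ^ (-l)) * A l).toReal := by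
      rw [ENNReal.toReal_sum fun l _ => ENNReal.mul_ne_top ENNReal.ofReal_ne_top (hAfin l)]
      refine Finset.sum_congr rfl fun l _ => ?_
      rw [ENNReal.toReal_mul, ENNReal.toReal_ofReal (by positivity)]
    rw [h4]
    exact (ENNReal.toReal_mono (by simp) h3).trans (by simp)
  have hAN : ∀ l, A l ≤ ENNReal.ofReal (2 ^ l * N l) := fun l => by
    rw [hN, ← mul_assoc, zpow_neg, mul_inv_cancel₀ (by positivity), one_mul,
      ENNReal.ofReal_toReal (hAfin l)]
  clear_value N
  set w : ℤ → ℝ := fun l => N l ^ ((1 - c / 2) / 2) * b l ^ (c / 2 / 2) with hw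
  set I : ℤ → ℤ → ℂ := fun l l' => ∑ j ∈ S, inner ℂ (synth ζ v (p j l)) (synth ζ v (p j l')) with hI
  have hb1 : ∀ l ∈ L, b l ≤ 1 := fun l hl =>
    (Finset.single_le_sum (fun l _ => hE.nonneg l) hl).trans hE.sum_le
  have hw2 : ∀ l l', √(N l * N l') ^ (1 - c / 2) * √(b l * b l') ^ (c / 2) = w l * w l' := by
    intro l l'
    have := hN0 l; have := hN0 l'; have := hE.nonneg l; have := hE.nonneg l'
    rw [Real.sqrt_eq_rpow, Real.sqrt_eq_rpow, ← Real.rpow_mul (by positivity),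
      ← Real.rpow_mul (by positivity), Real.mul_rpow (hN0 l) (hN0 l'),
      Real.mul_rpow (hE.nonneg l) (hE.nonneg l'), hw]
    simp only [one_div_mul_eq_div]
    ring
  have hle : ∀ l ∈ L, ∀ l' ∈ L, l ≤ l' →
      ‖I l l'‖ ≤ 6 * (levelDecay n e ^ (l - l').natAbs * (w l * w l')) := by
    intro l hl l' hl' hll
    have := hv.pair_le hn S (fun j => hp j l) (fun j => hp j l') (hE.meas l) (hE.meas l')
      (fun j => hpE j l) (fun j => hpE j l') hll (hN0 l) (hN0 l') (hE.nonneg l) (hE.nonneg l')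
      (hb1 l' hl') (hE.slice l hl) (hE.slice l' hl') (hAN l) (hAN l') (hBl l hl) (hBl l' hl') he he'
    rwa [← hc, hw2] at this
  have hle' : ∀ l ∈ L, ∀ l' ∈ L,
      ‖I l l'‖ ≤ 6 * (levelDecay n e ^ (l - l').natAbs * (w l * w l')) := by
    intro l hl l' hl'
    rcases le_total l l' with h | h
    · exact hle l hl l' hl' h
    · have h1 := hle l' hl' l hl h
      have h3 : ‖I l l'‖ = ‖I l' l‖ := by
        rw [← RCLike.norm_conj, hI, map_sum]; simp only [inner_conj_symm]
      rw [h3, ← Int.natAbs_neg, neg_sub, mul_comm (w l)]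
      exact h1
  have hg0 : 0 ≤ levelDecay n e := by unfold levelDecay; positivity
  have hg1 : levelDecay n e < 1 :=
    Real.rpow_lt_one_of_one_lt_of_neg (by norm_num) (by
      rw [neg_lt_zero, ← hc]; exact mul_pos (by positivity) (by linarith))
  have hexp : (((∑ j ∈ S, ‖∑ l ∈ L, synth ζ v (p j l)‖ ^ 2 : ℝ)) : ℂ) =
      ∑ l ∈ L, ∑ l' ∈ L, I l l' := by
    simp only [hI]
    push_cast
    rw [Finset.sum_congr rfl fun l _ => Finset.sum_comm, Finset.sum_comm]
    refine Finset.sum_congr rfl fun j _ => ?_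
    have := inner_self_eq_norm_sq_to_K (𝕜 := ℂ) (∑ l ∈ L, synth ζ v (p j l))
    simp only [Complex.coe_algebraMap] at this
    rw [← this, sum_inner]
    refine Finset.sum_congr rfl fun l _ => inner_sum _ _ _
  have h5 : ∑ j ∈ S, ‖∑ l ∈ L, synth ζ v (p j l)‖ ^ 2 ≤ ∑ l ∈ L, ∑ l' ∈ L, ‖I l l'‖ := by
    calc _ ≤ ‖(((∑ j ∈ S, ‖∑ l ∈ L, synth ζ v (p j l)‖ ^ 2 : ℝ)) : ℂ)‖ := by
          rw [Complex.norm_real]; exact le_abs_self _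
      _ ≤ _ := by
          rw [hexp]
          exact (norm_sum_le _ _).trans (Finset.sum_le_sum fun l _ => norm_sum_le _ _)
  refine h5.trans ?_
  calc ∑ l ∈ L, ∑ l' ∈ L, ‖I l l'‖
      ≤ ∑ l ∈ L, ∑ l' ∈ L, 6 * (levelDecay n e ^ (l - l').natAbs * (w l * w l')) :=
        Finset.sum_le_sum fun l hl => Finset.sum_le_sum fun l' hl' => hle' l hl l' hl'
    _ = 6 * ∑ l ∈ L, ∑ l' ∈ L, levelDecay n e ^ (l - l').natAbs * (w l * w l') := by
        simp only [Finset.mul_sum]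
    _ ≤ 6 * ((∑' d : ℤ, levelDecay n e ^ d.natAbs) * ∑ l ∈ L, w l ^ 2) := by
        gcongr; exact schur_le L hg0 hg1 w
    _ = levelConst n e * ∑ l ∈ L, w l ^ 2 := by rw [levelConst]; ring
    _ ≤ _ := by
        have hK : 0 ≤ levelConst n e := mul_nonneg (by norm_num) (tsum_nonneg fun d => by positivity)
        gcongr
        calc ∑ l ∈ L, w l ^ 2 = ∑ l ∈ L, N l ^ (1 - c / 2) * b l ^ (1 - (1 - c / 2)) := by
              refine Finset.sum_congr rfl fun l _ => ?_
              rw [(sq (w l)).trans (hw2 l l).symm, Real.sqrt_mul_self (hN0 l),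
                Real.sqrt_mul_self (hE.nonneg l)]
              congr 2; ring
          _ ≤ _ := sum_rpow_mul_rpow_le L hN0 hE.nonneg (by linarith) (by linarith)
          _ ≤ (S.card : ℝ) ^ (1 - c / 2) * 1 ^ (1 - (1 - c / 2)) := by
              have := Finset.sum_nonneg fun l (_ : l ∈ L) => hN0 l
              have := Finset.sum_nonneg fun l (_ : l ∈ L) => hE.nonneg l
              gcongr
              · linarith
              · linarith
              · exact hE.sum_le
          _ = _ := by simp

end MultiLevel

section Diagonalize

lemma exists_orthonormalBasis_gram {ι Z : Type*} [Fintype ι] [DecidableEq ι] [MeasurableSpace Z]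
    {ν : Measure Z} {u : ι → Z → ℂ}
    (hI : ∀ j k, Integrable (fun z => (starRingEnd ℂ) (u j z) * u k z) ν) :
    ∃ (b : OrthonormalBasis ι ℂ (EuclideanSpace ℂ ι)) (s : ι → ℝ), ∀ k m,
      ∫ z, (starRingEnd ℂ) (∑ j, b k j * u j z) * (∑ j, b m j * u j z) ∂ν =
        if k = m then (s m : ℂ) else 0 := by
  set G : Matrix ι ι ℂ := fun j k => ∫ z, (starRingEnd ℂ) (u j z) * u k z ∂ν with hG
  have hH : G.IsHermitian := by
    ext j k
    rw [Matrix.conjTranspose_apply, ← starRingEnd_apply, hG]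
    dsimp only
    rw [← integral_conj]
    simp [mul_comm]
  refine ⟨hH.eigenvectorBasis, hH.eigenvalues, fun k m => ?_⟩
  set b := hH.eigenvectorBasis
  have h1 : ∀ z, (starRingEnd ℂ) (∑ j, b k j * u j z) * (∑ j, b m j * u j z) =
      ∑ j, ∑ i, (starRingEnd ℂ) (b k j) * b m i * ((starRingEnd ℂ) (u j z) * u i z) := by
    intro z
    rw [map_sum, Finset.sum_mul_sum]
    refine Finset.sum_congr rfl fun j _ => Finset.sum_congr rfl fun i _ => ?_
    rw [map_mul]; ring
  have h2 : ∀ j, ∑ i, b m i * G j i = hH.eigenvalues m * b m j := by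
    intro j
    have := congrFun (hH.mulVec_eigenvectorBasis m) j
    simp only [Matrix.mulVec, dotProduct, Pi.smul_apply, Complex.real_smul] at this
    rw [← this]
    exact Finset.sum_congr rfl fun i _ => mul_comm _ _
  have h3 : ∑ j, (starRingEnd ℂ) (b k j) * b m j = if k = m then 1 else 0 := by
    have := orthonormal_iff_ite.1 b.orthonormal k m
    rw [PiLp.inner_apply] at this
    rw [← this]
    exact Finset.sum_congr rfl fun i _ => by simp [mul_comm]
  simp_rw [h1]
  rw [integral_finsetSum _ fun j _ => integrable_finsetSum _ fun i _ => (hI j i).const_mul _]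
  calc _ = ∑ j, (starRingEnd ℂ) (b k j) * ∑ i, b m i * G j i := by
        refine Finset.sum_congr rfl fun j _ => ?_
        rw [integral_finsetSum _ fun i _ => (hI j i).const_mul _, Finset.mul_sum]
        refine Finset.sum_congr rfl fun i _ => ?_
        rw [integral_const_mul, mul_assoc]
    _ = hH.eigenvalues m * ∑ j, (starRingEnd ℂ) (b k j) * b m j := by
        simp_rw [h2, Finset.mul_sum]
        exact Finset.sum_congr rfl fun j _ => by ring
    _ = _ := by rw [h3]; split_ifs <;> simp

variable {H : Type*} [NormedAddCommGroup H] [InnerProductSpace ℂ H]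

lemma orthonormal_sum_smul {ι : Type*} [Fintype ι] {F : ι → H}
    (hF : Orthonormal ℂ F) (b : OrthonormalBasis ι ℂ (EuclideanSpace ℂ ι)) :
    Orthonormal ℂ fun k => ∑ j, b k j • F j := by
  classical
  rw [orthonormal_iff_ite]
  intro k m
  rw [← orthonormal_iff_ite.1 b.orthonormal k m, PiLp.inner_apply, hF.inner_sum]
  exact Finset.sum_congr rfl fun i _ => by simp [mul_comm]

lemma sum_norm_inner_sum_smul {ι : Type*} [Fintype ι] (F : ι → H)
    (b : OrthonormalBasis ι ℂ (EuclideanSpace ℂ ι)) (x : H) :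
    ∑ k, ‖inner ℂ x (∑ j, b k j • F j)‖ ^ 2 = ∑ j, ‖inner ℂ x (F j)‖ ^ 2 := by
  have h := b.sum_sq_norm_inner_right (WithLp.toLp 2 fun j => inner ℂ (F j) x)
  rw [EuclideanSpace.norm_sq_eq] at h
  calc _ = ∑ j, ‖inner ℂ (F j) x‖ ^ 2 := by
        rw [← h]
        refine Finset.sum_congr rfl fun k _ => ?_
        rw [norm_inner_symm, sum_inner, PiLp.inner_apply]
        simp [inner_smul_left, mul_comm]
    _ = _ := Finset.sum_congr rfl fun j _ => by rw [norm_inner_symm]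

variable [CompleteSpace H] {X : Type*} [MeasurableSpace X] {μ : Measure X} [SigmaFinite μ] {n : ℕ}
  {v : ℝ × X → H}

/-- The measure with density `∑ 2^l 1_{E_l}`. -/
def levelMeasure {Z : Type*} [MeasurableSpace Z] (ζ : Measure Z) (L : Finset ℤ) (E : ℤ → Set Z) :
    Measure Z :=
  ∑ l ∈ L, ENNReal.ofReal (2 ^ l) • ζ.restrict (E l)

lemma Dispersive.weighted_levels_le (hv : Dispersive n μ v) (hn : 2 ≤ n) {L : Finset ℤ}
    {E : ℤ → Set (ℝ × X)} {b : ℤ → ℝ} (hE : LevelSets n μ L E b) {ι : Type*} [Fintype ι]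
    {F : ι → H} (hF : Orthonormal ℂ F) {e : ℝ} (he : 0 < e) (he' : e ≤ 1 / 2) :
    ∑ j, ∫⁻ z, ‖inner ℂ (v z) (F j)‖ₑ ^ 2 ∂(levelMeasure (volume.prod μ) L E) ≤
      ENNReal.ofReal (levelConst n e * (Fintype.card ι : ℝ) ^ (1 - gainExp n e / 2)) := by
  classical
  set ζ := (volume : Measure ℝ).prod μ
  set ν := levelMeasure ζ L E with hν
  obtain ⟨M, hM⟩ := hv.bdd
  have hfin : IsFiniteMeasure ν := by
    constructor
    rw [hν, levelMeasure, Measure.finsetSum_apply]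
    refine ENNReal.sum_lt_top.2 fun l _ => ?_
    simpa using ENNReal.mul_lt_top ENNReal.ofReal_lt_top (hE.fin l)
  have hum : ∀ w : H, Measurable fun z => inner ℂ (v z) w := fun w =>
    (hv.meas.inner stronglyMeasurable_const).measurable
  have hub : ∀ (w : H) z, ‖inner ℂ (v z) w‖ ≤ M * ‖w‖ := fun w z =>
    (norm_inner_le_norm _ _).trans (by gcongr; exact hM z)
  have hI : ∀ w w' : H, Integrable (fun z => (starRingEnd ℂ) (inner ℂ (v z) w) * inner ℂ (v z) w') ν := by
    intro w w'
    refine Integrable.of_bound ((Complex.continuous_conj.measurable.comp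
      (hum w)).mul (hum w')).aestronglyMeasurable ((M * ‖w‖) * (M * ‖w'‖))
      (Filter.Eventually.of_forall fun z => ?_)
    rw [norm_mul, RCLike.norm_conj]
    have := (norm_nonneg _).trans (hub w z)
    gcongr
    · exact hub w z
    · exact hub w' z
  obtain ⟨B, s, hBs⟩ := exists_orthonormalBasis_gram fun j k => hI (F j) (F k)
  set f : ι → H := fun k => ∑ j, B k j • F j with hf
  have hfo : Orthonormal ℂ f := orthonormal_sum_smul hF B
  have hGram : ∀ k m, ∫ z, (starRingEnd ℂ) (inner ℂ (v z) (f k)) * inner ℂ (v z) (f m) ∂ν =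
      if k = m then (s m : ℂ) else 0 := by
    intro k m
    rw [← hBs k m]
    simp only [hf, inner_sum, inner_smul_right]
  have hnorm : ∀ k z, (starRingEnd ℂ) (inner ℂ (v z) (f k)) * inner ℂ (v z) (f k) =
      ((‖inner ℂ (v z) (f k)‖ ^ 2 : ℝ) : ℂ) := fun k z => by
    rw [mul_comm, Complex.mul_conj']; push_cast; rfl
  have hs : ∀ k, s k = ∫ z, ‖inner ℂ (v z) (f k)‖ ^ 2 ∂ν := by
    intro k
    have := hGram k k
    simp only [hnorm, if_true, integral_complex_ofReal] at this
    exact_mod_cast this.symm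
  have hs0 : ∀ k, 0 ≤ s k := fun k => by rw [hs]; exact integral_nonneg fun z => by positivity
  set φ : ι → ℝ × X → ℂ := fun k z => ((√(s k))⁻¹ : ℝ) * inner ℂ (v z) (f k) with hφ
  have hφm : ∀ k, Measurable (φ k) := fun k => (hum _).const_mul _
  set p : ι → ℤ → ℝ × X → ℂ := fun k l => (E l).indicator fun z => ((2 ^ l : ℝ) : ℂ) * φ k z with hp
  have hpF : ∀ k l, FinSupp ζ (p k l) := by
    intro k l
    refine ⟨((hφm k).const_mul _).indicator (hE.meas l),
      ⟨‖((2 ^ l : ℝ) : ℂ)‖ * (‖(((√(s k))⁻¹ : ℝ) : ℂ)‖ * (M * ‖f k‖)), fun z => ?_⟩,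
      (measure_mono ?_).trans_lt (hE.fin l)⟩
    · refine (norm_indicator_le_norm_self _ _).trans ?_
      rw [norm_mul, hφ, norm_mul]
      gcongr
      exact hub _ z
    · exact support_indicator_subset
  have hpE : ∀ k l z, z ∉ E l → p k l z = 0 := fun k l z hz => by simp [hp, hz]
  have hint : ∀ g : ℝ × X → ℝ≥0∞, ∫⁻ z, g z ∂ν =
      ∑ l ∈ L, ENNReal.ofReal (2 ^ l) * ∫⁻ z in E l, g z ∂ζ := by
    intro g
    rw [hν, levelMeasure, lintegral_finsetSum_measure]
    simp
  have hBes : ∀ c : ι → ℂ, ∑ l ∈ L, ENNReal.ofReal (2 ^ (-l)) *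
      ∫⁻ z, ‖∑ j, c j * p j l z‖ₑ ^ 2 ∂ζ ≤ ∑ j, ‖c j‖ₑ ^ 2 := by
    intro c
    have h1 : ∑ l ∈ L, ENNReal.ofReal (2 ^ (-l)) * ∫⁻ z, ‖∑ j, c j * p j l z‖ₑ ^ 2 ∂ζ =
        ∫⁻ z, ‖∑ j, c j * φ j z‖ₑ ^ 2 ∂ν := by
      rw [hint]
      refine Finset.sum_congr rfl fun l _ => ?_
      have h2 : ∀ z, ‖∑ j, c j * p j l z‖ₑ ^ 2 =
          (E l).indicator (fun z => ENNReal.ofReal (2 ^ l) ^ 2 * ‖∑ j, c j * φ j z‖ₑ ^ 2) z := by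
        intro z
        by_cases hz : z ∈ E l
        · have : ∑ j, c j * p j l z = ((2 ^ l : ℝ) : ℂ) * ∑ j, c j * φ j z := by
            rw [Finset.mul_sum]
            refine Finset.sum_congr rfl fun j _ => ?_
            simp only [hp, indicator_of_mem hz]; ring
          rw [this, indicator_of_mem hz, enorm_mul, mul_pow, ← ofReal_norm, Complex.norm_real,
            Real.norm_of_nonneg (by positivity)]
        · simp [hp, hz]
      have hm : Measurable fun z => ‖∑ j, c j * φ j z‖ₑ ^ 2 :=
        (Finset.measurable_sum _ fun j _ => (hφm j).const_mul _).enorm.pow_const 2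
      simp_rw [h2]
      rw [lintegral_indicator (hE.meas l), lintegral_const_mul _ hm, ← mul_assoc,
        ← ENNReal.ofReal_pow (by positivity), ← ENNReal.ofReal_mul (by positivity)]
      congr 2
      rw [zpow_neg]; field_simp
    have h3 : ∀ z, ‖∑ j, c j * φ j z‖ₑ ^ 2 = ENNReal.ofReal (‖∑ j, c j * φ j z‖ ^ 2) := fun z => by
      rw [ENNReal.ofReal_pow (norm_nonneg _), ofReal_norm]
    have h4 : ∀ z, ((‖∑ j, c j * φ j z‖ ^ 2 : ℝ) : ℂ) = ∑ j, ∑ i,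
        ((starRingEnd ℂ) (c j) * c i * (((√(s j))⁻¹ : ℝ) * ((√(s i))⁻¹ : ℝ))) *
          ((starRingEnd ℂ) (inner ℂ (v z) (f j)) * inner ℂ (v z) (f i)) := by
      intro z
      push_cast
      rw [← Complex.mul_conj', mul_comm, map_sum, Finset.sum_mul_sum]
      refine Finset.sum_congr rfl fun j _ => Finset.sum_congr rfl fun i _ => ?_
      simp only [hφ, map_mul, Complex.conj_ofReal]
      push_cast
      ring
    have h5 : ((∫ z, ‖∑ j, c j * φ j z‖ ^ 2 ∂ν : ℝ) : ℂ) =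
        ((∑ j, ‖c j‖ ^ 2 * ((√(s j))⁻¹ * (√(s j))⁻¹ * s j) : ℝ) : ℂ) := by
      rw [← integral_complex_ofReal]
      simp_rw [h4]
      rw [integral_finsetSum _ fun j _ => integrable_finsetSum _ fun i _ => (hI _ _).const_mul _]
      push_cast
      refine Finset.sum_congr rfl fun j _ => ?_
      rw [integral_finsetSum _ fun i _ => (hI _ _).const_mul _]
      simp_rw [integral_const_mul, hGram]
      simp only [mul_ite, mul_zero, Finset.sum_ite_eq, Finset.mem_univ, if_true]
      rw [← Complex.mul_conj']
      ring
    have h6 := Complex.ofReal_injective h5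
    rw [h1]
    simp_rw [h3]
    rw [← ofReal_integral_eq_lintegral_ofReal _ (Filter.Eventually.of_forall fun z => by positivity),
      h6]
    · have h7 : ∀ j, ‖c j‖ₑ ^ 2 = ENNReal.ofReal (‖c j‖ ^ 2) := fun j => by
        rw [ENNReal.ofReal_pow (norm_nonneg _), ofReal_norm]
      simp_rw [h7]
      rw [← ENNReal.ofReal_sum_of_nonneg fun j _ => by positivity]
      refine ENNReal.ofReal_le_ofReal (Finset.sum_le_sum fun j _ => ?_)
      refine mul_le_of_le_one_right (by positivity) ?_
      rcases (hs0 j).eq_or_lt with h | h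
      · simp [← h]
      · rw [← mul_inv, Real.mul_self_sqrt h.le, inv_mul_cancel₀ h.ne']
    · have : Integrable (fun z => ((‖∑ j, c j * φ j z‖ ^ 2 : ℝ) : ℂ)) ν := by
        simp_rw [h4]
        exact integrable_finsetSum _ fun j _ => integrable_finsetSum _ fun i _ => (hI _ _).const_mul _
      exact this.re
  have hmain := hv.sum_synth_levels_le hn hE Finset.univ hpF hpE hBes he he'
  have hlow : ∀ k, s k ≤ ‖∑ l ∈ L, synth ζ v (p k l)‖ ^ 2 := by
    intro k
    have h1 : inner ℂ (f k) (∑ l ∈ L, synth ζ v (p k l)) = ((√(s k) : ℝ) : ℂ) := by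
      have h2 : ∀ l ∈ L, inner ℂ (f k) (synth ζ v (p k l)) = (ENNReal.ofReal (2 ^ l)).toReal •
          ∫ z in E l, (((√(s k))⁻¹ : ℝ) : ℂ) *
            ((starRingEnd ℂ) (inner ℂ (v z) (f k)) * inner ℂ (v z) (f k)) ∂ζ := by
        intro l _
        rw [inner_synth (hpF k l).integrable hv.meas hv.bdd,
          ENNReal.toReal_ofReal (by positivity), ← integral_smul,
          ← integral_indicator (hE.meas l)]
        congr 1; ext z
        by_cases hz : z ∈ E l
        · simp only [hp, hφ, indicator_of_mem hz, inner_conj_symm, Complex.real_smul]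
          ring
        · simp [hp, hz]
      rw [inner_sum, Finset.sum_congr rfl h2]
      have h3 : ∫ z, (((√(s k))⁻¹ : ℝ) : ℂ) *
            ((starRingEnd ℂ) (inner ℂ (v z) (f k)) * inner ℂ (v z) (f k)) ∂ν =
          ((√(s k) : ℝ) : ℂ) := by
        rw [integral_const_mul, hGram, if_pos rfl, ← Complex.ofReal_mul]
        congr 1
        rcases (hs0 k).eq_or_lt with h | h
        · simp [← h]
        · nth_rewrite 2 [← Real.mul_self_sqrt h.le]
          rw [inv_mul_cancel_left₀ (Real.sqrt_pos.2 h).ne']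
      rw [← h3, hν, levelMeasure, integral_finsetSum_measure]
      · simp_rw [integral_smul_measure]
      · exact integrable_finsetSum_measure.1 ((hI (f k) (f k)).const_mul _)
    have h2 := norm_inner_le_norm (𝕜 := ℂ) (f k) (∑ l ∈ L, synth ζ v (p k l))
    rw [h1, hfo.1 k, one_mul, Complex.norm_real, Real.norm_of_nonneg (Real.sqrt_nonneg _)] at h2
    calc s k = √(s k) ^ 2 := (Real.sq_sqrt (hs0 k)).symm
      _ ≤ _ := by gcongr
  have hfinal : ∑ j, ∫⁻ z, ‖inner ℂ (v z) (F j)‖ₑ ^ 2 ∂ν = ENNReal.ofReal (∑ k, s k) := by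
    rw [← lintegral_finsetSum _ fun j _ => (hum _).enorm.pow_const 2,
      ENNReal.ofReal_sum_of_nonneg fun k _ => hs0 k]
    calc _ = ∫⁻ z, ∑ k, ‖inner ℂ (v z) (f k)‖ₑ ^ 2 ∂ν := by
          refine lintegral_congr fun z => ?_
          have h7 : ∀ w : H, ‖inner ℂ (v z) w‖ₑ ^ 2 = ENNReal.ofReal (‖inner ℂ (v z) w‖ ^ 2) :=
            fun j => by rw [ENNReal.ofReal_pow (norm_nonneg _), ofReal_norm]
          simp_rw [h7]
          rw [← ENNReal.ofReal_sum_of_nonneg fun j _ => by positivity,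
            ← ENNReal.ofReal_sum_of_nonneg fun j _ => by positivity]
          congr 1
          exact (sum_norm_inner_sum_smul F B (v z)).symm
      _ = _ := by
          rw [lintegral_finsetSum _ fun j _ => (hum _).enorm.pow_const 2]
          refine Finset.sum_congr rfl fun k _ => ?_
          rw [hs, ofReal_integral_eq_lintegral_ofReal _
            (Filter.Eventually.of_forall fun z => by positivity)]
          · refine lintegral_congr fun z => ?_
            rw [ENNReal.ofReal_pow (norm_nonneg _), ofReal_norm]
          · have := (hI (f k) (f k))
            simp_rw [hnorm] at this
            exact this.re
  rw [hfinal]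
  refine ENNReal.ofReal_le_ofReal ((Finset.sum_le_sum fun k _ => hlow k).trans ?_)
  simpa using hmain

end Diagonalize

section Weight

/-- The dyadic level sets of a weight, truncated in time. -/
def dyadicLevel {X : Type*} (V : ℝ × X → ℝ≥0∞) (T : ℝ) (l : ℤ) : Set (ℝ × X) :=
  V ⁻¹' Ico (ENNReal.ofReal (2 ^ l)) (ENNReal.ofReal (2 ^ (l + 1))) ∩ Prod.fst ⁻¹' Icc (-T) T

lemma dyadicLevel_inj {X : Type*} {V : ℝ × X → ℝ≥0∞} {T : ℝ} {l l' : ℤ} {z : ℝ × X} (h : z ∈ dyadicLevel V T l)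
    (h' : z ∈ dyadicLevel V T l') : l = l' := by
  have key : ∀ l l' : ℤ, z ∈ dyadicLevel V T l → z ∈ dyadicLevel V T l' → l ≤ l' := by
    intro l l' h h'
    have := h.1.1.trans_lt h'.1.2
    rw [ENNReal.ofReal_lt_ofReal_iff (by positivity)] at this
    have := (zpow_lt_zpow_iff_right₀ (by norm_num : (1 : ℝ) < 2)).1 this
    omega
  exact le_antisymm (key _ _ h h') (key _ _ h' h)

lemma sum_dyadicLevel_le {X : Type*} (V : ℝ × X → ℝ≥0∞) (T : ℝ) (L : Finset ℤ) {r : ℝ} (hr : 0 ≤ r)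
    (z : ℝ × X) :
    ∑ l ∈ L, (dyadicLevel V T l).indicator (fun _ => ENNReal.ofReal (2 ^ l) ^ r) z ≤ V z ^ r := by
  by_cases h : ∃ l ∈ L, z ∈ dyadicLevel V T l
  · obtain ⟨l, hl, hz⟩ := h
    rw [Finset.sum_eq_single l]
    · rw [indicator_of_mem hz]
      exact ENNReal.rpow_le_rpow hz.1.1 hr
    · intro l' _ hne
      exact indicator_of_notMem (fun hz' => hne (dyadicLevel_inj hz' hz)) _
    · exact fun h => (h hl).elim
  · push Not at h
    rw [Finset.sum_eq_zero fun l hl => indicator_of_notMem (h l hl) _]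
    exact zero_le

lemma ofReal_rpow_half_sq (n : ℕ) (l : ℤ) :
    (ENNReal.ofReal (2 ^ l) ^ (((n : ℝ) + 1) / 2)) ^ 2 = ENNReal.ofReal ((2 ^ l) ^ (n + 1)) := by
  rw [← ENNReal.rpow_natCast, ← ENNReal.rpow_mul, ENNReal.ofReal_pow (by positivity),
    ← ENNReal.rpow_natCast]
  congr 1; push_cast; ring

variable {H : Type*} [NormedAddCommGroup H] [InnerProductSpace ℂ H]
  {X : Type*} [MeasurableSpace X] {μ : Measure X} [SigmaFinite μ] {n : ℕ} {v : ℝ × X → H}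

/-- Weights in the unit ball of `L^{n+1}_t L^{(n+1)/2}_x`. -/
structure AdmissibleWeight (n : ℕ) (μ : Measure X) (V : ℝ × X → ℝ≥0∞) : Prop where
  meas : Measurable V
  le_one : ∫⁻ t, (∫⁻ x, V (t, x) ^ (((n : ℝ) + 1) / 2) ∂μ) ^ 2 ≤ 1

lemma measurableSet_dyadicLevel {V : ℝ × X → ℝ≥0∞} (hV : Measurable V) (T : ℝ) (l : ℤ) :
    MeasurableSet (dyadicLevel V T l) :=
  (hV measurableSet_Ico).inter (measurable_fst measurableSet_Icc)

lemma AdmissibleWeight.levelSets {V : ℝ × X → ℝ≥0∞} (hV : AdmissibleWeight n μ V) (T : ℝ)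
    (L : Finset ℤ) :
    LevelSets n μ L (dyadicLevel V T) fun l => (ENNReal.ofReal ((2 ^ l) ^ (n + 1)) *
      ∫⁻ t, sliceMeas μ (dyadicLevel V T l) t ^ 2).toReal := by
  have hm := measurableSet_dyadicLevel hV.meas T
  have hr : (0 : ℝ) ≤ ((n : ℝ) + 1) / 2 := by positivity
  have hsum : ∀ L : Finset ℤ, ∑ l ∈ L, (ENNReal.ofReal ((2 ^ l) ^ (n + 1)) *
      ∫⁻ t, sliceMeas μ (dyadicLevel V T l) t ^ 2) ≤ 1 := by
    intro L
    refine le_trans ?_ hV.le_one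
    have h1 : ∀ t, ∑ l ∈ L, ENNReal.ofReal (2 ^ l) ^ (((n : ℝ) + 1) / 2) *
        sliceMeas μ (dyadicLevel V T l) t ≤ ∫⁻ x, V (t, x) ^ (((n : ℝ) + 1) / 2) ∂μ := by
      intro t
      calc _ = ∫⁻ x, ∑ l ∈ L, (dyadicLevel V T l).indicator
            (fun _ => ENNReal.ofReal (2 ^ l) ^ (((n : ℝ) + 1) / 2)) (t, x) ∂μ := by
            have hm' : ∀ l, Measurable fun x => (dyadicLevel V T l).indicator
                (fun _ => ENNReal.ofReal (2 ^ l) ^ (((n : ℝ) + 1) / 2)) (t, x) := fun l =>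
              (measurable_const.indicator (hm l)).comp measurable_prodMk_left
            rw [lintegral_finsetSum _ fun l _ => hm' l]
            refine Finset.sum_congr rfl fun l _ => ?_
            rw [sliceMeas, ← lintegral_indicator_const (measurable_prodMk_left (hm l))]
            rfl
        _ ≤ _ := lintegral_mono fun x => sum_dyadicLevel_le V T L hr (t, x)
    calc _ = ∫⁻ t, ∑ l ∈ L, (ENNReal.ofReal (2 ^ l) ^ (((n : ℝ) + 1) / 2) *
          sliceMeas μ (dyadicLevel V T l) t) ^ 2 := by
          rw [lintegral_finsetSum _ fun l _ =>
            ((measurable_sliceMeas (hm l)).const_mul _).pow_const 2]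
          refine Finset.sum_congr rfl fun l _ => ?_
          rw [← lintegral_const_mul _ ((measurable_sliceMeas (hm l)).pow_const 2)]
          simp_rw [mul_pow, ofReal_rpow_half_sq]
      _ ≤ ∫⁻ t, (∑ l ∈ L, ENNReal.ofReal (2 ^ l) ^ (((n : ℝ) + 1) / 2) *
          sliceMeas μ (dyadicLevel V T l) t) ^ 2 := by
          refine lintegral_mono fun t => ?_
          dsimp only
          rw [sq (∑ l ∈ L, _), Finset.sum_mul]
          refine Finset.sum_le_sum fun l hl => ?_
          rw [sq]
          gcongr
          exact Finset.single_le_sum (f := fun l => ENNReal.ofReal (2 ^ l) ^ (((n : ℝ) + 1) / 2) *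
            sliceMeas μ (dyadicLevel V T l) t) (fun _ _ => zero_le) hl
      _ ≤ _ := lintegral_mono fun t => by gcongr; exact h1 t
  have hne : ∀ l : ℤ, ENNReal.ofReal ((2 ^ l) ^ (n + 1)) *
      ∫⁻ t, sliceMeas μ (dyadicLevel V T l) t ^ 2 ≠ ∞ := fun l => by
    have := hsum {l}
    rw [Finset.sum_singleton] at this
    exact (this.trans_lt one_lt_top).ne
  have hcancel : ∀ l : ℤ, ∫⁻ t, sliceMeas μ (dyadicLevel V T l) t ^ 2 =
      ENNReal.ofReal (((2 : ℝ) ^ (-l)) ^ (n + 1) * (ENNReal.ofReal ((2 ^ l) ^ (n + 1)) *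
        ∫⁻ t, sliceMeas μ (dyadicLevel V T l) t ^ 2).toReal) := fun l => by
    rw [ENNReal.ofReal_mul (by positivity), ENNReal.ofReal_toReal (hne l), ← mul_assoc,
      ← ENNReal.ofReal_mul (by positivity), ← mul_pow, zpow_neg, inv_mul_cancel₀ (by positivity)]
    simp
  refine ⟨hm, fun l => ?_, fun l => toReal_nonneg, ?_, fun l _ => (hcancel l).le⟩
  · have h1 : (volume.prod μ) (dyadicLevel V T l) =
        ∫⁻ t, (Icc (-T) T).indicator 1 t * sliceMeas μ (dyadicLevel V T l) t := by
      rw [Measure.prod_apply (hm l)]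
      refine lintegral_congr fun t => ?_
      by_cases ht : t ∈ Icc (-T) T
      · simp [ht, sliceMeas]
      · have : Prod.mk t ⁻¹' dyadicLevel V T l = ∅ := by
          ext x; simp only [dyadicLevel, mem_preimage, mem_inter_iff, mem_empty_iff_false,
            iff_false, not_and]
          exact fun _ => ht
        rw [this]; simp [ht]
    have h2 := lintegral_mul_sq_le (μ := volume) (f := (Icc (-T) T).indicator 1)
      (measurable_one.indicator measurableSet_Icc).aemeasurable
      (measurable_sliceMeas (μ := μ) (hm l)).aemeasurable
    rw [← h1] at h2
    have h3 : ∀ t, (Icc (-T) T).indicator (1 : ℝ → ℝ≥0∞) t ^ 2 = (Icc (-T) T).indicator 1 t := by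
      intro t; by_cases ht : t ∈ Icc (-T) T <;> simp [ht]
    simp_rw [h3] at h2
    rw [lintegral_indicator_one measurableSet_Icc, hcancel l] at h2
    have h4 := h2.trans_lt (ENNReal.mul_lt_top (by simp) ENNReal.ofReal_lt_top)
    by_contra h5
    rw [not_lt, top_le_iff] at h5
    rw [h5] at h4
    simp at h4
  · rw [← ENNReal.toReal_sum fun l _ => hne l]
    exact (ENNReal.toReal_mono one_ne_top (hsum L)).trans (by simp)

lemma AdmissibleWeight.ae_lt_top (hV : AdmissibleWeight n μ V) :
    ∀ᵐ z ∂((volume : Measure ℝ).prod μ), V z < ∞ := by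
  have hpow : Measurable fun z => V z ^ (((n : ℝ) + 1) / 2) := hV.meas.pow_const _
  have h1 : ∀ᵐ t, (∫⁻ x, V (t, x) ^ (((n : ℝ) + 1) / 2) ∂μ) ^ 2 < ∞ :=
    MeasureTheory.ae_lt_top (hpow.lintegral_prod_right'.pow_const 2) (hV.le_one.trans_lt one_lt_top).ne
  have hS : MeasurableSet {z | V z < ∞} := measurableSet_lt hV.meas measurable_const
  rw [Measure.ae_prod_iff_ae_ae hS]
  filter_upwards [h1] with t ht
  have h2 : ∫⁻ x, V (t, x) ^ (((n : ℝ) + 1) / 2) ∂μ ≠ ∞ := fun h => by simp [h] at ht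
  filter_upwards [MeasureTheory.ae_lt_top (hpow.comp measurable_prodMk_left) h2] with x hx
  by_contra h3
  rw [not_lt, top_le_iff] at h3
  simp only [Function.comp, h3] at hx
  rw [ENNReal.top_rpow_of_pos (by positivity)] at hx
  exact lt_irrefl _ hx

lemma Dispersive.weighted_le [CompleteSpace H] (hv : Dispersive n μ v) (hn : 2 ≤ n)
    {V : ℝ × X → ℝ≥0∞} (hV : AdmissibleWeight n μ V) {ι : Type*} [Fintype ι]
    {F : ι → H} (hF : Orthonormal ℂ F) {e : ℝ} (he : 0 < e) (he' : e ≤ 1 / 2) :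
    ∑ j, ∫⁻ z, V z * ‖inner ℂ (v z) (F j)‖ₑ ^ 2 ∂(volume.prod μ) ≤
      2 * ENNReal.ofReal (levelConst n e * (Fintype.card ι : ℝ) ^ (1 - gainExp n e / 2)) := by
  set ζ := (volume : Measure ℝ).prod μ
  have hum : ∀ w : H, Measurable fun z => inner ℂ (v z) w := fun w =>
    (hv.meas.inner stronglyMeasurable_const).measurable
  set h : ℝ × X → ℝ≥0∞ := fun z => ∑ j, ‖inner ℂ (v z) (F j)‖ₑ ^ 2 with hh
  have hhm : Measurable h := Finset.measurable_sum _ fun j _ => (hum _).enorm.pow_const 2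
  have h0 : ∑ j, ∫⁻ z, V z * ‖inner ℂ (v z) (F j)‖ₑ ^ 2 ∂ζ = ∫⁻ z, V z * h z ∂ζ := by
    have hVm : ∀ j, Measurable fun z => V z * ‖inner ℂ (v z) (F j)‖ₑ ^ 2 := fun j =>
      hV.meas.mul ((hum _).enorm.pow_const 2)
    rw [← lintegral_finsetSum _ fun j _ => hVm j]
    simp_rw [hh, Finset.mul_sum]
  rw [h0]
  set K := ENNReal.ofReal (levelConst n e * (Fintype.card ι : ℝ) ^ (1 - gainExp n e / 2))
  have hT : ∀ T : ℕ, ∫⁻ z in Prod.fst ⁻¹' Icc (-(T : ℝ)) T, V z * h z ∂ζ ≤ 2 * K := by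
    intro T
    have hS : MeasurableSet (Prod.fst ⁻¹' Icc (-(T : ℝ)) T : Set (ℝ × X)) :=
      measurable_fst measurableSet_Icc
    have hm := measurableSet_dyadicLevel hV.meas (T : ℝ)
    calc _ ≤ ∫⁻ z, 2 * ∑' l : ℤ, ENNReal.ofReal (2 ^ l) * (dyadicLevel V T l).indicator h z ∂ζ := by
          rw [← lintegral_indicator hS]
          refine lintegral_mono_ae ?_
          filter_upwards [hV.ae_lt_top] with z hz
          by_cases hzS : z ∈ (Prod.fst ⁻¹' Icc (-(T : ℝ)) T : Set (ℝ × X))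
          · rw [indicator_of_mem hzS]
            by_cases hz0 : V z = 0
            · simp [hz0]
            obtain ⟨l, hl⟩ := exists_mem_Ico_zpow (ENNReal.toReal_pos hz0 hz.ne)
              (by norm_num : (1 : ℝ) < 2)
            have hlV : V z ∈ Ico (ENNReal.ofReal (2 ^ l)) (ENNReal.ofReal (2 ^ (l + 1))) := by
              rw [← ENNReal.ofReal_toReal hz.ne]
              exact ⟨ENNReal.ofReal_le_ofReal hl.1,
                (ENNReal.ofReal_lt_ofReal_iff (by positivity)).2 hl.2⟩
            have hzl : z ∈ dyadicLevel V T l := ⟨hlV, hzS⟩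
            calc V z * h z ≤ (2 * ENNReal.ofReal (2 ^ l)) * h z := by
                  gcongr
                  refine hlV.2.le.trans_eq ?_
                  rw [zpow_add_one₀ (by norm_num), mul_comm, ENNReal.ofReal_mul (by norm_num)]
                  simp
              _ = 2 * (ENNReal.ofReal (2 ^ l) * (dyadicLevel V T l).indicator h z) := by
                  rw [indicator_of_mem hzl, mul_assoc]
              _ ≤ _ := by
                  gcongr
                  exact ENNReal.le_tsum (f := fun l : ℤ => ENNReal.ofReal (2 ^ l) *
                    (dyadicLevel V T l).indicator h z) l
          · rw [indicator_of_notMem hzS]; exact zero_le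
      _ = 2 * ∑' l : ℤ, ENNReal.ofReal (2 ^ l) * ∫⁻ z in dyadicLevel V T l, h z ∂ζ := by
          rw [lintegral_const_mul _ (Measurable.tsum fun l =>
            (hhm.indicator (hm l)).const_mul _), lintegral_tsum fun l =>
            ((hhm.indicator (hm l)).const_mul _).aemeasurable]
          congr 1
          refine tsum_congr fun l => ?_
          rw [lintegral_const_mul _ (hhm.indicator (hm l)), lintegral_indicator (hm l)]
      _ ≤ 2 * K := by
          gcongr
          rw [ENNReal.tsum_eq_iSup_sum]
          refine iSup_le fun L => ?_
          have := hv.weighted_levels_le hn (hV.levelSets T L) hF he he'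
          rw [← lintegral_finsetSum _ fun j _ => (hum _).enorm.pow_const 2, levelMeasure,
            lintegral_finsetSum_measure] at this
          simpa using this
  have hU : (⋃ T : ℕ, (Prod.fst ⁻¹' Icc (-(T : ℝ)) T : Set (ℝ × X))) = univ := by
    refine eq_univ_of_forall fun z => ?_
    obtain ⟨T, hT⟩ := exists_nat_ge |z.1|
    exact mem_iUnion.2 ⟨T, abs_le.1 hT⟩
  rw [← setLIntegral_univ, ← hU, setLIntegral_iUnion_of_directed]
  · exact iSup_le hT
  · refine (monotone_nat_of_le_succ fun T => ?_).directed_le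
    refine preimage_mono (Icc_subset_Icc ?_ ?_) <;> push_cast <;> linarith

end Weight

section Sequence

/-- The constant in the passage from uniform to weighted sums. -/
def sumConst (α κ : ℝ) : ℝ≥0∞ :=
  ∑' k : ℕ, ENNReal.ofReal (2 ^ (α * κ) * ((2 : ℝ) ^ (α * κ - 1)) ^ k)

lemma sumConst_lt_top {α κ : ℝ} (h : α * κ < 1) : sumConst α κ < ∞ := by
  have hg : (2 : ℝ) ^ (α * κ - 1) < 1 :=
    Real.rpow_lt_one_of_one_lt_of_neg (by norm_num) (by linarith)
  have hs : Summable fun k : ℕ => (2 : ℝ) ^ (α * κ) * ((2 : ℝ) ^ (α * κ - 1)) ^ k :=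
    (summable_geometric_of_lt_one (by positivity) hg).mul_left _
  rw [sumConst, ← ENNReal.ofReal_tsum_of_nonneg (fun k => by positivity) hs]
  exact ENNReal.ofReal_lt_top

lemma tsum_mul_le_of_sum_le {a x : ℕ → ℝ≥0∞} {A : ℝ≥0∞} {α κ : ℝ} (hα : 0 < α) (hκ : 0 < κ)
    (ha : ∑' j, a j ^ α ≠ ∞) (hx : ∀ J : Finset ℕ, ∑ j ∈ J, x j ≤ A * (J.card : ℝ≥0∞) ^ κ) :
    ∑' j, a j * x j ≤ sumConst α κ * A * (∑' j, a j ^ α) ^ (1 / α) := by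
  set N := (∑' j, a j ^ α) ^ (1 / α) with hN
  have hNα : N ^ α = ∑' j, a j ^ α := by
    rw [hN, ← ENNReal.rpow_mul, one_div_mul_cancel hα.ne', ENNReal.rpow_one]
  have hNtop : N ≠ ∞ := ENNReal.rpow_ne_top_of_nonneg (by positivity) ha
  rcases eq_or_ne N 0 with h0 | h0
  · have h1 : ∀ j, a j = 0 := fun j => by
      have : a j ^ α ≤ N ^ α := hNα ▸ ENNReal.le_tsum j
      rw [h0, ENNReal.zero_rpow_of_pos hα] at this
      have := le_antisymm this zero_le
      exact (ENNReal.rpow_eq_zero_iff_of_pos hα).1 this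
    simp [h1]
  set b : ℕ → ℝ≥0∞ := fun j => a j / N with hb
  have hab : ∀ j, a j = N * b j := fun j => (ENNReal.mul_div_cancel h0 hNtop).symm
  have hbs : ∀ J : Finset ℕ, ∑ j ∈ J, b j ^ α ≤ 1 := by
    intro J
    have h1 : ∑ j ∈ J, a j ^ α ≤ N ^ α := hNα ▸ ENNReal.sum_le_tsum J
    simp_rw [hab, ENNReal.mul_rpow_of_nonneg _ _ hα.le, ← Finset.mul_sum] at h1
    have hNα0 : N ^ α ≠ 0 := by
      rw [Ne, ENNReal.rpow_eq_zero_iff_of_pos hα]; exact h0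
    have hNαt : N ^ α ≠ ∞ := ENNReal.rpow_ne_top_of_nonneg hα.le hNtop
    calc _ = (N ^ α)⁻¹ * (N ^ α * ∑ j ∈ J, b j ^ α) := by
          rw [← mul_assoc, ENNReal.inv_mul_cancel hNα0 hNαt, one_mul]
      _ ≤ (N ^ α)⁻¹ * N ^ α := by gcongr
      _ = 1 := ENNReal.inv_mul_cancel hNα0 hNαt
  have hb1 : ∀ j, b j ≤ 1 := fun j => by
    have := hbs {j}
    rw [Finset.sum_singleton] at this
    rwa [← ENNReal.one_rpow α, ENNReal.rpow_le_rpow_iff hα] at this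
  set t : ℕ → ℝ≥0∞ := fun k => ENNReal.ofReal ((2 : ℝ) ^ (-(k : ℝ))) with ht
  set Jk : ℕ → Set ℕ := fun k => {j | t (k + 1) < b j} with hJk
  have hpt : ∀ j, b j * x j ≤ ∑' k, t k * (Jk k).indicator x j := by
    intro j
    rcases eq_or_ne (b j) 0 with h | h
    · simp [h]
    have hbt : b j ≠ ∞ := ((hb1 j).trans_lt one_lt_top).ne
    have hr0 : 0 < (b j).toReal := ENNReal.toReal_pos h hbt
    have hr1 : (b j).toReal ≤ 1 := ENNReal.toReal_le_of_le_ofReal (by norm_num) (by simpa using hb1 j)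
    obtain ⟨k, hk1, hk2⟩ := exists_nat_pow_near_of_lt_one hr0 hr1
      (by norm_num : (0 : ℝ) < 1 / 2) (by norm_num)
    have htk : ∀ k, t k = ENNReal.ofReal ((1 / 2) ^ k) := fun k => by
      rw [ht]; dsimp only
      rw [Real.rpow_neg (by norm_num), Real.rpow_natCast, one_div, inv_pow]
    have hmem : j ∈ Jk k := by
      rw [hJk]
      change t (k + 1) < b j
      rw [htk, ← ENNReal.ofReal_toReal hbt]
      exact (ENNReal.ofReal_lt_ofReal_iff hr0).2 hk1
    calc b j * x j ≤ t k * (Jk k).indicator x j := by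
          rw [indicator_of_mem hmem]
          gcongr
          rw [htk, ← ENNReal.ofReal_toReal hbt]
          exact ENNReal.ofReal_le_ofReal hk2
      _ ≤ _ := ENNReal.le_tsum (f := fun k => t k * (Jk k).indicator x j) k
  have hlev : ∀ k, ∑' j, (Jk k).indicator x j ≤
      A * ENNReal.ofReal ((2 : ℝ) ^ (((k : ℝ) + 1) * (α * κ))) := by
    intro k
    classical
    rw [ENNReal.tsum_eq_iSup_sum]
    refine iSup_le fun S => ?_
    set J := S.filter fun j => j ∈ Jk k
    have hJ : ∑ j ∈ S, (Jk k).indicator x j = ∑ j ∈ J, x j := by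
      rw [Finset.sum_filter]
      exact Finset.sum_congr rfl fun j _ => by simp [Set.indicator_apply]
    rw [hJ]
    refine (hx _).trans ?_
    gcongr
    have h1 : (J.card : ℝ≥0∞) * t (k + 1) ^ α ≤ 1 := by
      refine le_trans ?_ (hbs J)
      rw [← nsmul_eq_mul, ← Finset.sum_const]
      refine Finset.sum_le_sum fun j hj => ?_
      exact ENNReal.rpow_le_rpow (Finset.mem_filter.1 hj).2.le hα.le
    have h2 : t (k + 1) ^ α = ENNReal.ofReal ((2 : ℝ) ^ (-(((k : ℝ) + 1) * α))) := by
      rw [ht]; dsimp only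
      rw [ENNReal.ofReal_rpow_of_nonneg (by positivity) hα.le, ← Real.rpow_mul (by norm_num)]
      push_cast; congr 2; ring
    have h3 : (J.card : ℝ≥0∞) ≤ ENNReal.ofReal ((2 : ℝ) ^ (((k : ℝ) + 1) * α)) := by
      calc (J.card : ℝ≥0∞) = J.card * t (k + 1) ^ α *
            ENNReal.ofReal ((2 : ℝ) ^ (((k : ℝ) + 1) * α)) := by
            rw [h2, mul_assoc, ← ENNReal.ofReal_mul (by positivity), ← Real.rpow_add (by norm_num)]
            simp
        _ ≤ 1 * ENNReal.ofReal ((2 : ℝ) ^ (((k : ℝ) + 1) * α)) := by gcongr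
        _ = _ := one_mul _
    calc (J.card : ℝ≥0∞) ^ κ ≤ ENNReal.ofReal ((2 : ℝ) ^ (((k : ℝ) + 1) * α)) ^ κ := by gcongr
      _ = _ := by
        rw [ENNReal.ofReal_rpow_of_nonneg (by positivity) hκ.le, ← Real.rpow_mul (by norm_num),
          mul_assoc]
  calc ∑' j, a j * x j = N * ∑' j, b j * x j := by
        simp_rw [hab, mul_assoc]; rw [ENNReal.tsum_mul_left]
    _ ≤ N * ∑' j, ∑' k, t k * (Jk k).indicator x j := by gcongr with j; exact hpt j
    _ = N * ∑' k, t k * ∑' j, (Jk k).indicator x j := by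
        rw [ENNReal.tsum_comm]; simp_rw [ENNReal.tsum_mul_left]
    _ ≤ N * ∑' k : ℕ, t k * (A * ENNReal.ofReal ((2 : ℝ) ^ (((k : ℝ) + 1) * (α * κ)))) := by
        gcongr with k; exact hlev k
    _ = N * ∑' k : ℕ, A * ENNReal.ofReal (2 ^ (α * κ) * ((2 : ℝ) ^ (α * κ - 1)) ^ k) := by
        congr 1
        refine tsum_congr fun k => ?_
        rw [mul_left_comm, ht, ← ENNReal.ofReal_mul (by positivity)]
        congr 2
        rw [← Real.rpow_natCast, ← Real.rpow_mul (by norm_num), ← Real.rpow_add (by norm_num),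
          ← Real.rpow_add (by norm_num)]
        congr 1; ring
    _ = _ := by rw [ENNReal.tsum_mul_left, sumConst]; ring

end Sequence

section Duality

open Filter Topology

variable {X : Type*} [MeasurableSpace X] {μ : Measure X} [SigmaFinite μ]

/-- The `n`-dimensional endpoint mixed norm, to the power `(n+1)/n`. -/
def mixedEnergy (n : ℕ) (μ : Measure X) (F : ℝ × X → ℝ≥0∞) : ℝ≥0∞ :=
  ∫⁻ t, (∫⁻ x, F (t, x) ^ (((n : ℝ) + 1) / (n - 1)) ∂μ) ^ (((n : ℝ) - 1) / n)

lemma mixedEnergy_le_of_ne_top {n : ℕ} (hn : 2 ≤ n) {F : ℝ × X → ℝ≥0∞} (hF : Measurable F)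
    {K : ℝ≥0∞} (hK : ∀ V, AdmissibleWeight n μ V → ∫⁻ z, V z * F z ∂(volume.prod μ) ≤ K)
    (hr : ∀ t, ∫⁻ x, F (t, x) ^ (((n : ℝ) + 1) / (n - 1)) ∂μ ≠ ∞)
    (hI : mixedEnergy n μ F ≠ ∞) :
    mixedEnergy n μ F ^ ((n : ℝ) / (n + 1)) ≤ K := by
  have hn' : (2 : ℝ) ≤ n := by exact_mod_cast hn
  have hn0 : (n : ℝ) ≠ 0 := by positivity
  have hn1 : (n : ℝ) - 1 ≠ 0 := by linarith
  have hn2 : (n : ℝ) + 1 ≠ 0 := by positivity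
  set I := mixedEnergy n μ F with hIdef
  have hp0 : 0 < (n : ℝ) / (n + 1) := by positivity
  rcases eq_or_ne I 0 with h0 | h0
  · rw [h0, ENNReal.zero_rpow_of_pos hp0]; exact zero_le
  set r : ℝ → ℝ≥0∞ := fun t => ∫⁻ x, F (t, x) ^ (((n : ℝ) + 1) / (n - 1)) ∂μ with hrdef
  have hrm : Measurable r := (hF.pow_const _).lintegral_prod_right'
  have hsl : ∀ t, Measurable fun x => F (t, x) := fun t => hF.comp measurable_prodMk_left
  have hIr : I = ∫⁻ t, r t ^ (((n : ℝ) - 1) / n) := rfl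
  have hq : 0 < ((n : ℝ) - 1) / n := by apply div_pos <;> linarith
  set V : ℝ × X → ℝ≥0∞ := fun z =>
    F z ^ (2 / ((n : ℝ) - 1)) * (r z.1 ^ (-(1 / (n : ℝ))) * I ^ (-(1 / ((n : ℝ) + 1)))) with hV
  have hVm : Measurable V :=
    (hF.pow_const _).mul (((hrm.comp measurable_fst).pow_const _).mul_const _)
  have hadm : AdmissibleWeight n μ V := by
    refine ⟨hVm, ?_⟩
    have h1 : ∀ t, (∫⁻ x, V (t, x) ^ (((n : ℝ) + 1) / 2) ∂μ) ^ 2 =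
        r t ^ (((n : ℝ) - 1) / n) * I⁻¹ := by
      intro t
      have h2 : ∀ x, V (t, x) ^ (((n : ℝ) + 1) / 2) = F (t, x) ^ (((n : ℝ) + 1) / (n - 1)) *
          (r t ^ (-(1 / (n : ℝ))) * I ^ (-(1 / ((n : ℝ) + 1)))) ^ (((n : ℝ) + 1) / 2) := by
        intro x
        rw [hV]; dsimp only
        rw [ENNReal.mul_rpow_of_nonneg _ _ (by positivity), ← ENNReal.rpow_mul]
        congr 2; field_simp
      simp_rw [h2]
      rw [lintegral_mul_const _ ((hsl t).pow_const _),
        ENNReal.mul_rpow_of_nonneg _ _ (by positivity), ← ENNReal.rpow_mul, ← ENNReal.rpow_mul]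
      change (r t * _) ^ 2 = _
      rcases eq_or_ne (r t) 0 with h0 | h0
      · rw [h0, ENNReal.zero_rpow_of_pos hq]; simp
      · rw [← ENNReal.rpow_natCast, ENNReal.mul_rpow_of_nonneg _ _ (by positivity),
          ENNReal.mul_rpow_of_nonneg _ _ (by positivity), ← ENNReal.rpow_mul, ← ENNReal.rpow_mul,
          ← mul_assoc, ← ENNReal.rpow_add _ _ h0 (hr t), ← ENNReal.rpow_neg_one I]
        congr 2 <;> push_cast <;> field_simp <;> ring
    simp_rw [h1]
    rw [lintegral_mul_const _ (hrm.pow_const _), ← hIr, ENNReal.mul_inv_cancel h0 hI]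
  refine le_trans (le_of_eq ?_) (hK V hadm)
  have h3 : ∀ t, ∫⁻ x, V (t, x) * F (t, x) ∂μ =
      r t ^ (((n : ℝ) - 1) / n) * I ^ (-(1 / ((n : ℝ) + 1))) := by
    intro t
    have h2 : ∀ x, V (t, x) * F (t, x) = F (t, x) ^ (((n : ℝ) + 1) / (n - 1)) *
        (r t ^ (-(1 / (n : ℝ))) * I ^ (-(1 / ((n : ℝ) + 1)))) := by
      intro x
      rw [hV]; dsimp only
      rw [mul_right_comm]
      congr 1
      conv_lhs => rw [← ENNReal.rpow_one (F (t, x)), ← ENNReal.rpow_mul, one_mul]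
      rw [← ENNReal.rpow_add_of_nonneg _ _ (by apply div_nonneg <;> linarith) zero_le_one]
      congr 1; field_simp; ring
    simp_rw [h2]
    rw [lintegral_mul_const _ ((hsl t).pow_const _)]
    change r t * _ = _
    rcases eq_or_ne (r t) 0 with h0 | h0
    · rw [h0, ENNReal.zero_rpow_of_pos hq]; simp
    · rw [← mul_assoc]
      congr 1
      conv_lhs => rw [← ENNReal.rpow_one (r t), ← ENNReal.rpow_mul, one_mul]
      rw [← ENNReal.rpow_add _ _ h0 (hr t)]
      congr 1; field_simp; ring
  have hVF : Measurable fun z => V z * F z := hVm.mul hF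
  rw [lintegral_prod _ hVF.aemeasurable]
  simp_rw [h3]
  rw [lintegral_mul_const _ (hrm.pow_const _), ← hIr]
  conv_rhs => rw [← ENNReal.rpow_one I, ← ENNReal.rpow_mul, one_mul]
  rw [← ENNReal.rpow_add _ _ h0 hI]
  congr 1; field_simp; ring

theorem mixedEnergy_le {n : ℕ} (hn : 2 ≤ n) {F : ℝ × X → ℝ≥0∞} (hF : Measurable F)
    {K : ℝ≥0∞} (hK : ∀ V, AdmissibleWeight n μ V → ∫⁻ z, V z * F z ∂(volume.prod μ) ≤ K) :
    mixedEnergy n μ F ^ ((n : ℝ) / (n + 1)) ≤ K := by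
  have hn' : (2 : ℝ) ≤ n := by exact_mod_cast hn
  have hp : 0 < ((n : ℝ) + 1) / (n - 1) := by apply div_pos <;> linarith
  have hp' : 0 < ((n : ℝ) - 1) / n := by apply div_pos <;> linarith
  set S : ℕ → Set (ℝ × X) := fun k => Icc (-(k : ℝ)) k ×ˢ spanningSets μ k with hS
  have hSm : ∀ k, MeasurableSet (S k) := fun k =>
    measurableSet_Icc.prod (measurableSet_spanningSets μ k)
  have hSmono : Monotone S := by
    intro k l hkl
    refine prod_mono (Icc_subset_Icc ?_ ?_) (monotone_spanningSets μ hkl) <;>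
      [rw [neg_le_neg_iff]; skip] <;> exact_mod_cast hkl
  have hSmem : ∀ z, ∀ᶠ k in atTop, z ∈ S k := by
    intro z
    obtain ⟨a, ha⟩ := exists_nat_ge |z.1|
    obtain ⟨b, hb⟩ := mem_iUnion.1 ((iUnion_spanningSets μ).symm ▸ mem_univ z.2)
    filter_upwards [eventually_ge_atTop (max a b)] with k hk
    refine hSmono hk ⟨abs_le.1 (ha.trans ?_), monotone_spanningSets μ (le_max_right a b) hb⟩
    exact_mod_cast le_max_left a b
  set G : ℕ → ℝ × X → ℝ≥0∞ := fun k => (S k).indicator fun z => min (F z) k with hG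
  have hGm : ∀ k, Measurable (G k) := fun k => (hF.min measurable_const).indicator (hSm k)
  have hGF : ∀ k z, G k z ≤ F z := fun k z =>
    (indicator_le_self' (fun _ _ => zero_le) z).trans (min_le_left _ _)
  have hGmono : ∀ z, Monotone fun k => G k z := by
    intro z k l hkl
    by_cases hz : z ∈ S k
    · simp only [hG, indicator_of_mem hz, indicator_of_mem (hSmono hkl hz)]
      gcongr
    · simp only [hG, indicator_of_notMem hz]; exact zero_le
  have hGlim : ∀ z, Tendsto (fun k => G k z) atTop (𝓝 (F z)) := by
    intro z
    have h1 : Tendsto (fun k : ℕ => min (F z) (k : ℝ≥0∞)) atTop (𝓝 (min (F z) ∞)) :=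
      tendsto_const_nhds.min ENNReal.tendsto_nat_nhds_top
    rw [min_eq_left le_top] at h1
    refine h1.congr' ?_
    filter_upwards [hSmem z] with k hk
    simp only [hG, indicator_of_mem hk]
  have hrle : ∀ k t, ∫⁻ x, G k (t, x) ^ (((n : ℝ) + 1) / (n - 1)) ∂μ ≤
      (Icc (-(k : ℝ)) k).indicator
        (fun _ => (k : ℝ≥0∞) ^ (((n : ℝ) + 1) / (n - 1)) * μ (spanningSets μ k)) t := by
    intro k t
    by_cases ht : t ∈ Icc (-(k : ℝ)) k
    · rw [indicator_of_mem ht, ← lintegral_indicator_const (measurableSet_spanningSets μ k)]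
      refine lintegral_mono fun x => ?_
      by_cases hx : x ∈ spanningSets μ k
      · rw [indicator_of_mem hx]
        refine ENNReal.rpow_le_rpow ?_ hp.le
        simp only [hG]
        rw [indicator_of_mem (show (t, x) ∈ S k from ⟨ht, hx⟩)]
        exact min_le_right _ _
      · simp only [hG]
        rw [indicator_of_notMem (fun h : (t, x) ∈ S k => hx h.2), ENNReal.zero_rpow_of_pos hp]
        exact zero_le
    · rw [indicator_of_notMem ht]
      refine le_of_eq ((lintegral_congr fun x => ?_).trans lintegral_zero)
      simp only [hG]
      rw [indicator_of_notMem (fun h : (t, x) ∈ S k => ht h.1), ENNReal.zero_rpow_of_pos hp]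
  have hcfin : ∀ k : ℕ, (k : ℝ≥0∞) ^ (((n : ℝ) + 1) / (n - 1)) * μ (spanningSets μ k) ≠ ∞ :=
    fun k => ENNReal.mul_ne_top (ENNReal.rpow_ne_top_of_nonneg hp.le (ENNReal.natCast_ne_top k))
      (measure_spanningSets_lt_top μ k).ne
  have hr : ∀ k t, ∫⁻ x, G k (t, x) ^ (((n : ℝ) + 1) / (n - 1)) ∂μ ≠ ∞ := by
    intro k t
    refine ((hrle k t).trans (indicator_le_self' (fun _ _ => zero_le) t)).trans_lt
      (hcfin k).lt_top |>.ne
  have hI : ∀ k, mixedEnergy n μ (G k) ≠ ∞ := by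
    intro k
    have h1 : mixedEnergy n μ (G k) ≤ ∫⁻ t, (Icc (-(k : ℝ)) k).indicator
        (fun _ => ((k : ℝ≥0∞) ^ (((n : ℝ) + 1) / (n - 1)) * μ (spanningSets μ k)) ^
          (((n : ℝ) - 1) / n)) t := by
      refine lintegral_mono fun t => (ENNReal.rpow_le_rpow (hrle k t) hp'.le).trans (le_of_eq ?_)
      by_cases ht : t ∈ Icc (-(k : ℝ)) k
      · simp only [indicator_of_mem ht]
      · simp only [indicator_of_notMem ht, ENNReal.zero_rpow_of_pos hp']
    refine (h1.trans_lt ?_).ne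
    rw [lintegral_indicator_const measurableSet_Icc]
    exact ENNReal.mul_lt_top (ENNReal.rpow_lt_top_of_nonneg hp'.le (hcfin k)) (by simp)
  have hk : ∀ k, mixedEnergy n μ (G k) ^ ((n : ℝ) / (n + 1)) ≤ K := fun k =>
    mixedEnergy_le_of_ne_top hn (hGm k) (fun V hV => (lintegral_mono fun z => by
      gcongr; exact hGF k z).trans (hK V hV)) (hr k) (hI k)
  have hsl : ∀ k t, Measurable fun x => G k (t, x) := fun k t =>
    (hGm k).comp measurable_prodMk_left
  have hlim : Tendsto (fun k => mixedEnergy n μ (G k)) atTop (𝓝 (mixedEnergy n μ F)) := by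
    refine lintegral_tendsto_of_tendsto_of_monotone
      (fun k => (((hGm k).pow_const _).lintegral_prod_right'.pow_const _).aemeasurable)
      (ae_of_all _ fun t k l hkl => ?_) (ae_of_all _ fun t => ?_)
    · exact ENNReal.rpow_le_rpow (lintegral_mono fun x =>
        ENNReal.rpow_le_rpow (hGmono (t, x) hkl) hp.le) hp'.le
    · refine ((ENNReal.continuous_rpow_const).tendsto _).comp
        (lintegral_tendsto_of_tendsto_of_monotone (fun k => ((hsl k t).pow_const _).aemeasurable)
          (ae_of_all _ fun x k l hkl => ENNReal.rpow_le_rpow (hGmono (t, x) hkl) hp.le)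
          (ae_of_all _ fun x => ((ENNReal.continuous_rpow_const).tendsto _).comp (hGlim (t, x))))
  exact le_of_tendsto (((ENNReal.continuous_rpow_const).tendsto _).comp hlim)
    (Eventually.of_forall hk)

end Duality

section Plancherel

open FourierTransform ComplexInnerProductSpace SchwartzMap

variable {E : Type*} [NormedAddCommGroup E] [InnerProductSpace ℝ E] [FiniteDimensional ℝ E]
  [MeasurableSpace E] [BorelSpace E]

lemma integral_schwartz_fourier_mul (g : 𝓢(E, ℂ)) {f : E → ℂ} (hf : Integrable f) :
    ∫ x, (𝓕 g) x * f x = ∫ x, g x * 𝓕 f x := by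
  have := VectorFourier.integral_fourierIntegral_smul_eq_flip (L := innerₗ E) (μ := volume)
    (ν := volume) (f := g) (g := f) Real.continuous_fourierChar continuous_inner
    g.integrable hf
  rw [flip_innerₗ] at this
  exact this

lemma coe_fourier_toLp_ae_eq {f : E → ℂ} (hf : Integrable f) (hf2 : MemLp f 2) :
    ((𝓕 (hf2.toLp f) : Lp ℂ 2 (volume : Measure E)) : E → ℂ) =ᵐ[volume] 𝓕 f := by
  have hc : Continuous (𝓕 f) := VectorFourier.fourierIntegral_continuous
    Real.continuous_fourierChar continuous_inner hf
  refine ae_eq_of_integral_contDiff_smul_eq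
    ((Lp.memLp _).locallyIntegrable (by norm_num)) hc.locallyIntegrable fun g hg hgs => ?_
  set G : 𝓢(E, ℂ) := (hgs.comp_left (g := fun r : ℝ => (r : ℂ)) rfl).toSchwartzMap
    (Complex.ofRealCLM.contDiff.comp hg)
  have hG : ∀ x, G x = (g x : ℂ) := fun x => rfl
  have h1 := DFunLike.congr_fun (Lp.fourier_toTemperedDistribution_eq (hf2.toLp f)) G
  rw [TemperedDistribution.fourier_apply, Lp.toTemperedDistribution_apply,
    Lp.toTemperedDistribution_apply] at h1
  calc ∫ x, g x • (𝓕 (hf2.toLp f) : Lp ℂ 2 (volume : Measure E)) x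
      = ∫ x, G x • (𝓕 (hf2.toLp f) : Lp ℂ 2 (volume : Measure E)) x := by simp [hG]
    _ = ∫ x, (𝓕 G) x • (hf2.toLp f) x := h1.symm
    _ = ∫ x, (𝓕 G) x • f x := by
        refine integral_congr_ae ?_
        filter_upwards [hf2.coeFn_toLp] with x hx
        rw [hx]
    _ = ∫ x, G x * 𝓕 f x := integral_schwartz_fourier_mul G hf
    _ = _ := by simp [hG]

lemma memLp_fourier {f : E → ℂ} (hf : Integrable f) (hf2 : MemLp f 2) : MemLp (𝓕 f) 2 :=
  (memLp_congr_ae (coe_fourier_toLp_ae_eq hf hf2)).1 (Lp.memLp _)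

lemma toLp_fourier_eq_fourier_toLp {f : E → ℂ} (hf : Integrable f) (hf2 : MemLp f 2) :
    (memLp_fourier hf hf2).toLp (𝓕 f) = 𝓕 (hf2.toLp f) :=
  Lp.ext ((MemLp.coeFn_toLp _).trans (coe_fourier_toLp_ae_eq hf hf2).symm)

lemma lintegral_enorm_sq_eq_toLp {f : E → ℂ} (hf : MemLp f 2) :
    ∫⁻ x, ‖f x‖ₑ ^ 2 = ‖hf.toLp f‖ₑ ^ 2 := by
  rw [Lp.enorm_toLp, eLpNorm_eq_lintegral_rpow_enorm_toReal (by norm_num) (by norm_num),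
    ← ENNReal.rpow_natCast, ← ENNReal.rpow_mul]
  simp

lemma lintegral_enorm_fourier_sq {f : E → ℂ} (hf : Integrable f) (hf2 : MemLp f 2) :
    ∫⁻ x, ‖𝓕 f x‖ₑ ^ 2 = ∫⁻ x, ‖f x‖ₑ ^ 2 := by
  rw [lintegral_enorm_sq_eq_toLp hf2, lintegral_enorm_sq_eq_toLp (memLp_fourier hf hf2),
    toLp_fourier_eq_fourier_toLp hf, ← ofReal_norm, Lp.norm_fourier_eq, ofReal_norm]

lemma lintegral_enorm_fourierInv_sq {f : E → ℂ} (hf : Integrable f) (hf2 : MemLp f 2) :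
    ∫⁻ x, ‖𝓕⁻ f x‖ₑ ^ 2 = ∫⁻ x, ‖f x‖ₑ ^ 2 := by
  rw [← lintegral_enorm_fourier_sq hf hf2, ← lintegral_neg_eq_self (fun x => ‖𝓕 f x‖ₑ ^ 2)]
  simp_rw [Real.fourierInv_eq_fourier_neg]

lemma inner_toLp_eq {f g : E → ℂ} (hf : MemLp f 2) (hg : MemLp g 2) :
    ⟪hf.toLp f, hg.toLp g⟫ = ∫ x, g x * (starRingEnd ℂ) (f x) := by
  rw [L2.inner_def]
  refine integral_congr_ae ?_
  filter_upwards [hf.coeFn_toLp, hg.coeFn_toLp] with x h1 h2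
  rw [h1, h2]; simp

end Plancherel

section Gaussian

open FourierTransform ComplexInnerProductSpace

variable {n : ℕ}

/-- The damped plane wave with which one pairs `𝓕 f` to evaluate the propagator at `(t, x)`. -/
def wave (ε : ℝ) (z : ℝ × Rn n) (w : Rn n) : ℂ :=
  Complex.exp (-(ε - 4 * π ^ 2 * z.1 * Complex.I) * (‖w‖ : ℂ) ^ 2 +
    (-(2 * π * Complex.I)) * (inner ℝ z.2 w : ℝ))

lemma norm_wave (ε : ℝ) (z : ℝ × Rn n) (w : Rn n) : ‖wave ε z w‖ = rexp (-ε * ‖w‖ ^ 2) := by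
  rw [wave, Complex.norm_exp]
  congr 1
  simp [← Complex.ofReal_pow]

lemma conj_wave (ε : ℝ) (z : ℝ × Rn n) (w : Rn n) :
    (starRingEnd ℂ) (wave ε z w) =
      Complex.exp (-(ε + 4 * π ^ 2 * z.1 * Complex.I) * (‖w‖ : ℂ) ^ 2 +
        (2 * π * Complex.I) * (inner ℝ z.2 w : ℝ)) := by
  rw [wave, ← Complex.exp_conj]
  congr 1
  simp [Complex.conj_ofNat, sub_eq_add_neg, add_comm]

lemma integrable_gaussian {ε : ℝ} (hε : 0 < ε) :
    Integrable fun w : Rn n => rexp (-ε * ‖w‖ ^ 2) := by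
  have := (GaussianFourier.integrable_cexp_neg_mul_sq_norm_add (V := Rn n) (b := ε)
    (by simpa using hε) 0 0).norm
  refine this.congr (ae_of_all _ fun w => ?_)
  dsimp only
  rw [Complex.norm_exp]
  congr 1
  simp [← Complex.ofReal_pow]

lemma memLp_wave {ε : ℝ} (hε : 0 < ε) (z : ℝ × Rn n) : MemLp (wave ε z) 2 := by
  have hc : Continuous (wave ε z) := by unfold wave; fun_prop
  rw [memLp_two_iff_integrable_sq_norm hc.aestronglyMeasurable]
  refine (integrable_gaussian (n := n) (ε := 2 * ε) (by positivity)).congr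
    (ae_of_all _ fun w => ?_)
  dsimp only
  rw [norm_wave, ← Real.exp_nat_mul]
  congr 1; push_cast; ring

/-- The field of damped plane waves. -/
def waveField {ε : ℝ} (hε : 0 < ε) (z : ℝ × Rn n) : Lp ℂ 2 (volume : Measure (Rn n)) :=
  (memLp_wave hε z).toLp _

lemma inner_waveField_wave {ε : ℝ} (hε : 0 < ε) (z z' : ℝ × Rn n) :
    ⟪waveField hε z, waveField hε z'⟫ = ∫ w, wave ε z' w * (starRingEnd ℂ) (wave ε z w) :=
  inner_toLp_eq _ _

lemma wave_mul_conj (ε : ℝ) (z z' : ℝ × Rn n) (w : Rn n) :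
    wave ε z' w * (starRingEnd ℂ) (wave ε z w) =
      Complex.exp (-(2 * ε - 4 * π ^ 2 * (z'.1 - z.1) * Complex.I) * (‖w‖ : ℂ) ^ 2 +
        (2 * π * Complex.I) * (inner ℝ (z.2 - z'.2) w : ℝ)) := by
  rw [conj_wave, wave, ← Complex.exp_add]
  congr 1
  rw [inner_sub_left]; push_cast; ring

lemma norm_inner_waveField_le {ε : ℝ} (hε : 0 < ε) (z z' : ℝ × Rn n) :
    ‖⟪waveField hε z, waveField hε z'⟫‖ ≤
      (π / ‖(2 * ε - 4 * π ^ 2 * (z'.1 - z.1) * Complex.I : ℂ)‖) ^ ((n : ℝ) / 2) := by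
  set b : ℂ := 2 * ε - 4 * π ^ 2 * (z'.1 - z.1) * Complex.I with hb
  have hre : b.re = 2 * ε := by simp [hb, ← Complex.ofReal_pow, ← Complex.ofReal_sub]
  have hre0 : 0 < b.re := by rw [hre]; positivity
  have hb0 : b ≠ 0 := fun h => by rw [h] at hre0; simp at hre0
  rw [inner_waveField_wave]
  simp_rw [wave_mul_conj]
  rw [← hb, GaussianFourier.integral_cexp_neg_mul_sq_norm_add hre0, norm_mul]
  have h1 : ‖Complex.exp ((2 * π * Complex.I) ^ 2 * (‖z.2 - z'.2‖ : ℂ) ^ 2 / (4 * b))‖ ≤ 1 := by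
    rw [Complex.norm_exp, Real.exp_le_one_iff]
    have : (2 * π * Complex.I) ^ 2 * (‖z.2 - z'.2‖ : ℂ) ^ 2 / (4 * b) =
        ((-(π ^ 2 * ‖z.2 - z'.2‖ ^ 2) : ℝ) : ℂ) * b⁻¹ := by
      rw [mul_pow, Complex.I_sq]; push_cast; field_simp; ring
    rw [this, Complex.re_ofReal_mul, Complex.inv_re]
    have : 0 ≤ b.re / Complex.normSq b := div_nonneg hre0.le (Complex.normSq_nonneg _)
    nlinarith [mul_nonneg (by positivity : 0 ≤ π ^ 2 * ‖z.2 - z'.2‖ ^ 2) this]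
  have h2 : ‖((π : ℂ) / b) ^ ((Module.finrank ℝ (Rn n) : ℂ) / 2)‖ =
      (π / ‖b‖) ^ ((n : ℝ) / 2) := by
    rw [finrank_euclideanSpace_fin]
    have : ((n : ℂ) / 2) = (((n : ℝ) / 2 : ℝ) : ℂ) := by push_cast; rfl
    rw [this, Complex.norm_cpow_real, norm_div, Complex.norm_real, Real.norm_of_nonneg pi_pos.le]
  rw [h2]
  exact mul_le_of_le_one_right (by positivity) h1

end Gaussian

section WaveField

open FourierTransform ComplexInnerProductSpace

variable {n : ℕ}

lemma norm_waveField_sq {ε : ℝ} (hε : 0 < ε) (z : ℝ × Rn n) :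
    ‖waveField hε z‖ ^ 2 = ‖waveField hε (0 : ℝ × Rn n)‖ ^ 2 := by
  have h : ∀ z : ℝ × Rn n, ((‖waveField hε z‖ ^ 2 : ℝ) : ℂ) = ∫ w : Rn n, ((rexp (-ε * ‖w‖ ^ 2) ^ 2 : ℝ) : ℂ) := by
    intro z
    rw [Complex.ofReal_pow]
    refine (inner_self_eq_norm_sq_to_K (𝕜 := ℂ) (waveField hε z)).symm.trans ?_
    rw [inner_waveField_wave]
    refine integral_congr_ae (ae_of_all _ fun w => ?_)
    dsimp only
    rw [Complex.mul_conj, Complex.normSq_eq_norm_sq, norm_wave]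
  exact_mod_cast (h z).trans (h 0).symm

lemma continuous_waveField {ε : ℝ} (hε : 0 < ε) :
    Continuous (waveField hε : ℝ × Rn n → Lp ℂ 2 (volume : Measure (Rn n))) := by
  have hker : ∀ z : ℝ × Rn n, Continuous fun z' => ⟪waveField hε z, waveField hε z'⟫ := by
    intro z
    simp_rw [inner_waveField_wave]
    have hc : ∀ z' : ℝ × Rn n, Continuous (wave ε z') := fun z' => by unfold wave; fun_prop
    refine continuous_of_dominated (bound := fun w => rexp (-(2 * ε) * ‖w‖ ^ 2))
      (fun z' => ((hc z').mul (Complex.continuous_conj.comp (hc z))).aestronglyMeasurable)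
      (fun z' => ae_of_all _ fun w => ?_) (integrable_gaussian (by positivity))
      (ae_of_all _ fun w => ?_)
    · rw [norm_mul, RCLike.norm_conj, norm_wave, norm_wave, ← Real.exp_add]
      apply le_of_eq; congr 1; ring
    · refine Continuous.mul ?_ continuous_const
      unfold wave; fun_prop
  rw [continuous_iff_continuousAt]
  intro z
  rw [ContinuousAt, tendsto_iff_norm_sub_tendsto_zero]
  have h : ∀ z', ‖waveField hε z' - waveField hε z‖ = √(2 * (‖waveField hε (0 : ℝ × Rn n)‖ ^ 2 -
      RCLike.re ⟪waveField hε z, waveField hε z'⟫)) := by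
    intro z'
    rw [← Real.sqrt_sq (norm_nonneg (waveField hε z' - waveField hε z)), norm_sub_rev,
      norm_sub_sq (𝕜 := ℂ), norm_waveField_sq hε z, norm_waveField_sq hε z']
    congr 1; ring
  simp_rw [h]
  have hlim : ContinuousAt (fun z' => √(2 * (‖waveField hε (0 : ℝ × Rn n)‖ ^ 2 -
      RCLike.re ⟪waveField hε z, waveField hε z'⟫))) z :=
    (Real.continuous_sqrt.comp (continuous_const.mul (continuous_const.sub
      (RCLike.continuous_re.comp (hker z))))).continuousAt
  have h0 : √(2 * (‖waveField hε (0 : ℝ × Rn n)‖ ^ 2 -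
      RCLike.re ⟪waveField hε z, waveField hε z⟫)) = 0 := by
    rw [← h z, sub_self, norm_zero]
  rw [ContinuousAt, h0] at hlim
  exact hlim

lemma inner_waveField_eq_fourierInv {ε : ℝ} (hε : 0 < ε) (t : ℝ) (x : Rn n)
    (w : Lp ℂ 2 (volume : Measure (Rn n))) :
    ⟪waveField hε (t, x), w⟫ = 𝓕⁻ (fun ξ => w ξ * (starRingEnd ℂ) (wave ε (t, 0) ξ)) x := by
  rw [L2.inner_def, Real.fourierInv_eq']
  refine integral_congr_ae ?_
  filter_upwards [(memLp_wave hε (t, x)).coeFn_toLp] with ξ hξ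
  rw [waveField, hξ, RCLike.inner_apply, smul_eq_mul, conj_wave, conj_wave, mul_left_comm,
    ← Complex.exp_add]
  congr 2
  rw [real_inner_comm]
  simp
  ring

lemma dispersive_waveField {ε : ℝ} (hε : 0 < ε) :
    Dispersive n (volume : Measure (Rn n)) (waveField hε) where
  meas := (continuous_waveField hε).stronglyMeasurable
  bdd := ⟨‖waveField hε (0 : ℝ × Rn n)‖, fun z => le_of_eq <|
    (pow_left_inj₀ (norm_nonneg _) (norm_nonneg _) two_ne_zero).1 (norm_waveField_sq hε z)⟩
  slice := by
    intro t w
    have hc : Continuous fun ξ => (starRingEnd ℂ) (wave ε (t, (0 : Rn n)) ξ) := by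
      unfold wave; fun_prop
    have hL2 : MemLp (fun ξ => (starRingEnd ℂ) (wave ε (t, (0 : Rn n)) ξ)) 2 :=
      (memLp_wave hε (t, 0)).of_le hc.aestronglyMeasurable
        (ae_of_all _ fun ξ => (RCLike.norm_conj _).le)
    have hle : ∀ ξ, ‖w ξ * (starRingEnd ℂ) (wave ε (t, (0 : Rn n)) ξ)‖ ≤ ‖w ξ‖ := by
      intro ξ
      rw [norm_mul, RCLike.norm_conj, norm_wave]
      refine mul_le_of_le_one_right (norm_nonneg _) (Real.exp_le_one_iff.2 ?_)
      have : 0 ≤ ‖ξ‖ ^ 2 := by positivity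
      nlinarith
    have hG : MemLp (fun ξ => w ξ * (starRingEnd ℂ) (wave ε (t, (0 : Rn n)) ξ)) 2 :=
      (Lp.memLp w).of_le ((Lp.memLp w).1.mul hc.aestronglyMeasurable) (ae_of_all _ hle)
    have hG1 : Integrable (fun ξ => w ξ * (starRingEnd ℂ) (wave ε (t, (0 : Rn n)) ξ)) :=
      (Lp.memLp w).integrable_mul hL2
    simp_rw [inner_waveField_eq_fourierInv]
    rw [lintegral_enorm_fourierInv_sq hG1 hG]
    calc ∫⁻ ξ, ‖w ξ * (starRingEnd ℂ) (wave ε (t, (0 : Rn n)) ξ)‖ₑ ^ 2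
        ≤ ∫⁻ ξ, ‖w ξ‖ₑ ^ 2 := by
          refine lintegral_mono fun ξ => ?_
          gcongr
          exact enorm_le_iff_norm_le.2 (hle ξ)
      _ = _ := by rw [lintegral_enorm_sq_eq_toLp (Lp.memLp w), Lp.toLp_coeFn]
  decay := by
    intro t s x y hts
    have hd : 0 < |t - s| := abs_pos.2 (sub_ne_zero.2 hts)
    rw [← ofReal_norm, ← ENNReal.ofReal_pow (norm_nonneg _)]
    refine ENNReal.ofReal_le_ofReal ?_
    refine (pow_le_pow_left₀ (norm_nonneg _) (norm_inner_waveField_le hε (t, x) (s, y)) 2).trans ?_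
    set b : ℂ := 2 * ε - 4 * π ^ 2 * ((s : ℂ) - t) * Complex.I with hb
    have him : b.im = 4 * π ^ 2 * (t - s) := by
      have : b = ((2 * ε : ℝ) : ℂ) + ((4 * π ^ 2 * (t - s) : ℝ) : ℂ) * Complex.I := by
        rw [hb]; push_cast; ring
      rw [this]; simp [-Complex.ofReal_mul, -Complex.ofReal_pow, -Complex.ofReal_sub]
    have h1 : π * |t - s| ≤ ‖b‖ := by
      refine le_trans ?_ (Complex.abs_im_le_norm b)
      rw [him, abs_mul, abs_of_nonneg (a := 4 * π ^ 2) (by positivity)]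
      refine mul_le_mul_of_nonneg_right ?_ (abs_nonneg _)
      nlinarith [pi_gt_three]
    have h2 : π / ‖b‖ ≤ |t - s|⁻¹ := by
      rw [div_le_iff₀ (lt_of_lt_of_le (by positivity) h1)]
      calc π = |t - s|⁻¹ * (π * |t - s|) := by field_simp
        _ ≤ _ := by gcongr
    rw [← Real.rpow_natCast, ← Real.rpow_mul (by positivity)]
    norm_num
    rw [← inv_pow]
    exact pow_le_pow_left₀ (by positivity) h2 n

end WaveField

section Propagator

open FourierTransform ComplexInnerProductSpace Filter Topology

variable {n : ℕ}

lemma dotC_eq_inner (x ξ : Rn n) : dotC x ξ = (inner ℝ x ξ : ℝ) := by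
  rw [dotC, PiLp.inner_apply]
  congr 1
  exact Finset.sum_congr rfl fun i _ => by simp [mul_comm]

lemma FT_smul_eq_fourier (f : Rn n → ℂ) (w : Rn n) : FT f ((2 * π) • w) = 𝓕 f w := by
  rw [FT, Real.fourier_eq']
  refine integral_congr_ae (ae_of_all _ fun x => ?_)
  dsimp only
  rw [dotC_eq_inner, inner_smul_right, smul_eq_mul]
  congr 2
  push_cast; ring

lemma wave_zero_conj (t : ℝ) (x w : Rn n) :
    (starRingEnd ℂ) (wave 0 (t, x) w) = Complex.exp (Complex.I *
      (dotC x ((2 * π) • w) - (t : ℂ) * ((‖(2 * π) • w‖ : ℝ) : ℂ) ^ 2)) := by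
  rw [conj_wave, dotC_eq_inner, inner_smul_right, norm_smul, Real.norm_of_nonneg (by positivity)]
  congr 1
  push_cast; ring

lemma integral_rescale {F : Type*} [NormedAddCommGroup F] [NormedSpace ℝ F] (g : Rn n → F) :
    ((2 * π : ℝ) ^ (-(n : ℝ)) : ℝ) • ∫ ξ, g ξ = ∫ w, g ((2 * π) • w) := by
  rw [Measure.integral_comp_smul, finrank_euclideanSpace_fin, Real.rpow_neg (by positivity),
    Real.rpow_natCast, abs_of_nonneg (by positivity)]

lemma schrodinger_eq (f : Rn n → ℂ) (t : ℝ) (x : Rn n) :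
    schrodinger f t x = ∫ w, 𝓕 f w * (starRingEnd ℂ) (wave 0 (t, x) w) := by
  rw [schrodinger, prop, integral_rescale]
  refine integral_congr_ae (ae_of_all _ fun w => ?_)
  dsimp only
  rw [wave_zero_conj, FT_smul_eq_fourier, one_mul, mul_comm]

/-- The functions for which the integrals in the definition of the propagator converge. -/
def FourierIntegrable (f : Rn n → ℂ) : Prop := Integrable f ∧ Integrable (𝓕 f)

lemma continuous_wave_right (ε : ℝ) (z : ℝ × Rn n) : Continuous (wave ε z) := by
  unfold wave; fun_prop

lemma integrable_mul_conj_wave_iff {g : Rn n → ℂ} (z : ℝ × Rn n) :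
    Integrable (fun w => g w * (starRingEnd ℂ) (wave 0 z w)) ↔ Integrable g := by
  have hc := Complex.continuous_conj.comp (continuous_wave_right 0 z)
  have h1 : ∀ w, ‖wave 0 z w‖ = 1 := fun w => by rw [norm_wave]; simp
  constructor
  · intro h
    refine (h.mul_bdd (c := 1) (continuous_wave_right 0 z).aestronglyMeasurable
      (ae_of_all _ fun w => (h1 w).le)).congr (ae_of_all _ fun w => ?_)
    dsimp only
    rw [mul_assoc, mul_comm ((starRingEnd ℂ) _), Complex.mul_conj, Complex.normSq_eq_norm_sq, h1]
    simp
  · intro h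
    exact h.mul_bdd (c := 1) hc.aestronglyMeasurable
      (ae_of_all _ fun w => ((RCLike.norm_conj _).trans (h1 w)).le)

lemma schrodinger_eq_zero {f : Rn n → ℂ} (hf : ¬ FourierIntegrable f) (t : ℝ) (x : Rn n) :
    schrodinger f t x = 0 := by
  rw [schrodinger_eq]
  by_cases h : Integrable f
  · have h2 : ¬ Integrable (𝓕 f) := fun h2 => hf ⟨h, h2⟩
    exact integral_undef fun h3 => h2 ((integrable_mul_conj_wave_iff _).1 h3)
  · have h2 : ∀ w, 𝓕 f w = 0 := fun w => integral_undef fun h3 => h <|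
      (VectorFourier.fourierIntegral_convergent_iff (L := innerₗ (Rn n))
        Real.continuous_fourierChar continuous_inner w).1 h3
    simp [h2]

lemma continuous_schrodinger {f : Rn n → ℂ} (hf : FourierIntegrable f) :
    Continuous fun z : ℝ × Rn n => schrodinger f z.1 z.2 := by
  simp_rw [schrodinger_eq]
  refine continuous_of_dominated (bound := fun w => ‖𝓕 f w‖)
    (fun z => ((integrable_mul_conj_wave_iff z).2 hf.2).1)
    (fun z => ae_of_all _ fun w => ?_) hf.2.norm (ae_of_all _ fun w => ?_)
  · rw [norm_mul, RCLike.norm_conj, norm_wave]; simp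
  · unfold wave; fun_prop

lemma measurable_schrodinger (f : Rn n → ℂ) :
    Measurable fun z : ℝ × Rn n => schrodinger f z.1 z.2 := by
  by_cases h : FourierIntegrable f
  · exact (continuous_schrodinger h).measurable
  · simp_rw [schrodinger_eq_zero h]; exact measurable_const

lemma tendsto_inner_waveField {f : Rn n → ℂ} (hf : FourierIntegrable f) (hL2 : MemLp (𝓕 f) 2)
    {ε : ℕ → ℝ} (hε : ∀ k, 0 < ε k) (hlim : Tendsto ε atTop (𝓝 0)) (z : ℝ × Rn n) :
    Tendsto (fun k => ⟪waveField (hε k) z, hL2.toLp (𝓕 f)⟫) atTop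
      (𝓝 (schrodinger f z.1 z.2)) := by
  simp_rw [waveField, inner_toLp_eq, schrodinger_eq]
  refine tendsto_integral_of_dominated_convergence (fun w => ‖𝓕 f w‖)
    (fun k => hf.2.1.mul (Complex.continuous_conj.comp
      (continuous_wave_right (ε k) z)).aestronglyMeasurable) hf.2.norm
    (fun k => ae_of_all _ fun w => ?_) (ae_of_all _ fun w => ?_)
  · rw [norm_mul, RCLike.norm_conj, norm_wave]
    refine mul_le_of_le_one_right (norm_nonneg _) (Real.exp_le_one_iff.2 ?_)
    have := mul_nonneg (hε k).le (sq_nonneg ‖w‖)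
    linarith
  · have hc : Continuous fun e : ℝ => 𝓕 f w * (starRingEnd ℂ) (wave e z w) := by
      unfold wave; fun_prop
    exact (hc.tendsto 0).comp hlim

end Propagator

section Positive

open FourierTransform ComplexInnerProductSpace Filter Topology

variable {n : ℕ}

lemma mul_le_liminf_mul {a : ℝ≥0∞} {b : ℕ → ℝ≥0∞} (h : Tendsto b atTop (𝓝 a)) (c : ℝ≥0∞) :
    c * a ≤ liminf (fun k => c * b k) atTop := by
  rcases eq_or_ne a 0 with rfl | ha
  · simp
  · exact (ENNReal.Tendsto.const_mul h (Or.inl ha)).liminf_eq.ge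

lemma OS.OrthonormalL2.memLp {f : ℕ → Rn n → ℂ} (hf : OrthonormalL2 f) {j : ℕ}
    (hj : Integrable (f j)) : MemLp (f j) 2 := by
  rw [memLp_two_iff_integrable_sq_norm hj.1]
  have h1 : ∫ x, f j x * (starRingEnd ℂ) (f j x) ≠ 0 := by simp [hf j j]
  refine (Integrable.of_integral_ne_zero h1).norm.congr (ae_of_all _ fun x => ?_)
  dsimp only
  rw [norm_mul, RCLike.norm_conj, sq]

lemma sum_lintegral_schrodinger_le {V : ℝ × Rn n → ℝ≥0∞} (hn : 2 ≤ n)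
    (hV : AdmissibleWeight n (volume : Measure (Rn n)) V) {f : ℕ → Rn n → ℂ}
    (hf : OrthonormalL2 f) {e : ℝ} (he : 0 < e) (he' : e ≤ 1 / 2) (J : Finset ℕ)
    (hJ : ∀ j ∈ J, FourierIntegrable (f j)) :
    ∑ j ∈ J, ∫⁻ z, V z * ‖schrodinger (f j) z.1 z.2‖ₑ ^ 2 ≤
      2 * ENNReal.ofReal (levelConst n e * (J.card : ℝ) ^ (1 - gainExp n e / 2)) := by
  have hf2 : ∀ j : J, MemLp (f j) 2 := fun j => hf.memLp (hJ j j.2).1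
  have hF2 : ∀ j : J, MemLp (𝓕 (f j)) 2 := fun j => memLp_fourier (hJ j j.2).1 (hf2 j)
  set F : J → Lp ℂ 2 (volume : Measure (Rn n)) := fun j => (hF2 j).toLp _ with hFdef
  have hF : Orthonormal ℂ F := by
    rw [orthonormal_iff_ite]
    intro i j
    simp only [hFdef]
    rw [toLp_fourier_eq_fourier_toLp (hJ i i.2).1 (hf2 i),
      toLp_fourier_eq_fourier_toLp (hJ j j.2).1 (hf2 j), Lp.inner_fourier_eq, inner_toLp_eq,
      hf j i]
    refine if_congr ?_ rfl rfl
    rw [eq_comm, ← Subtype.ext_iff]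
  set ε : ℕ → ℝ := fun k => 1 / ((k : ℝ) + 1)
  have hε : ∀ k, 0 < ε k := fun k => by positivity
  have hlim : Tendsto ε atTop (𝓝 0) := tendsto_one_div_add_atTop_nhds_zero_nat
  set B := 2 * ENNReal.ofReal (levelConst n e * (J.card : ℝ) ^ (1 - gainExp n e / 2)) with hB
  set b : ℕ → ℝ × Rn n → ℝ≥0∞ := fun k z =>
    ∑ j : J, ‖⟪waveField (hε k) z, F j⟫‖ₑ ^ 2 with hb
  have hbm : ∀ k, Measurable (b k) := fun k => by
    refine Finset.measurable_fun_sum _ fun j _ => ?_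
    exact (((continuous_waveField (hε k)).inner continuous_const).enorm.measurable.pow_const 2)
  have hmj : ∀ k (j : J), Measurable fun z => V z * ‖⟪waveField (hε k) z, F j⟫‖ₑ ^ 2 :=
    fun k j => hV.meas.mul
      (((continuous_waveField (hε k)).inner continuous_const).enorm.measurable.pow_const 2)
  have hk : ∀ k, ∫⁻ z, V z * b k z ≤ B := by
    intro k
    have h1 := (dispersive_waveField (hε k)).weighted_le hn hV hF he he'
    rw [Fintype.card_coe, ← hB] at h1
    refine le_trans (le_of_eq ?_) h1
    simp only [hb, Finset.mul_sum]
    rw [lintegral_finsetSum _ fun j _ => hmj k j]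
    rfl
  have hsm : ∀ j, Measurable fun z : ℝ × Rn n => V z * ‖schrodinger (f j) z.1 z.2‖ₑ ^ 2 :=
    fun j => hV.meas.mul ((measurable_schrodinger (f j)).enorm.pow_const 2)
  calc ∑ j ∈ J, ∫⁻ z, V z * ‖schrodinger (f j) z.1 z.2‖ₑ ^ 2
      = ∫⁻ z, V z * ∑ j : J, ‖schrodinger (f j) z.1 z.2‖ₑ ^ 2 := by
        simp only [Finset.mul_sum]
        rw [lintegral_finsetSum _ fun (j : J) _ => hsm j, Finset.sum_coe_sort J
          (fun j => ∫⁻ z : ℝ × Rn n, V z * ‖schrodinger (f j) z.1 z.2‖ₑ ^ 2)]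
    _ ≤ ∫⁻ z, liminf (fun k => V z * b k z) atTop := by
        refine lintegral_mono fun z => mul_le_liminf_mul ?_ _
        refine tendsto_finsetSum _ fun j _ => ?_
        exact ((ENNReal.continuous_pow 2).tendsto _).comp
          (tendsto_inner_waveField (hJ j j.2) (hF2 j) hε hlim z).enorm
    _ ≤ liminf (fun k => ∫⁻ z, V z * b k z) atTop :=
        lintegral_liminf_le fun k => hV.meas.mul (hbm k)
    _ ≤ B := liminf_le_of_le (by isBoundedDefault) fun c hc => by
        obtain ⟨k, hk'⟩ := hc.exists
        exact hk'.trans (hk k)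

lemma exists_gainExp {α : ℝ} (hn : 2 ≤ n) (hα : α < ((n : ℝ) + 1) / n) :
    ∃ e : ℝ, 0 < e ∧ e ≤ 1 / 2 ∧ α * (1 - gainExp n e / 2) < 1 := by
  have hn' : (2 : ℝ) ≤ n := by exact_mod_cast hn
  have hc : ContinuousAt (fun e => α * (1 - gainExp n e / 2)) 0 := by
    unfold gainExp
    refine continuousAt_const.mul (continuousAt_const.sub (ContinuousAt.div_const
      (ContinuousAt.div (by fun_prop) (by fun_prop) ?_) 2))
    have : (0 : ℝ) < (1 - 0) + ((n : ℝ) - 1) / 2 := by linarith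
    exact this.ne'
  have h0 : α * (1 - gainExp n 0 / 2) < 1 := by
    have : 1 - gainExp n 0 / 2 = n / (n + 1) := by
      have h : (1 - 0 : ℝ) + ((n : ℝ) - 1) / 2 ≠ 0 := by linarith
      have h' : (n : ℝ) + 1 ≠ 0 := by positivity
      rw [gainExp, eq_div_iff h', show (1 - 0 : ℝ) + ((n : ℝ) - 1) / 2 = ((n : ℝ) + 1) / 2 by ring]
      field_simp; ring
    rw [this]
    rw [lt_div_iff₀ (by positivity)] at hα
    rw [← mul_div_assoc, div_lt_one (by positivity)]
    exact hα
  have h1 := (hc.eventually_lt continuousAt_const h0).filter_mono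
    (nhdsWithin_le_nhds (s := Ioi 0))
  obtain ⟨e, he, he2⟩ := (h1.and (Ioc_mem_nhdsGT (by norm_num : (0 : ℝ) < 1 / 2))).exists
  exact ⟨e, he2.1, he2.2, he⟩

lemma lintegral_weight_density_le {α e : ℝ} (hn : 2 ≤ n) (hα : 1 ≤ α) (he : 0 < e)
    (he' : e ≤ 1 / 2) {f : ℕ → Rn n → ℂ} (hf : OrthonormalL2 f) {a : ℕ → ℝ≥0∞}
    (ha : ∑' j, a j ^ α ≠ ∞) {V : ℝ × Rn n → ℝ≥0∞}
    (hV : AdmissibleWeight n (volume : Measure (Rn n)) V) :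
    ∫⁻ z, V z * ∑' j, a j * ‖schrodinger (f j) z.1 z.2‖ₑ ^ 2 ≤
      sumConst α (1 - gainExp n e / 2) * (2 * ENNReal.ofReal (levelConst n e)) *
        (∑' j, a j ^ α) ^ (1 / α) := by
  have hκ : 0 < 1 - gainExp n e / 2 := by linarith [gainExp_lt_one hn (show e < 1 by linarith)]
  have hsm : ∀ j, Measurable fun z : ℝ × Rn n => V z * ‖schrodinger (f j) z.1 z.2‖ₑ ^ 2 :=
    fun j => hV.meas.mul ((measurable_schrodinger (f j)).enorm.pow_const 2)
  have h1 : ∫⁻ z, V z * ∑' j, a j * ‖schrodinger (f j) z.1 z.2‖ₑ ^ 2 =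
      ∑' j, a j * ∫⁻ z : ℝ × Rn n, V z * ‖schrodinger (f j) z.1 z.2‖ₑ ^ 2 := by
    simp_rw [← ENNReal.tsum_mul_left, mul_left_comm (V _)]
    rw [lintegral_tsum fun j => ((hsm j).const_mul _).aemeasurable]
    exact tsum_congr fun j => lintegral_const_mul _ (hsm j)
  rw [h1]
  refine tsum_mul_le_of_sum_le (by linarith) hκ ha fun J => ?_
  classical
  have h2 : ∑ j ∈ J, ∫⁻ z : ℝ × Rn n, V z * ‖schrodinger (f j) z.1 z.2‖ₑ ^ 2 =
      ∑ j ∈ J with FourierIntegrable (f j),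
        ∫⁻ z : ℝ × Rn n, V z * ‖schrodinger (f j) z.1 z.2‖ₑ ^ 2 := by
    refine (Finset.sum_filter_of_ne fun j _ h => ?_).symm
    by_contra hbad
    simp [schrodinger_eq_zero hbad] at h
  rw [h2]
  refine (sum_lintegral_schrodinger_le hn hV hf he he' _
    fun j hj => (Finset.mem_filter.1 hj).2).trans ?_
  rw [ENNReal.ofReal_mul' (by positivity), mul_assoc]
  gcongr
  rw [← ENNReal.ofReal_rpow_of_nonneg (by positivity) hκ.le, ENNReal.ofReal_natCast]
  refine ENNReal.rpow_le_rpow ?_ hκ.le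
  exact_mod_cast Finset.card_filter_le _ _

lemma enorm_density_le (lam : ℕ → ℝ) (f : ℕ → Rn n → ℂ) (t : ℝ) (x : Rn n) :
    ‖density lam f t x‖ₑ ≤ ∑' j, ENNReal.ofReal |lam j| * ‖schrodinger (f j) t x‖ₑ ^ 2 := by
  refine enorm_tsum_le_tsum_enorm.trans (le_of_eq (tsum_congr fun j => ?_))
  rw [enorm_mul, Real.enorm_eq_ofReal_abs, enorm_pow, enorm_norm]

lemma mixedLp_endpoint {E : Type*} [NormedAddCommGroup E] (hn : 2 ≤ n) (u : ℝ → Rn n → E) :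
    mixedLp (ENNReal.ofReal (((n : ℝ) + 1) / n)) (ENNReal.ofReal (((n : ℝ) + 1) / ((n : ℝ) - 1))) u
      = mixedEnergy n volume (fun z => ‖u z.1 z.2‖ₑ) ^ ((n : ℝ) / (n + 1)) := by
  have hn' : (2 : ℝ) ≤ n := by exact_mod_cast hn
  have hp : 0 < ((n : ℝ) + 1) / (n - 1) := by apply div_pos <;> linarith
  have hq : 0 < ((n : ℝ) + 1) / n := by positivity
  have h1 : (n : ℝ) - 1 ≠ 0 := by linarith
  rw [mixedLp, eLp, if_neg ENNReal.ofReal_ne_top, ENNReal.toReal_ofReal hq.le, mixedEnergy]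
  congr 1
  · refine lintegral_congr fun t => ?_
    rw [eLpNorm_eq_lintegral_rpow_enorm_toReal (by simpa using hp) ENNReal.ofReal_ne_top,
      ENNReal.toReal_ofReal hp.le, ← ENNReal.rpow_mul]
    congr 1; field_simp
  · field_simp

theorem mixedLp_density_le {α : ℝ} (hn : 2 ≤ n) (hα : 1 ≤ α) (hα' : α < ((n : ℝ) + 1) / n) :
    ∃ C : ℝ, 0 < C ∧ ∀ (f : ℕ → Rn n → ℂ) (lam : ℕ → ℝ),
      OrthonormalL2 f → seqNormE (ENNReal.ofReal α) lam ≠ ∞ →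
      mixedLp (ENNReal.ofReal (((n : ℝ) + 1) / n)) (ENNReal.ofReal (((n : ℝ) + 1) / ((n : ℝ) - 1)))
          (density lam f)
        ≤ ENNReal.ofReal C * seqNormE (ENNReal.ofReal α) lam := by
  have hn' : (2 : ℝ) ≤ n := by exact_mod_cast hn
  obtain ⟨e, he, he', hακ⟩ := exists_gainExp hn hα'
  set C₀ := sumConst α (1 - gainExp n e / 2) * (2 * ENNReal.ofReal (levelConst n e)) with hC₀
  have hC₀top : C₀ ≠ ∞ := ENNReal.mul_ne_top (sumConst_lt_top hακ).ne
    (ENNReal.mul_ne_top (by norm_num) ENNReal.ofReal_ne_top)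
  refine ⟨C₀.toReal + 1, by positivity, fun f lam hf hlam => ?_⟩
  have hseq : seqNormE (ENNReal.ofReal α) lam =
      (∑' j, ENNReal.ofReal |lam j| ^ α) ^ (1 / α) := by
    rw [seqNormE, if_neg ENNReal.ofReal_ne_top, ENNReal.toReal_ofReal (by linarith)]
  have hfin : ∑' j, ENNReal.ofReal |lam j| ^ α ≠ ∞ := by
    intro h
    rw [hseq, h, ENNReal.top_rpow_of_pos (by positivity)] at hlam
    exact hlam rfl
  set F : ℝ × Rn n → ℝ≥0∞ := fun z =>
    ∑' j, ENNReal.ofReal |lam j| * ‖schrodinger (f j) z.1 z.2‖ₑ ^ 2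
  have hFm : Measurable F := Measurable.tsum fun j =>
    ((measurable_schrodinger (f j)).enorm.pow_const 2).const_mul _
  rw [mixedLp_endpoint hn]
  calc mixedEnergy n volume (fun z => ‖density lam f z.1 z.2‖ₑ) ^ ((n : ℝ) / (n + 1))
      ≤ mixedEnergy n volume F ^ ((n : ℝ) / (n + 1)) := by
        have h1 : (0 : ℝ) ≤ ((n : ℝ) + 1) / (n - 1) := by apply div_nonneg <;> linarith
        have h2 : (0 : ℝ) ≤ ((n : ℝ) - 1) / n := by apply div_nonneg <;> linarith
        unfold mixedEnergy
        gcongr with t x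
        exact enorm_density_le lam f t x
    _ ≤ C₀ * (∑' j, ENNReal.ofReal |lam j| ^ α) ^ (1 / α) :=
        mixedEnergy_le hn hFm fun V hV => lintegral_weight_density_le hn hα he he' hf hfin hV
    _ ≤ _ := by
        rw [hseq]
        gcongr
        rw [← ENNReal.ofReal_toReal hC₀top]
        exact ENNReal.ofReal_le_ofReal (by simp)

end Positive

section Packets

open FourierTransform ComplexInnerProductSpace SchwartzMap

variable {n : ℕ}

/-- The cut-off profile of the wave packets, before normalization in `L²`. -/
def packetBump (n : ℕ) : ContDiffBump (0 : Rn n) where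
  rIn := 1 / (2000 * (n + 1))
  rOut := 1 / (1000 * (n + 1))
  rIn_pos := by positivity
  rIn_lt_rOut := by
    rw [div_lt_div_iff₀ (by positivity) (by positivity)]; nlinarith [(n.cast_nonneg : (0 : ℝ) ≤ n)]

/-- The `L²`-normalized profile of the wave packets. -/
def packetProfile (w : Rn n) : ℝ := packetBump n w / √(∫ v, packetBump n v ^ 2)

lemma integral_packetBump_sq_pos : 0 < ∫ v, packetBump n v ^ 2 := by
  refine Continuous.integral_pos_of_hasCompactSupport_nonneg_nonzero (x := 0)
    ((packetBump n).continuous.pow 2) ?_ (fun _ => sq_nonneg _) ?_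
  · exact (packetBump n).hasCompactSupport.comp_left (g := fun r : ℝ => r ^ 2) (by simp)
  · have h := (packetBump n).pos_of_mem_ball (Metric.mem_ball_self (packetBump n).rOut_pos)
    positivity

lemma packetProfile_nonneg (w : Rn n) : 0 ≤ packetProfile w :=
  div_nonneg (packetBump n).nonneg (Real.sqrt_nonneg _)

lemma integral_packetProfile_sq : ∫ w : Rn n, packetProfile w ^ 2 = 1 := by
  have h := integral_packetBump_sq_pos (n := n)
  simp_rw [packetProfile, div_pow, Real.sq_sqrt h.le]
  rw [integral_div, div_self h.ne']

lemma contDiff_packetProfile {m : ℕ∞} : ContDiff ℝ m (packetProfile : Rn n → ℝ) :=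
  (packetBump n).contDiff.div_const _

lemma hasCompactSupport_packetProfile : HasCompactSupport (packetProfile : Rn n → ℝ) :=
  (packetBump n).hasCompactSupport.comp_left (g := fun r : ℝ => r / √(∫ v, packetBump n v ^ 2))
    (by simp)

lemma packetProfile_eq_zero {w : Rn n} (hw : 1 / (1000 * ((n : ℝ) + 1)) ≤ ‖w‖) :
    packetProfile w = 0 := by
  rw [packetProfile, (packetBump n).zero_of_le_dist (by simpa [packetBump] using hw), zero_div]

lemma integral_packetProfile_pos : 0 < ∫ w : Rn n, packetProfile w := by
  refine Continuous.integral_pos_of_hasCompactSupport_nonneg_nonzero (x := 0)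
    (contDiff_packetProfile (m := 0)).continuous hasCompactSupport_packetProfile packetProfile_nonneg ?_
  have h := (packetBump n).pos_of_mem_ball (Metric.mem_ball_self (packetBump n).rOut_pos)
  have h2 := integral_packetBump_sq_pos (n := n)
  unfold packetProfile
  positivity

lemma contDiff_wave {m : WithTop ℕ∞} (ε : ℝ) (z : ℝ × Rn n) : ContDiff ℝ m (wave ε z) := by
  have h1 : ContDiff ℝ m fun w : Rn n => ((‖w‖ ^ 2 : ℝ) : ℂ) :=
    Complex.ofRealCLM.contDiff.comp (contDiff_norm_sq ℝ)
  have h2 : ContDiff ℝ m fun w : Rn n => ((inner ℝ z.2 w : ℝ) : ℂ) :=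
    Complex.ofRealCLM.contDiff.comp (contDiff_const.inner ℝ contDiff_id)
  simp only [Complex.ofReal_pow] at h1
  exact ((contDiff_const.mul h1).add (contDiff_const.mul h2)).cexp

/-- The wave packet with frequency `μ`, focusing at the origin at time `t`, on the frequency
side. -/
def packet (μ : Rn n) (t : ℝ) : 𝓢(Rn n, ℂ) :=
  HasCompactSupport.toSchwartzMap
    (f := fun w => (packetProfile (w - μ) : ℂ) * wave 0 (t, 0) w)
    (((hasCompactSupport_packetProfile.comp_homeomorph (Homeomorph.subRight μ)).comp_left
      (g := fun r : ℝ => (r : ℂ)) rfl).mul_right)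
    ((Complex.ofRealCLM.contDiff.comp (contDiff_packetProfile.comp
      (contDiff_id.sub contDiff_const))).mul (contDiff_wave _ _))

lemma packet_apply (μ : Rn n) (t : ℝ) (w : Rn n) :
    packet μ t w = (packetProfile (w - μ) : ℂ) * wave 0 (t, 0) w := rfl

lemma integral_packet_mul_conj_self (μ : Rn n) (t : ℝ) :
    ∫ w, packet μ t w * (starRingEnd ℂ) (packet μ t w) = 1 := by
  have h : ∀ w, packet μ t w * (starRingEnd ℂ) (packet μ t w) =
      ((packetProfile (w - μ) ^ 2 : ℝ) : ℂ) := by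
    intro w
    rw [Complex.mul_conj, Complex.normSq_eq_norm_sq, packet_apply, norm_mul, norm_wave]
    simp
  simp_rw [h]
  rw [integral_complex_ofReal, integral_sub_right_eq_self (fun w : Rn n => packetProfile w ^ 2),
    integral_packetProfile_sq, Complex.ofReal_one]

lemma integral_packet_mul_conj {μ μ' : Rn n} (hμ : 1 ≤ ‖μ - μ'‖) (t t' : ℝ) :
    ∫ w, packet μ t w * (starRingEnd ℂ) (packet μ' t' w) = 0 := by
  refine integral_eq_zero_of_ae (ae_of_all _ fun w => ?_)
  dsimp only [Pi.zero_apply]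
  rw [packet_apply, packet_apply]
  have hδ : 1 / (1000 * ((n : ℝ) + 1)) ≤ 1 / 2 := by
    rw [div_le_div_iff₀ (by positivity) (by positivity)]
    nlinarith [(n.cast_nonneg : (0 : ℝ) ≤ n)]
  rcases le_total (1 / 2) ‖w - μ‖ with h | h
  · rw [packetProfile_eq_zero (hδ.trans h)]; simp
  · have h3 : ‖μ - μ'‖ ≤ ‖w - μ'‖ + ‖w - μ‖ := by
      rw [← norm_neg (w - μ)]
      calc ‖μ - μ'‖ = ‖(w - μ') + -(w - μ)‖ := by congr 1; abel
        _ ≤ _ := norm_add_le _ _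
    rw [packetProfile_eq_zero (w := w - μ') (hδ.trans (by linarith))]; simp

/-- On the unit ball, during a time interval of length `≲ 1 / ‖μ‖` after the focusing time, the
wave packet is bounded below. -/
lemma le_norm_integral_packet {μ x : Rn n} {t t₀ : ℝ} (hx : ‖x‖ ≤ 1) (ht : |t₀ - t| ≤ 1)
    (hμ : |t₀ - t| * ‖μ‖ ≤ 2 * n) :
    (∫ w : Rn n, packetProfile w) / 2 ≤
      ‖∫ w, packet μ t₀ w * (starRingEnd ℂ) (wave 0 (t, x) w)‖ := by
  set θ : Rn n → ℝ := fun η => 4 * π ^ 2 * (t₀ - t) * (2 * inner ℝ μ η + ‖η‖ ^ 2) +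
    2 * π * inner ℝ x η with hθ
  set c : ℝ := 4 * π ^ 2 * (t₀ - t) * ‖μ‖ ^ 2 + 2 * π * inner ℝ x μ with hc
  have hθc : Continuous θ := by fun_prop
  have h1 : ∀ w, packet μ t₀ w * (starRingEnd ℂ) (wave 0 (t, x) w) =
      Complex.exp (c * Complex.I) *
        ((packetProfile (w - μ) : ℂ) * Complex.exp (θ (w - μ) * Complex.I)) := by
    intro w
    rw [packet_apply, mul_assoc, wave_mul_conj, mul_left_comm, ← Complex.exp_add]
    congr 2
    obtain ⟨η, rfl⟩ : ∃ η, w = η + μ := ⟨w - μ, by simp⟩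
    simp only [add_sub_cancel_right, sub_zero, hθ, hc, inner_add_right]
    have h : ((‖η + μ‖ : ℝ) : ℂ) ^ 2 =
        (‖η‖ : ℂ) ^ 2 + 2 * ((inner ℝ μ η : ℝ) : ℂ) + (‖μ‖ : ℂ) ^ 2 := by
      rw [real_inner_comm]
      exact_mod_cast norm_add_sq_real η μ
    rw [h]
    push_cast; ring
  simp_rw [h1]
  rw [integral_const_mul, norm_mul, Complex.norm_exp_ofReal_mul_I, one_mul,
    integral_sub_right_eq_self (fun w => (packetProfile w : ℂ) * Complex.exp (θ w * Complex.I))]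
  have hint : Integrable fun w : Rn n => (packetProfile w : ℂ) * Complex.exp (θ w * Complex.I) := by
    refine Continuous.integrable_of_hasCompactSupport ?_ ?_
    · have := (contDiff_packetProfile (n := n) (m := 0)).continuous
      fun_prop
    · exact (hasCompactSupport_packetProfile.comp_left (g := fun r : ℝ => (r : ℂ)) rfl).mul_right
  refine le_trans ?_ (Complex.re_le_norm _)
  have hre : (∫ w : Rn n, (packetProfile w : ℂ) * Complex.exp (θ w * Complex.I)).re =
      ∫ w, packetProfile w * Real.cos (θ w) := by
    refine (integral_re hint).symm.trans (integral_congr_ae (ae_of_all _ fun w => ?_))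
    dsimp only
    rw [RCLike.re_eq_complex_re, Complex.re_ofReal_mul, Complex.exp_ofReal_mul_I_re]
  have hφc := (contDiff_packetProfile (n := n) (m := 0)).continuous
  have hφi := hφc.integrable_of_hasCompactSupport hasCompactSupport_packetProfile (μ := volume)
  rw [hre, ← integral_div]
  refine integral_mono (hφi.div_const _) ((hφc.mul (Real.continuous_cos.comp hθc)
    ).integrable_of_hasCompactSupport hasCompactSupport_packetProfile.mul_right) fun w => ?_
  dsimp only
  rcases le_total (1 / (1000 * ((n : ℝ) + 1))) ‖w‖ with hw | hw
  · simp [packetProfile_eq_zero hw]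
  have hn0 : (0 : ℝ) ≤ n := n.cast_nonneg
  set δ := 1 / (1000 * ((n : ℝ) + 1)) with hδ
  have hδ0 : 0 < δ := by positivity
  have hδ1 : δ ≤ 1 := by
    rw [hδ, div_le_one (by positivity)]; linarith
  have hθ1 : |θ w| ≤ 1 := by
    have h2 : |(t₀ - t) * (2 * inner ℝ μ w + ‖w‖ ^ 2)| ≤ 4 * n * δ + δ := by
      have h3 : |inner ℝ μ w| ≤ ‖μ‖ * δ :=
        (abs_real_inner_le_norm μ w).trans (by gcongr)
      have h4 : ‖w‖ ^ 2 ≤ δ := by nlinarith [norm_nonneg w]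
      calc |(t₀ - t) * (2 * inner ℝ μ w + ‖w‖ ^ 2)|
          ≤ |t₀ - t| * (2 * |inner ℝ μ w| + ‖w‖ ^ 2) := by
            rw [abs_mul]
            gcongr
            refine (abs_add_le _ _).trans (le_of_eq ?_)
            rw [abs_mul, abs_two, abs_of_nonneg (sq_nonneg ‖w‖)]
        _ ≤ |t₀ - t| * (2 * (‖μ‖ * δ) + δ) := by gcongr
        _ = 2 * (|t₀ - t| * ‖μ‖) * δ + |t₀ - t| * δ := by ring
        _ ≤ 2 * (2 * n) * δ + 1 * δ := by gcongr
        _ = _ := by ring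
    have h5 : |inner ℝ x w| ≤ δ := (abs_real_inner_le_norm x w).trans (by nlinarith [norm_nonneg w])
    have hπ : π ^ 2 ≤ 10 := by nlinarith [Real.pi_lt_d2, Real.pi_pos]
    have hπ' : π ≤ 4 := Real.pi_le_four
    calc |θ w| ≤ 4 * π ^ 2 * |(t₀ - t) * (2 * inner ℝ μ w + ‖w‖ ^ 2)| + 2 * π * |inner ℝ x w| := by
          rw [hθ]
          dsimp only
          rw [mul_assoc (4 * π ^ 2)]
          refine (abs_add_le _ _).trans (le_of_eq ?_)
          rw [abs_mul, abs_mul (2 * π), abs_of_nonneg (by positivity : 0 ≤ 4 * π ^ 2),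
            abs_of_nonneg (by positivity : 0 ≤ 2 * π)]
      _ ≤ 4 * 10 * (4 * n * δ + δ) + 2 * 4 * δ := by gcongr
      _ = (160 * n + 48) * δ := by ring
      _ ≤ 1 := by
        rw [hδ, mul_one_div, div_le_one (by positivity)]; linarith
  have hcos := Real.one_sub_sq_div_two_le_cos (x := θ w)
  have hsq : θ w ^ 2 ≤ 1 := (sq_le_one_iff_abs_le_one _).2 hθ1
  nlinarith [packetProfile_nonneg w]

end Packets

section Systems

open FourierTransform ComplexInnerProductSpace SchwartzMap Filter Topology

variable {n : ℕ}

/-- The free evolution of the function with Fourier transform `s`. -/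
def evolution (s : 𝓢(Rn n, ℂ)) (z : ℝ × Rn n) : ℂ := schrodinger (𝓕⁻ s : 𝓢(Rn n, ℂ)) z.1 z.2

lemma fourier_coe_fourierInv (s : 𝓢(Rn n, ℂ)) :
    𝓕 ((𝓕⁻ s : 𝓢(Rn n, ℂ)) : Rn n → ℂ) = s := by
  rw [← fourier_coe, FourierTransform.fourier_fourierInv_eq]

lemma fourierIntegrable_fourierInv (s : 𝓢(Rn n, ℂ)) :
    FourierIntegrable ((𝓕⁻ s : 𝓢(Rn n, ℂ)) : Rn n → ℂ) :=
  ⟨(𝓕⁻ s).integrable, by rw [fourier_coe_fourierInv]; exact s.integrable⟩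

lemma evolution_eq (s : 𝓢(Rn n, ℂ)) (z : ℝ × Rn n) :
    evolution s z = ∫ w, s w * (starRingEnd ℂ) (wave 0 z w) := by
  rw [evolution, schrodinger_eq, fourier_coe_fourierInv]

lemma tendsto_inner_waveField_toLp (s : 𝓢(Rn n, ℂ)) {ε : ℕ → ℝ} (hε : ∀ k, 0 < ε k)
    (hlim : Tendsto ε atTop (𝓝 0)) (z : ℝ × Rn n) :
    Tendsto (fun k => ⟪waveField (hε k) z, s.toLp 2⟫) atTop (𝓝 (evolution s z)) := by
  have hm : MemLp (𝓕 ((𝓕⁻ s : 𝓢(Rn n, ℂ)) : Rn n → ℂ)) 2 := by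
    rw [fourier_coe_fourierInv]; exact s.memLp 2
  have h := tendsto_inner_waveField (fourierIntegrable_fourierInv s) hm hε hlim z
  simp only [fourier_coe_fourierInv] at h
  exact h

lemma orthonormalL2_fourierInv {s : ℕ → 𝓢(Rn n, ℂ)}
    (hs : Orthonormal ℂ fun j => (s j).toLp 2 (volume : Measure (Rn n))) :
    OrthonormalL2 fun j => ((𝓕⁻ (s j) : 𝓢(Rn n, ℂ)) : Rn n → ℂ) := by
  intro j k
  have h1 := inner_toLp_eq ((𝓕⁻ (s k)).memLp 2) ((𝓕⁻ (s j)).memLp 2)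
  rw [← h1]
  change ⟪(𝓕⁻ (s k)).toLp 2, (𝓕⁻ (s j)).toLp 2⟫ = _
  rw [← Lp.inner_fourier_eq, SchwartzMap.toLp_fourier_eq, SchwartzMap.toLp_fourier_eq,
    FourierTransform.fourier_fourierInv_eq, FourierTransform.fourier_fourierInv_eq,
    orthonormal_iff_ite.1 hs]
  simp [eq_comm]

/-- Among orthonormal systems in a fixed space, orthonormal bases have the largest square sum of
coefficients. -/
lemma sum_norm_inner_sq_le {H ι κ : Type*} [NormedAddCommGroup H] [InnerProductSpace ℂ H]
    [Fintype ι] [Fintype κ] {E : Submodule ℂ H} (b : OrthonormalBasis ι ℂ E) {g : κ → H}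
    (hg : Orthonormal ℂ g) (hgE : ∀ j, g j ∈ E) (x : H) :
    ∑ j, ‖⟪x, g j⟫‖ ^ 2 ≤ ∑ i, ‖⟪x, (b i : H)⟫‖ ^ 2 := by
  have : FiniteDimensional ℂ E := b.toBasis.finiteDimensional_of_finite
  set v := E.orthogonalProjectionOnto x
  have hproj : ∀ y : E, ⟪x, (y : H)⟫ = ⟪v, y⟫ := fun y =>
    (Submodule.inner_orthogonalProjectionOnto_eq_of_mem_right y x).symm
  simp_rw [hproj]
  rw [b.sum_sq_norm_inner_left v]
  have h : Orthonormal ℂ fun j => (⟨g j, hgE j⟩ : E) :=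
    (E.subtypeₗᵢ.orthonormal_comp_iff).1 hg
  calc ∑ j, ‖⟪x, g j⟫‖ ^ 2 = ∑ j, ‖⟪(⟨g j, hgE j⟩ : E), v⟫‖ ^ 2 := by
        refine Finset.sum_congr rfl fun j _ => ?_
        rw [norm_inner_symm _ v, ← hproj]
    _ ≤ ‖v‖ ^ 2 := h.sum_inner_products_le v

/-- Among orthonormal systems in a fixed space, orthonormal bases maximize the density. -/
lemma sum_evolution_le {ι κ : Type*} [Fintype ι] [Fintype κ]
    {E : Submodule ℂ (Lp ℂ 2 (volume : Measure (Rn n)))} (b : OrthonormalBasis ι ℂ E)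
    {u : ι → 𝓢(Rn n, ℂ)} (hu : ∀ i, (u i).toLp 2 = (b i : Lp ℂ 2 (volume : Measure (Rn n))))
    {g : κ → 𝓢(Rn n, ℂ)} (hg : Orthonormal ℂ fun j => (g j).toLp 2 (volume : Measure (Rn n)))
    (hgE : ∀ j, (g j).toLp 2 volume ∈ E) (z : ℝ × Rn n) :
    ∑ j, ‖evolution (g j) z‖ ^ 2 ≤ ∑ i, ‖evolution (u i) z‖ ^ 2 := by
  have hε : ∀ k : ℕ, (0 : ℝ) < 1 / (k + 1) := fun k => by positivity
  have hlim := tendsto_one_div_add_atTop_nhds_zero_nat (𝕜 := ℝ)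
  refine le_of_tendsto_of_tendsto'
    (tendsto_finsetSum Finset.univ fun j _ =>
      ((tendsto_inner_waveField_toLp (g j) hε hlim z).norm.pow 2))
    (tendsto_finsetSum Finset.univ fun i _ =>
      ((tendsto_inner_waveField_toLp (u i) hε hlim z).norm.pow 2)) fun k => ?_
  have h := sum_norm_inner_sq_le b hg hgE (waveField (hε k) z)
  refine h.trans (le_of_eq (Finset.sum_congr rfl fun i _ => ?_))
  rw [hu]

lemma exists_toLp_eq_of_mem_span {ι : Type*} {s : ι → 𝓢(Rn n, ℂ)}
    {v : Lp ℂ 2 (volume : Measure (Rn n))}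
    (hv : v ∈ Submodule.span ℂ (Set.range fun i => (s i).toLp 2)) :
    ∃ u : 𝓢(Rn n, ℂ), u.toLp 2 = v := by
  have h : Submodule.span ℂ (Set.range fun i => (s i).toLp 2) ≤
      LinearMap.range (toLpCLM ℂ ℂ 2 (volume : Measure (Rn n))).toLinearMap := by
    rw [Submodule.span_le]
    rintro _ ⟨i, rfl⟩
    exact ⟨s i, rfl⟩
  exact h hv

/-- Orthonormalization of mutually orthogonal finite blocks. -/
theorem exists_orthonormal_blocks {κ : ℕ → Type*} [∀ k, Fintype (κ k)] [∀ k, Nonempty (κ k)]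
    (s : ∀ k, κ k → 𝓢(Rn n, ℂ)) (hs0 : ∀ k i, (s k i).toLp 2 (volume : Measure (Rn n)) ≠ 0)
    (hs : ∀ k l, k ≠ l → ∀ i j, ⟪(s k i).toLp 2 (volume : Measure (Rn n)), (s l j).toLp 2⟫ = 0) :
    ∃ (d : ℕ → ℕ) (u : (Σ k, Fin (d k)) → 𝓢(Rn n, ℂ)), (∀ k, 0 < d k) ∧
      (∀ k, d k ≤ Fintype.card (κ k)) ∧
      (Orthonormal ℂ fun a => (u a).toLp 2 (volume : Measure (Rn n))) ∧
      ∀ (k : ℕ) {ι : Type} [Fintype ι] (g : ι → κ k),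
        (Orthonormal ℂ fun j => (s k (g j)).toLp 2 (volume : Measure (Rn n))) →
        ∀ z, ∑ j, ‖evolution (s k (g j)) z‖ ^ 2 ≤ ∑ b, ‖evolution (u ⟨k, b⟩) z‖ ^ 2 := by
  set E : ℕ → Submodule ℂ (Lp ℂ 2 (volume : Measure (Rn n))) := fun k =>
    Submodule.span ℂ (Set.range fun i => (s k i).toLp 2) with hE
  have hfin : ∀ k, FiniteDimensional ℂ (E k) := fun k =>
    FiniteDimensional.span_of_finite ℂ (Set.finite_range _)
  have hmem : ∀ k i, (s k i).toLp 2 volume ∈ E k := fun k i => Submodule.subset_span ⟨i, rfl⟩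
  have horth : OrthogonalFamily ℂ (fun k => E k) fun k => (E k).subtypeₗᵢ := by
    refine OrthogonalFamily.of_pairwise fun k l hkl => ?_
    rw [hE]
    refine Submodule.isOrtho_span.2 ?_
    rintro _ ⟨i, rfl⟩ _ ⟨j, rfl⟩
    exact hs k l hkl i j
  set b := fun k => stdOrthonormalBasis ℂ (E k)
  have hrep : ∀ a : Σ k, Fin (Module.finrank ℂ (E k)), ∃ u : 𝓢(Rn n, ℂ),
      u.toLp 2 = (b a.1 a.2 : Lp ℂ 2 (volume : Measure (Rn n))) := fun a =>
    exists_toLp_eq_of_mem_span (b a.1 a.2).2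
  choose u hu using hrep
  refine ⟨fun k => Module.finrank ℂ (E k), u, fun k => ?_, fun k => finrank_range_le_card _, ?_, ?_⟩
  · obtain ⟨i⟩ := (inferInstance : Nonempty (κ k))
    have : Nontrivial (E k) := ⟨⟨(s k i).toLp 2, hmem k i⟩, 0, fun h =>
      hs0 k i (congrArg Subtype.val h)⟩
    exact Module.finrank_pos
  · have h := horth.orthonormal_sigma_orthonormal
      (α := fun k => Fin (Module.finrank ℂ (E k))) fun k => (b k).orthonormal
    rw [funext hu]
    exact h
  · intro k ι _ g hg z
    exact sum_evolution_le (b k) (fun i => hu ⟨k, i⟩) hg (fun j => hmem k (g j)) z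

end Systems

section Blocks

open FourierTransform ComplexInnerProductSpace SchwartzMap Filter Topology

variable {n : ℕ}

/-- The frequencies of the `k`-th block: the integer points of the cube `[2ᵏ, 2ᵏ⁺¹)ⁿ`. -/
def blockFreq (k : ℕ) (ν : Fin n → Fin (2 ^ k)) : Rn n :=
  WithLp.toLp 2 fun j => ((2 ^ k + (ν j : ℕ) : ℕ) : ℝ)

/-- The wave packets of the `k`-th block, focusing at the times in `[0, 1) ∩ 2⁻ᵏℤ`. -/
def blockPacket (k : ℕ) (i : (Fin n → Fin (2 ^ k)) × Fin (2 ^ k)) : 𝓢(Rn n, ℂ) :=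
  packet (blockFreq k i.1) ((i.2 : ℕ) / 2 ^ k)

lemma one_le_norm_blockFreq_sub {k l : ℕ} {ν : Fin n → Fin (2 ^ k)} {ν' : Fin n → Fin (2 ^ l)}
    {j : Fin n} (h : 2 ^ k + (ν j : ℕ) ≠ 2 ^ l + (ν' j : ℕ)) :
    1 ≤ ‖blockFreq k ν - blockFreq l ν'‖ := by
  refine le_trans ?_ (PiLp.norm_apply_le _ j)
  have h1 : (1 : ℤ) ≤ |((2 ^ k + (ν j : ℕ) : ℕ) : ℤ) - ((2 ^ l + (ν' j : ℕ) : ℕ) : ℤ)| :=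
    Int.one_le_abs (sub_ne_zero.2 (by exact_mod_cast h))
  rw [PiLp.sub_apply, Real.norm_eq_abs]
  have h2 := Int.cast_le (R := ℝ).2 h1
  rwa [Int.cast_abs, Int.cast_sub, Int.cast_natCast, Int.cast_natCast, Int.cast_one] at h2

lemma norm_blockFreq_le (k : ℕ) (ν : Fin n → Fin (2 ^ k)) :
    ‖blockFreq k ν‖ ≤ 2 * n * 2 ^ k := by
  rw [EuclideanSpace.norm_eq]
  refine Real.sqrt_le_iff.2 ⟨by positivity, ?_⟩
  have h : ∀ j, ‖(blockFreq k ν) j‖ ^ 2 ≤ (2 * 2 ^ k) ^ 2 := by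
    intro j
    have h1 : ((ν j : ℕ) : ℝ) ≤ 2 ^ k := by exact_mod_cast (ν j).2.le
    simp only [blockFreq, Real.norm_eq_abs, sq_abs]
    push_cast
    gcongr
    linarith
  rcases Nat.eq_zero_or_pos n with rfl | hn
  · simp
  have hn' : (1 : ℝ) ≤ n := by exact_mod_cast hn
  calc ∑ j, ‖(blockFreq k ν) j‖ ^ 2 ≤ ∑ _j : Fin n, (2 * 2 ^ k : ℝ) ^ 2 :=
        Finset.sum_le_sum fun j _ => h j
    _ = n * (2 * 2 ^ k : ℝ) ^ 2 := by simp
    _ ≤ n ^ 2 * (2 * 2 ^ k : ℝ) ^ 2 := by gcongr; nlinarith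
    _ = _ := by ring

lemma inner_packet_toLp (μ μ' : Rn n) (t t' : ℝ) :
    ⟪(packet μ t).toLp 2 (volume : Measure (Rn n)), (packet μ' t').toLp 2⟫ =
      ∫ w, packet μ' t' w * (starRingEnd ℂ) (packet μ t w) :=
  inner_toLp_eq _ _

lemma inner_blockPacket_of_ne (hn : 0 < n) {k l : ℕ} (hkl : k ≠ l) (i j) :
    ⟪(blockPacket (n := n) k i).toLp 2 (volume : Measure (Rn n)),
      (blockPacket (n := n) l j).toLp 2⟫ = 0 := by
  have key : ∀ {k l : ℕ} (a : Fin (2 ^ k)) (b : Fin (2 ^ l)), k < l →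
      2 ^ k + (a : ℕ) ≠ 2 ^ l + (b : ℕ) := by
    intro k l a b h
    have h1 := a.2
    have h2 : 2 ^ (k + 1) ≤ 2 ^ l := Nat.pow_le_pow_right two_pos h
    rw [pow_succ] at h2
    omega
  refine (inner_packet_toLp _ _ _ _).trans (integral_packet_mul_conj
    (one_le_norm_blockFreq_sub (j := ⟨0, hn⟩) ?_) _ _)
  rcases lt_or_gt_of_ne hkl with h | h
  · exact (key _ _ h).symm
  · exact key _ _ h

lemma orthonormal_blockPacket (k : ℕ) (i : Fin (2 ^ k)) :
    Orthonormal ℂ fun ν : Fin n → Fin (2 ^ k) =>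
      (blockPacket k (ν, i)).toLp 2 (volume : Measure (Rn n)) := by
  rw [orthonormal_iff_ite]
  intro ν ν'
  refine (inner_packet_toLp _ _ _ _).trans ?_
  split_ifs with h
  · rw [h]; exact integral_packet_mul_conj_self _ _
  · obtain ⟨j, hj⟩ := Function.ne_iff.1 h
    refine integral_packet_mul_conj (one_le_norm_blockFreq_sub (j := j) fun h' => hj ?_) _ _
    exact Fin.ext (Nat.add_left_cancel h'.symm)

lemma le_sum_evolution_blockPacket (k : ℕ) {t : ℝ} (ht : t ∈ Ico (0 : ℝ) 1) {x : Rn n}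
    (hx : ‖x‖ ≤ 1) : ∃ i : Fin (2 ^ k),
    (2 : ℝ) ^ (k * n) * ((∫ w : Rn n, packetProfile w) / 2) ^ 2 ≤
      ∑ ν : Fin n → Fin (2 ^ k), ‖evolution (blockPacket k (ν, i)) (t, x)‖ ^ 2 := by
  have h2 : (0 : ℝ) < 2 ^ k := by positivity
  have hlt : ⌊t * 2 ^ k⌋₊ < 2 ^ k := by
    rw [Nat.floor_lt (mul_nonneg ht.1 h2.le)]
    push_cast
    nlinarith [ht.2]
  refine ⟨⟨⌊t * 2 ^ k⌋₊, hlt⟩, ?_⟩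
  have h3 : |(⌊t * 2 ^ k⌋₊ : ℝ) / 2 ^ k - t| ≤ 1 / 2 ^ k := by
    have h4 := Nat.floor_le (mul_nonneg ht.1 h2.le)
    have h5 := Nat.lt_floor_add_one (t * 2 ^ k)
    have h6 : (⌊t * 2 ^ k⌋₊ : ℝ) / 2 ^ k - t = -((t * 2 ^ k - ⌊t * 2 ^ k⌋₊) / 2 ^ k) := by
      field_simp; ring
    rw [h6, abs_neg, abs_of_nonneg (div_nonneg (by linarith) h2.le)]
    gcongr
    linarith
  have h1 : ∀ ν : Fin n → Fin (2 ^ k), ((∫ w : Rn n, packetProfile w) / 2) ^ 2 ≤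
      ‖evolution (blockPacket k (ν, ⟨⌊t * 2 ^ k⌋₊, hlt⟩)) (t, x)‖ ^ 2 := by
    intro ν
    have h0 := integral_packetProfile_pos (n := n)
    rw [evolution_eq]
    refine pow_le_pow_left₀ (by positivity) (le_norm_integral_packet hx (h3.trans ?_) ?_) 2
    · exact div_le_one_of_le₀ (one_le_pow₀ one_le_two) h2.le
    · calc |(⌊t * 2 ^ k⌋₊ : ℝ) / 2 ^ k - t| * ‖blockFreq k ν‖
          ≤ 1 / 2 ^ k * (2 * n * 2 ^ k) := by
            gcongr
            exact norm_blockFreq_le k ν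
        _ = 2 * n := by field_simp
  calc (2 : ℝ) ^ (k * n) * ((∫ w : Rn n, packetProfile w) / 2) ^ 2
      = ∑ _ν : Fin n → Fin (2 ^ k), ((∫ w : Rn n, packetProfile w) / 2) ^ 2 := by
        simp [pow_mul]
    _ ≤ _ := Finset.sum_le_sum fun ν _ => h1 ν

/-- There is an orthonormal system, decomposed into blocks of at most `2ᵏ⁽ⁿ⁺¹⁾` functions, such
that each block has density `≳ 2ᵏⁿ` on the product of the unit time interval and the unit ball. -/
theorem exists_large_density_blocks (hn : 0 < n) :
    ∃ (c : ℝ) (d : ℕ → ℕ) (e : ℕ ≃ Σ k, Fin (d k)) (f : ℕ → Rn n → ℂ), 0 < c ∧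
      (∀ k, d k ≤ 2 ^ (k * (n + 1))) ∧ OrthonormalL2 f ∧
      ∀ k, ∀ t ∈ Ico (0 : ℝ) 1, ∀ x : Rn n, ‖x‖ ≤ 1 →
        2 ^ (k * n) * c ≤ ∑ b, ‖schrodinger (f (e.symm ⟨k, b⟩)) t x‖ ^ 2 := by
  obtain ⟨d, u, hd0, hd, hu, hmax⟩ := exists_orthonormal_blocks
    (κ := fun k => (Fin n → Fin (2 ^ k)) × Fin (2 ^ k)) (fun k i => blockPacket (n := n) k i)
    (fun k i => ((orthonormal_blockPacket k i.2).ne_zero i.1))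
    (fun k l hkl i j => inner_blockPacket_of_ne hn hkl i j)
  have : Infinite (Σ k, Fin (d k)) := Infinite.of_injective (fun k => ⟨k, ⟨0, hd0 k⟩⟩)
    fun k l h => congrArg Sigma.fst h
  obtain ⟨e⟩ := nonempty_equiv_of_countable (α := ℕ) (β := Σ k, Fin (d k))
  refine ⟨((∫ w : Rn n, packetProfile w) / 2) ^ 2, d, e, fun j => (𝓕⁻ (u (e j)) : 𝓢(Rn n, ℂ)),
    by have := integral_packetProfile_pos (n := n); positivity, fun k => (hd k).trans (le_of_eq ?_),
    orthonormalL2_fourierInv (hu.comp e e.injective), fun k t ht x hx => ?_⟩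
  · simp [mul_add, pow_add, pow_mul]
  · obtain ⟨i, hi⟩ := le_sum_evolution_blockPacket k ht hx
    refine hi.trans ((hmax k (fun ν => (ν, i)) (orthonormal_blockPacket k i) (t, x)).trans
      (le_of_eq (Finset.sum_congr rfl fun b _ => ?_)))
    dsimp only
    rw [Equiv.apply_symm_apply]
    rfl

end Blocks

section Failure

open Filter Topology

variable {n : ℕ}

lemma le_mixedEnergy_of_le {F : ℝ × Rn n → ℝ≥0∞} {a : ℝ≥0∞} (hn : 2 ≤ n)
    (h : ∀ t ∈ Ico (0 : ℝ) 1, ∀ x : Rn n, ‖x‖ ≤ 1 → a ≤ F (t, x)) :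
    (a ^ (((n : ℝ) + 1) / (n - 1)) * volume (Metric.closedBall (0 : Rn n) 1)) ^
      (((n : ℝ) - 1) / n) ≤ mixedEnergy n volume F := by
  have hn' : (2 : ℝ) ≤ n := by exact_mod_cast hn
  have hp : 0 ≤ ((n : ℝ) + 1) / (n - 1) := div_nonneg (by linarith) (by linarith)
  have hr : 0 ≤ ((n : ℝ) - 1) / n := div_nonneg (by linarith) (by linarith)
  calc (a ^ (((n : ℝ) + 1) / (n - 1)) * volume (Metric.closedBall (0 : Rn n) 1)) ^
      (((n : ℝ) - 1) / n)
      = ∫⁻ _t in Ico (0 : ℝ) 1, (∫⁻ _x in Metric.closedBall (0 : Rn n) 1,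
          a ^ (((n : ℝ) + 1) / (n - 1))) ^ (((n : ℝ) - 1) / n) := by
        simp
    _ ≤ ∫⁻ t in Ico (0 : ℝ) 1, (∫⁻ x in Metric.closedBall (0 : Rn n) 1,
          F (t, x) ^ (((n : ℝ) + 1) / (n - 1))) ^ (((n : ℝ) - 1) / n) := by
        refine setLIntegral_mono' measurableSet_Ico fun t ht => ENNReal.rpow_le_rpow
          (setLIntegral_mono' measurableSet_closedBall fun x hx => ENNReal.rpow_le_rpow
            (h t ht x (by simpa using hx)) hp) hr
    _ ≤ ∫⁻ t in Ico (0 : ℝ) 1, (∫⁻ x, F (t, x) ^ (((n : ℝ) + 1) / (n - 1))) ^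
          (((n : ℝ) - 1) / n) :=
        lintegral_mono fun t => ENNReal.rpow_le_rpow (setLIntegral_le_lintegral _ _) hr
    _ ≤ _ := setLIntegral_le_lintegral _ _

/-- The weights `2⁻ᵏⁿ` on the first `K` blocks of a system. -/
def blockWeight (n : ℕ) {d : ℕ → ℕ} (e : ℕ ≃ Σ k, Fin (d k)) (K j : ℕ) : ℝ :=
  if (e j).1 < K then ((2 : ℝ) ^ ((e j).1 * n))⁻¹ else 0

lemma blockWeight_nonneg {d : ℕ → ℕ} (e : ℕ ≃ Σ k, Fin (d k)) (K j : ℕ) :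
    0 ≤ blockWeight n e K j := by
  unfold blockWeight; split_ifs <;> positivity

lemma tsum_eq_sum_blocks {M : Type*} [AddCommMonoid M] [TopologicalSpace M] {d : ℕ → ℕ}
    (e : ℕ ≃ Σ k, Fin (d k)) {K : ℕ} {F : ℕ → M} (hF : ∀ j, K ≤ (e j).1 → F j = 0) :
    ∑' j, F j = ∑ k ∈ Finset.range K, ∑ b, F (e.symm ⟨k, b⟩) := by
  rw [← e.symm.tsum_eq, tsum_eq_sum (s := (Finset.range K).sigma fun _ => Finset.univ),
    Finset.sum_sigma]
  rintro ⟨k, b⟩ h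
  refine hF _ ?_
  simpa using h

lemma le_density_blockWeight {d : ℕ → ℕ} (e : ℕ ≃ Σ k, Fin (d k)) (K : ℕ) {f : ℕ → Rn n → ℂ}
    {c t : ℝ} {x : Rn n}
    (h : ∀ k, 2 ^ (k * n) * c ≤ ∑ b, ‖schrodinger (f (e.symm ⟨k, b⟩)) t x‖ ^ 2) :
    K * c ≤ density (blockWeight n e K) f t x := by
  rw [density, density2, tsum_eq_sum_blocks e (K := K)
    fun j hj => by simp [blockWeight, not_lt.2 hj]]
  calc K * c = ∑ k ∈ Finset.range K, c := by simp
    _ ≤ _ := Finset.sum_le_sum fun k hk => ?_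
  have h1 : ∀ b, blockWeight n e K (e.symm ⟨k, b⟩) = ((2 : ℝ) ^ (k * n))⁻¹ := fun b => by
    simp [blockWeight, Finset.mem_range.1 hk]
  simp_rw [h1]
  rw [← Finset.mul_sum, inv_mul_eq_div, le_div_iff₀ (by positivity), mul_comm]
  exact h k

lemma tsum_blockWeight_rpow_le (hn : 0 < n) {d : ℕ → ℕ} (hd : ∀ k, d k ≤ 2 ^ (k * (n + 1)))
    (e : ℕ ≃ Σ k, Fin (d k)) (K : ℕ) :
    ∑' j, ENNReal.ofReal |blockWeight n e K j| ^ (((n : ℝ) + 1) / n) ≤ K := by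
  have hn' : (0 : ℝ) < n := by exact_mod_cast hn
  have hq : 0 < ((n : ℝ) + 1) / n := by positivity
  rw [tsum_eq_sum_blocks e (K := K) fun j hj => by
    simp [blockWeight, not_lt.2 hj, ENNReal.zero_rpow_of_pos hq]]
  calc _ ≤ ∑ k ∈ Finset.range K, (1 : ℝ≥0∞) := Finset.sum_le_sum fun k hk => ?_
    _ = K := by simp
  have h1 : ∀ b, ENNReal.ofReal |blockWeight n e K (e.symm ⟨k, b⟩)| ^ (((n : ℝ) + 1) / n) =
      ENNReal.ofReal ((2 : ℝ) ^ (k * (n + 1)))⁻¹ := fun b => by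
    rw [abs_of_nonneg (blockWeight_nonneg _ _ _), blockWeight, if_pos (by simpa using hk),
      ENNReal.ofReal_rpow_of_nonneg (by positivity) hq.le, Real.inv_rpow (by positivity),
      ← Real.rpow_natCast, ← Real.rpow_natCast, ← Real.rpow_mul two_pos.le]
    congr 3
    rw [Equiv.apply_symm_apply]
    push_cast
    field_simp
  simp_rw [h1]
  rw [Finset.sum_const, Finset.card_univ, Fintype.card_fin, nsmul_eq_mul,
    ← ENNReal.ofReal_natCast, ← ENNReal.ofReal_mul (by positivity)]
  refine ENNReal.ofReal_le_one.2 ?_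
  rw [mul_inv_le_iff₀ (by positivity), one_mul]
  exact_mod_cast hd k

/-- At the endpoint, the orthonormal Strichartz estimate fails for the critical summability
exponent. -/
theorem not_exists_mixedLp_density_le (hn : 2 ≤ n) :
    ¬ ∃ C : ℝ, 0 < C ∧ ∀ (f : ℕ → Rn n → ℂ) (lam : ℕ → ℝ),
      OrthonormalL2 f → seqNormE (ENNReal.ofReal (((n : ℝ) + 1) / n)) lam ≠ ∞ →
      mixedLp (ENNReal.ofReal (((n : ℝ) + 1) / n)) (ENNReal.ofReal (((n : ℝ) + 1) / ((n : ℝ) - 1)))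
          (density lam f)
        ≤ ENNReal.ofReal C * seqNormE (ENNReal.ofReal (((n : ℝ) + 1) / n)) lam := by
  rintro ⟨C, hC, hle⟩
  have hn' : (2 : ℝ) ≤ n := by exact_mod_cast hn
  have hq : 0 < ((n : ℝ) + 1) / n := by positivity
  set s : ℝ := (n : ℝ) / (n + 1) with hs
  have hs0 : 0 < s := by positivity
  have hs1 : s < 1 := by rw [hs, div_lt_one (by positivity)]; linarith
  obtain ⟨c, d, e, f, hc, hd, hf, hdens⟩ := exists_large_density_blocks (n := n) (by omega)
  set V := volume (Metric.closedBall (0 : Rn n) 1) with hV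
  have hV0 : V ≠ 0 := (Metric.measure_closedBall_pos _ _ one_pos).ne'
  have hVt : V ≠ ∞ := measure_closedBall_lt_top.ne
  set r : ℝ := ((n : ℝ) - 1) / n * s with hr
  have hr0 : 0 ≤ r := mul_nonneg (div_nonneg (by linarith) (by linarith)) hs0.le
  set v := (V ^ r).toReal with hv
  have hv0 : 0 < v := ENNReal.toReal_pos (by simp [hV0, hVt]) (ENNReal.rpow_ne_top_of_nonneg hr0 hVt)
  have key : ∀ K : ℕ, (K : ℝ) * (c * v) ≤ C * (K : ℝ) ^ s := by
    intro K
    have hsum := tsum_blockWeight_rpow_le (by omega) hd e K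
    have hnorm : seqNormE (ENNReal.ofReal (((n : ℝ) + 1) / n)) (blockWeight n e K) ≤
        (K : ℝ≥0∞) ^ s := by
      rw [seqNormE, if_neg ENNReal.ofReal_ne_top, ENNReal.toReal_ofReal hq.le, one_div_div]
      exact ENNReal.rpow_le_rpow hsum hs0.le
    have hK : (K : ℝ≥0∞) ^ s ≠ ∞ := ENNReal.rpow_ne_top_of_nonneg hs0.le (ENNReal.natCast_ne_top K)
    have h1 := hle f (blockWeight n e K) hf (ne_top_of_le_ne_top hK hnorm)
    rw [mixedLp_endpoint hn] at h1
    have h2 := le_mixedEnergy_of_le (n := n)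
      (F := fun z => ‖density (blockWeight n e K) f z.1 z.2‖ₑ) (a := ENNReal.ofReal (K * c)) hn
      fun t ht x hx => by
        have h3 := le_density_blockWeight e K (f := f) (c := c) (t := t) (x := x)
          fun k => hdens k t ht x hx
        rw [Real.enorm_eq_ofReal_abs]
        exact ENNReal.ofReal_le_ofReal (h3.trans (le_abs_self _))
    have h4 : ENNReal.ofReal (K * c) * V ^ r ≤ ENNReal.ofReal C * (K : ℝ≥0∞) ^ s := by
      refine le_trans (le_of_eq ?_) ((ENNReal.rpow_le_rpow h2 hs0.le).trans
        (h1.trans (by gcongr)))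
      rw [← ENNReal.rpow_mul, ← hr, ENNReal.mul_rpow_of_nonneg _ _ hr0, ← ENNReal.rpow_mul]
      have : ((n : ℝ) + 1) / (n - 1) * r = 1 := by
        have : (n : ℝ) - 1 ≠ 0 := by linarith
        rw [hr, hs]; field_simp
      rw [this, ENNReal.rpow_one]
    have h5 := ENNReal.toReal_mono (ENNReal.mul_ne_top ENNReal.ofReal_ne_top hK) h4
    rw [ENNReal.toReal_mul, ENNReal.toReal_mul, ENNReal.toReal_ofReal (by positivity),
      ENNReal.toReal_ofReal hC.le, ← ENNReal.toReal_rpow (K : ℝ≥0∞),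
      ENNReal.toReal_natCast] at h5
    rwa [← mul_assoc]
  have hlim : Tendsto (fun K : ℕ => (K : ℝ) ^ (1 - s)) atTop atTop :=
    (tendsto_rpow_atTop (by linarith)).comp tendsto_natCast_atTop_atTop
  obtain ⟨K, hK, hK0⟩ := ((hlim.eventually_gt_atTop (C / (c * v))).and
    (eventually_gt_atTop 0)).exists
  have hK' : (0 : ℝ) < K := by exact_mod_cast hK0
  have h := key K
  rw [div_lt_iff₀ (by positivity)] at hK
  have hKs : (K : ℝ) = (K : ℝ) ^ (1 - s) * (K : ℝ) ^ s := by
    rw [← Real.rpow_add hK']; simp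
  have hpos : 0 < (K : ℝ) ^ s := by positivity
  refine absurd h (not_le.2 ?_)
  calc C * (K : ℝ) ^ s < (K : ℝ) ^ (1 - s) * (c * v) * (K : ℝ) ^ s := by gcongr
    _ = (K : ℝ) ^ (1 - s) * (K : ℝ) ^ s * (c * v) := by ring
    _ = K * (c * v) := by rw [← hKs]

end Failure

/-- At the endpoint `A`, i.e. `p = (n+1)/(n-1)`, `q = (n+1)/n`, the
orthonormal Strichartz estimate holds for every `α < (n+1)/n` and fails for
`α = (n+1)/n` (for `n ≥ 2`). -/
theorem endpoint_A (n : ℕ) (hn : 2 ≤ n) :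
    (∀ α : ℝ, 1 ≤ α → α < ((n : ℝ) + 1) / n →
      ∃ C : ℝ, 0 < C ∧ ∀ (f : ℕ → Rn n → ℂ) (lam : ℕ → ℝ),
        OrthonormalL2 f → seqNormE (ENNReal.ofReal α) lam ≠ ∞ →
        mixedLp (ENNReal.ofReal (((n : ℝ) + 1) / n)) (ENNReal.ofReal (((n : ℝ) + 1) / ((n : ℝ) - 1)))
            (density lam f)
          ≤ ENNReal.ofReal C * seqNormE (ENNReal.ofReal α) lam) ∧
    ¬ ∃ C : ℝ, 0 < C ∧ ∀ (f : ℕ → Rn n → ℂ) (lam : ℕ → ℝ),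
        OrthonormalL2 f → seqNormE (ENNReal.ofReal (((n : ℝ) + 1) / n)) lam ≠ ∞ →
        mixedLp (ENNReal.ofReal (((n : ℝ) + 1) / n)) (ENNReal.ofReal (((n : ℝ) + 1) / ((n : ℝ) - 1)))
            (density lam f)
          ≤ ENNReal.ofReal C * seqNormE (ENNReal.ofReal (((n : ℝ) + 1) / n)) lam := by
  exact ⟨fun α h1 h2 => mixedLp_density_le hn h1 h2, not_exists_mixedLp_density_le hn⟩
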